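/- arXiv:1911.08643 — 2 statements merged into one kernel-verified Lean document; each statement's English description precedes it below -/
import Mathlib

section
/- Let a ∈ (0,1), γ ∈ (1,∞), and s > (a/4)(1 - 1/γ). Then the maximal operator P*_{a,γ} f(x) = sup_{0<t<1} |P^t_{a,γ} f(x)| satisfies the global L² bound ‖P*_{a,γ} f‖_{L²(ℝ)} ≲ ‖f‖_{H^s(ℝ)} for all f ∈ H^s(ℝ). -/
open MeasureTheory

/-- Fourier transform with the normalization `f(x) = ∫ f̂(ξ) e^{ixξ} dξ`. -/
noncomputable def ftransform (f : ℝ → ℂ) (ξ : ℝ) : ℂ :=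
  (1 / (2 * Real.pi)) * ∫ x : ℝ, f x * Complex.exp (-Complex.I * ((x * ξ : ℝ) : ℂ))

/-- The fractional Schrödinger evolution with complex time `g(t) = t + i t^γ`,
applied to a function with Fourier transform `fhat`. -/
noncomputable def Pop (a γ : ℝ) (fhat : ℝ → ℂ) (t x : ℝ) : ℂ :=
  ∫ ξ : ℝ, fhat ξ *
    Complex.exp (Complex.I * ((t * |ξ| ^ a : ℝ) : ℂ) - ((t ^ γ * |ξ| ^ a : ℝ) : ℂ)) *
    Complex.exp (Complex.I * ((x * ξ : ℝ) : ℂ))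

/-- The maximal operator `P*_{a,γ} f(x) = sup_{0<t<1} |P^t_{a,γ} f(x)|`. -/
noncomputable def Pstar (a γ : ℝ) (fhat : ℝ → ℂ) (x : ℝ) : ℝ :=
  ⨆ t : Set.Ioo (0 : ℝ) 1, ‖Pop a γ fhat t x‖



/-- Integration by parts twice. -/
lemma ibp_twice {α β : ℝ} (hαβ : α ≤ β) (p p1 p2 : ℝ → ℂ) (F0 F1 F2 F3 : ℝ → ℂ) (D B m : ℝ)
    (hp : ∀ u ∈ Set.Icc α β, HasDerivAt p (p1 u) u)
    (hp1 : ∀ u ∈ Set.Icc α β, HasDerivAt p1 (p2 u) u)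
    (hp2 : ContinuousOn p2 (Set.Icc α β))
    (hpα : p α = 0) (hpβ : p β = 0) (hp1α : p1 α = 0) (hp1β : p1 β = 0)
    (hF0 : ∀ u ∈ Set.Icc α β, HasDerivAt F0 (F1 u) u)
    (hF1 : ∀ u ∈ Set.Icc α β, HasDerivAt F1 (F2 u) u)
    (hF2 : ∀ u ∈ Set.Icc α β, HasDerivAt F2 (F3 u) u)
    (hF3 : ContinuousOn F3 (Set.Icc α β))
    (hm : 0 < m) (hB : 0 ≤ B) (hD : 0 ≤ D)
    (bp : ∀ u ∈ Set.Icc α β, ‖p u‖ ≤ D) (bp1 : ∀ u ∈ Set.Icc α β, ‖p1 u‖ ≤ D)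
    (bp2 : ∀ u ∈ Set.Icc α β, ‖p2 u‖ ≤ D)
    (re : ∀ u ∈ Set.Icc α β, (F0 u).re ≤ 0)
    (b1 : ∀ u ∈ Set.Icc α β, m ≤ ‖F1 u‖)
    (b2 : ∀ u ∈ Set.Icc α β, ‖F2 u‖ ≤ B * ‖F1 u‖)
    (b3 : ∀ u ∈ Set.Icc α β, ‖F3 u‖ ≤ B * ‖F1 u‖) :
    ‖∫ u in α..β, p u * Complex.exp (F0 u)‖ ≤ D * (1 + 4 * B + 3 * B ^ 2) * (β - α) / m ^ 2 := by
  have huI : Set.uIcc α β = Set.Icc α β := Set.uIcc_of_le hαβ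
  have hne : ∀ u ∈ Set.Icc α β, F1 u ≠ 0 := fun u hu h => by
    have := b1 u hu; rw [h, norm_zero] at this; linarith
  set q : ℝ → ℂ := fun u => p u / F1 u
  set q1 : ℝ → ℂ := fun u => (p1 u * F1 u - p u * F2 u) / F1 u ^ 2
  set r : ℝ → ℂ := fun u => q1 u / F1 u
  set r1 : ℝ → ℂ := fun u => p2 u / F1 u ^ 2 - 3 * p1 u * F2 u / F1 u ^ 3 - p u * F3 u / F1 u ^ 3
    + 3 * p u * F2 u ^ 2 / F1 u ^ 4
  have hq : ∀ u ∈ Set.Icc α β, HasDerivAt q (q1 u) u := fun u hu =>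
    (hp u hu).div (hF1 u hu) (hne u hu)
  have hr : ∀ u ∈ Set.Icc α β, HasDerivAt r (r1 u) u := fun u hu => by
    have h := ((((hp1 u hu).mul (hF1 u hu)).sub ((hp u hu).mul (hF2 u hu))).div
      ((hF1 u hu).pow 2) (pow_ne_zero 2 (hne u hu))).div (hF1 u hu) (hne u hu)
    refine h.congr_deriv ?_
    have := hne u hu
    simp only [r1, Pi.mul_apply, Pi.sub_apply, Pi.pow_apply, Pi.div_apply]
    field_simp
    ring
  have he : ∀ u ∈ Set.Icc α β, HasDerivAt (fun u => Complex.exp (F0 u))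
      (F1 u * Complex.exp (F0 u)) u := fun u hu => by
    have := (hF0 u hu).cexp; rwa [mul_comm] at this
  have cp : ContinuousOn p (Set.Icc α β) := fun u hu => (hp u hu).continuousAt.continuousWithinAt
  have cp1 : ContinuousOn p1 (Set.Icc α β) := fun u hu => (hp1 u hu).continuousAt.continuousWithinAt
  have cF1 : ContinuousOn F1 (Set.Icc α β) := fun u hu => (hF1 u hu).continuousAt.continuousWithinAt
  have cF2 : ContinuousOn F2 (Set.Icc α β) := fun u hu => (hF2 u hu).continuousAt.continuousWithinAt
  have ce : ContinuousOn (fun u => Complex.exp (F0 u)) (Set.Icc α β) :=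
    fun u hu => (he u hu).continuousAt.continuousWithinAt
  have cq1 : ContinuousOn q1 (Set.Icc α β) := ((cp1.mul cF1).sub (cp.mul cF2)).div (cF1.pow 2)
    fun u hu => pow_ne_zero 2 (hne u hu)
  have cr1 : ContinuousOn r1 (Set.Icc α β) := by
    refine ((((hp2.div (cF1.pow 2) ?_)).sub (((continuousOn_const.mul cp1).mul cF2).div
      (cF1.pow 3) ?_)).sub ((cp.mul hF3).div (cF1.pow 3) ?_)).add
      (((continuousOn_const.mul cp).mul (cF2.pow 2)).div (cF1.pow 4) ?_) <;>
    exact fun u hu => pow_ne_zero _ (hne u hu)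
  have cFe : ContinuousOn (fun u => F1 u * Complex.exp (F0 u)) (Set.Icc α β) := cF1.mul ce
  have e1 : ∫ u in α..β, p u * Complex.exp (F0 u) = - ∫ u in α..β, q1 u * Complex.exp (F0 u) := by
    have := intervalIntegral.integral_mul_deriv_eq_deriv_mul (a := α) (b := β) (u := q) (u' := q1)
      (v := fun u => Complex.exp (F0 u)) (v' := fun u => F1 u * Complex.exp (F0 u))
      (by rw [huI]; exact hq) (by rw [huI]; exact he)
      (by apply ContinuousOn.intervalIntegrable; rw [huI]; exact cq1)
      (by apply ContinuousOn.intervalIntegrable; rw [huI]; exact cFe)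
    simp only [q, hpα, hpβ, zero_div, zero_mul, sub_zero, zero_sub] at this
    rw [← this]
    apply intervalIntegral.integral_congr
    intro u hu
    rw [huI] at hu
    have := hne u hu
    simp only
    field_simp
  have e2 : ∫ u in α..β, q1 u * Complex.exp (F0 u) = - ∫ u in α..β, r1 u * Complex.exp (F0 u) := by
    have := intervalIntegral.integral_mul_deriv_eq_deriv_mul (a := α) (b := β) (u := r) (u' := r1)
      (v := fun u => Complex.exp (F0 u)) (v' := fun u => F1 u * Complex.exp (F0 u))
      (by rw [huI]; exact hr) (by rw [huI]; exact he)
      (by apply ContinuousOn.intervalIntegrable; rw [huI]; exact cr1)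
      (by apply ContinuousOn.intervalIntegrable; rw [huI]; exact cFe)
    simp only [r, q1, hpα, hpβ, hp1α, hp1β, zero_div, zero_mul, sub_zero, zero_sub] at this
    rw [← this]
    apply intervalIntegral.integral_congr
    intro u hu
    rw [huI] at hu
    have := hne u hu
    simp only [q1]
    field_simp
  rw [e1, e2, neg_neg]
  have bd : ∀ u ∈ Set.uIoc α β, ‖r1 u * Complex.exp (F0 u)‖ ≤
      D * (1 + 4 * B + 3 * B ^ 2) / m ^ 2 := by
    intro u hu
    rw [Set.uIoc_of_le hαβ] at hu
    have hu := Set.Ioc_subset_Icc_self hu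
    set y := ‖F1 u‖ with hy
    have hmy := b1 u hu
    have hy0 : 0 < y := hm.trans_le hmy
    have i1 : ‖p2 u / F1 u ^ 2‖ ≤ D / y ^ 2 := by
      rw [norm_div, norm_pow]; gcongr; exact bp2 u hu
    have i2 : ‖3 * p1 u * F2 u / F1 u ^ 3‖ ≤ 3 * D * B / y ^ 2 := by
      rw [norm_div, norm_pow, norm_mul, norm_mul, ← hy]
      calc _ ≤ 3 * D * (B * y) / y ^ 3 := by
            gcongr
            · simp
            · exact bp1 u hu
            · exact b2 u hu
        _ = _ := by field_simp
    have i3 : ‖p u * F3 u / F1 u ^ 3‖ ≤ D * B / y ^ 2 := by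
      rw [norm_div, norm_pow, norm_mul, ← hy]
      calc _ ≤ D * (B * y) / y ^ 3 := by
            gcongr
            · exact bp u hu
            · exact b3 u hu
        _ = _ := by field_simp
    have i4 : ‖3 * p u * F2 u ^ 2 / F1 u ^ 4‖ ≤ 3 * D * B ^ 2 / y ^ 2 := by
      rw [norm_div, norm_pow, norm_mul, norm_mul, norm_pow, ← hy]
      calc _ ≤ 3 * D * (B * y) ^ 2 / y ^ 4 := by
            gcongr
            · simp
            · exact bp u hu
            · exact b2 u hu
        _ = _ := by field_simp
    have i5 : ‖Complex.exp (F0 u)‖ ≤ 1 := by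
      rw [Complex.norm_exp]; exact Real.exp_le_one_iff.2 (re u hu)
    calc ‖r1 u * Complex.exp (F0 u)‖ ≤ ‖r1 u‖ * 1 := by rw [norm_mul]; gcongr
      _ ≤ D / y ^ 2 + 3 * D * B / y ^ 2 + D * B / y ^ 2 + 3 * D * B ^ 2 / y ^ 2 := by
        rw [mul_one]
        refine (norm_add_le _ _).trans (add_le_add ((norm_sub_le _ _).trans (add_le_add
          ((norm_sub_le _ _).trans (add_le_add i1 i2)) i3)) i4)
      _ = D * (1 + 4 * B + 3 * B ^ 2) / y ^ 2 := by ring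
      _ ≤ _ := by gcongr
  refine (intervalIntegral.norm_integral_le_of_norm_le_const bd).trans (le_of_eq ?_)
  rw [abs_of_nonneg (by linarith)]; ring

/-- The van der Corput lemma with second derivative and amplitude vanishing at the ends. -/
lemma vdc_second {α β : ℝ} (hαβ : α ≤ β) (A A1 φ φ1 φ2 : ℝ → ℝ) (D μ : ℝ)
    (hA : ∀ u ∈ Set.Icc α β, HasDerivAt A (A1 u) u)
    (cA1 : ContinuousOn A1 (Set.Icc α β)) (hAα : A α = 0) (hAβ : A β = 0)
    (hφ : ∀ u ∈ Set.Icc α β, HasDerivAt φ (φ1 u) u)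
    (hφ1 : ∀ u ∈ Set.Icc α β, HasDerivAt φ1 (φ2 u) u)
    (cφ2 : ContinuousOn φ2 (Set.Icc α β))
    (hμ : 0 < μ) (hD : 0 ≤ D) (bA : ∀ u ∈ Set.Icc α β, |A u| ≤ D)
    (bA1 : ∀ u ∈ Set.Icc α β, |A1 u| ≤ D) (b2 : ∀ u ∈ Set.Icc α β, μ ≤ φ2 u) :
    ‖∫ u in α..β, (A u : ℂ) * Complex.exp (Complex.I * (φ u : ℂ))‖ ≤
      D * (2 * Real.pi + (β - α)) / √μ := by
  have huI : Set.uIcc α β = Set.Icc α β := Set.uIcc_of_le hαβ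
  set δ := √μ
  have hδ : 0 < δ := Real.sqrt_pos.2 hμ
  have hδ2 : δ ^ 2 = μ := Real.sq_sqrt hμ.le
  have hpos : ∀ u, 0 < φ1 u ^ 2 + δ ^ 2 := fun u => by positivity
  set q : ℝ → ℝ := fun u => A u * φ1 u / (φ1 u ^ 2 + δ ^ 2)
  set q1 : ℝ → ℝ := fun u => A1 u * φ1 u / (φ1 u ^ 2 + δ ^ 2) +
    A u * φ2 u * (δ ^ 2 - φ1 u ^ 2) / (φ1 u ^ 2 + δ ^ 2) ^ 2
  have hq : ∀ u ∈ Set.Icc α β, HasDerivAt q (q1 u) u := fun u hu => by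
    have h := ((hA u hu).mul (hφ1 u hu)).div (((hφ1 u hu).pow 2).add_const (δ ^ 2)) (hpos u).ne'
    refine h.congr_deriv ?_
    have := (hpos u).ne'
    simp only [q1, Pi.mul_apply, Pi.pow_apply]
    field_simp
    ring
  have cA : ContinuousOn A (Set.Icc α β) := fun u hu => (hA u hu).continuousAt.continuousWithinAt
  have cφ : ContinuousOn φ (Set.Icc α β) := fun u hu => (hφ u hu).continuousAt.continuousWithinAt
  have cφ1 : ContinuousOn φ1 (Set.Icc α β) := fun u hu => (hφ1 u hu).continuousAt.continuousWithinAt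
  have cq1 : ContinuousOn q1 (Set.Icc α β) :=
    ((cA1.mul cφ1).div ((cφ1.pow 2).add continuousOn_const) fun u _ => (hpos u).ne').add
    (((cA.mul cφ2).mul (continuousOn_const.sub (cφ1.pow 2))).div
      (((cφ1.pow 2).add continuousOn_const).pow 2) fun u _ => pow_ne_zero 2 (hpos u).ne')
  set e : ℝ → ℂ := fun u => Complex.exp (Complex.I * (φ u : ℂ))
  have hee : ∀ u ∈ Set.Icc α β, HasDerivAt e (Complex.I * (φ1 u : ℂ) * e u) u := fun u hu => by
    have := ((hφ u hu).ofReal_comp.const_mul Complex.I).cexp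
    rwa [mul_comm] at this
  have ce : ContinuousOn e (Set.Icc α β) := fun u hu => (hee u hu).continuousAt.continuousWithinAt
  have ne : ∀ u, ‖e u‖ = 1 := fun u => by
    simp only [e]; rw [mul_comm]; exact Complex.norm_exp_ofReal_mul_I _
  have e1 : ∫ u in α..β, (q u : ℂ) * (Complex.I * (φ1 u : ℂ) * e u) =
      - ∫ u in α..β, (q1 u : ℂ) * e u := by
    have := intervalIntegral.integral_mul_deriv_eq_deriv_mul (a := α) (b := β)
      (u := fun u => (q u : ℂ)) (u' := fun u => (q1 u : ℂ))
      (v := e) (v' := fun u => Complex.I * (φ1 u : ℂ) * e u)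
      (by rw [huI]; exact fun u hu => (hq u hu).ofReal_comp) (by rw [huI]; exact hee)
      (by apply ContinuousOn.intervalIntegrable; rw [huI]
          exact Complex.continuous_ofReal.comp_continuousOn cq1)
      (by apply ContinuousOn.intervalIntegrable; rw [huI]
          exact (continuousOn_const.mul (Complex.continuous_ofReal.comp_continuousOn cφ1)).mul ce)
    simpa [q, hAα, hAβ] using this
  set g : ℝ → ℝ := fun u => φ2 u / (φ1 u ^ 2 + δ ^ 2)
  have cg : ContinuousOn g (Set.Icc α β) :=
    cφ2.div ((cφ1.pow 2).add continuousOn_const) fun u _ => (hpos u).ne'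
  have ig : IntervalIntegrable g volume α β := by
    apply ContinuousOn.intervalIntegrable; rw [huI]; exact cg
  have hg : ∫ u in α..β, g u ≤ Real.pi / δ := by
    have : ∫ u in α..β, g u = Real.arctan (φ1 β / δ) / δ - Real.arctan (φ1 α / δ) / δ := by
      apply intervalIntegral.integral_eq_sub_of_hasDerivAt
        (f := fun u => Real.arctan (φ1 u / δ) / δ) _ ig
      rw [huI]
      intro u hu
      have h := (((hφ1 u hu).div_const δ).arctan).div_const δ
      refine h.congr_deriv ?_
      simp only [g]
      have := (hpos u).ne'
      field_simp
      ring
    rw [this, ← sub_div]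
    gcongr
    linarith [Real.arctan_lt_pi_div_two (φ1 β / δ), Real.neg_pi_div_two_lt_arctan (φ1 α / δ)]
  -- split
  have e0 : ∫ u in α..β, (A u : ℂ) * e u =
      (∫ u in α..β, ((A u * (δ ^ 2 / (φ1 u ^ 2 + δ ^ 2)) : ℝ) : ℂ) * e u) +
      (Complex.I * ∫ u in α..β, (q1 u : ℂ) * e u) := by
    have : Complex.I * ∫ u in α..β, (q1 u : ℂ) * e u =
        ∫ u in α..β, ((q u * φ1 u : ℝ) : ℂ) * e u := by
      have h2 : ∫ u in α..β, (q1 u : ℂ) * e u =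
        - ∫ u in α..β, (q u : ℂ) * (Complex.I * (φ1 u : ℂ) * e u) := by rw [e1, neg_neg]
      rw [h2, mul_neg, ← intervalIntegral.integral_const_mul, ← intervalIntegral.integral_neg]
      congr 1; ext u
      push_cast
      linear_combination (-(q u : ℂ) * φ1 u * e u) * Complex.I_sq
    rw [this, ← intervalIntegral.integral_add]
    · apply intervalIntegral.integral_congr
      intro u hu
      simp only
      rw [← add_mul, ← Complex.ofReal_add]
      congr 2
      simp only [q]
      have := (hpos u).ne'
      field_simp
      ring
    · apply ContinuousOn.intervalIntegrable; rw [huI]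
      refine (Complex.continuous_ofReal.comp_continuousOn (cA.mul (continuousOn_const.div
        ((cφ1.pow 2).add continuousOn_const) fun u _ => (hpos u).ne'))).mul ce
    · apply ContinuousOn.intervalIntegrable; rw [huI]
      refine (Complex.continuous_ofReal.comp_continuousOn (((cA.mul cφ1).div
        ((cφ1.pow 2).add continuousOn_const) fun u _ => (hpos u).ne').mul cφ1)).mul ce
  have n1 : ‖∫ u in α..β, ((A u * (δ ^ 2 / (φ1 u ^ 2 + δ ^ 2)) : ℝ) : ℂ) * e u‖ ≤
      D * (Real.pi / δ) := by
    calc _ ≤ ∫ u in α..β, D * g u := by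
          apply intervalIntegral.norm_integral_le_of_norm_le hαβ _ (ig.const_mul D)
          refine Filter.Eventually.of_forall fun u hu => ?_
          have hu := Set.Ioc_subset_Icc_self hu
          rw [norm_mul, ne, mul_one, Complex.norm_real, Real.norm_eq_abs, abs_mul,
            abs_of_pos (div_pos (by positivity) (hpos u))]
          have := b2 u hu
          rw [← hδ2] at this
          have := bA u hu
          have := hpos u
          simp only [g]
          gcongr
      _ ≤ _ := by rw [intervalIntegral.integral_const_mul]; gcongr
  have n2 : ‖∫ u in α..β, (q1 u : ℂ) * e u‖ ≤ D * (Real.pi / δ) + D * (β - α) / δ := by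
    calc _ ≤ ∫ u in α..β, (D * g u + D / δ) := by
          apply intervalIntegral.norm_integral_le_of_norm_le hαβ _
            ((ig.const_mul D).add intervalIntegrable_const)
          refine Filter.Eventually.of_forall fun u hu => ?_
          have hu := Set.Ioc_subset_Icc_self hu
          rw [norm_mul, ne, mul_one, Complex.norm_real, Real.norm_eq_abs, add_comm (D * g u)]
          refine (abs_add_le _ _).trans (add_le_add ?_ ?_)
          · rw [abs_div, abs_mul, abs_of_pos (hpos u), div_le_div_iff₀ (hpos u) hδ]
            have h1 := bA1 u hu
            have h2 : |φ1 u| * δ ≤ φ1 u ^ 2 + δ ^ 2 := by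
              rw [← sq_abs (φ1 u)]; nlinarith [sq_nonneg (|φ1 u| - δ), abs_nonneg (φ1 u), sq_nonneg (|φ1 u| + δ)]
            calc _ = |A1 u| * (|φ1 u| * δ) := by ring
              _ ≤ D * (φ1 u ^ 2 + δ ^ 2) := by gcongr
          · have h1 := bA u hu
            have h2 : 0 < φ2 u := hμ.trans_le (b2 u hu)
            rw [abs_div, abs_mul, abs_mul, abs_of_pos h2, abs_of_pos (pow_pos (hpos u) 2)]
            have h3 : |δ ^ 2 - φ1 u ^ 2| ≤ φ1 u ^ 2 + δ ^ 2 := by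
              rw [abs_le]; constructor <;> nlinarith [sq_nonneg (φ1 u), sq_nonneg δ]
            have h4 := hpos u
            calc _ ≤ D * φ2 u * (φ1 u ^ 2 + δ ^ 2) / (φ1 u ^ 2 + δ ^ 2) ^ 2 := by gcongr
              _ = D * g u := by simp only [g]; field_simp
      _ ≤ _ := by
          rw [intervalIntegral.integral_add (ig.const_mul D) intervalIntegrable_const,
            intervalIntegral.integral_const_mul, intervalIntegral.integral_const]
          have : (β - α) • (D / δ) = D * (β - α) / δ := by rw [smul_eq_mul]; ring
          rw [this]; gcongr
  rw [e0]
  refine (norm_add_le _ _).trans ?_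
  rw [norm_mul, Complex.norm_I, one_mul]
  calc _ ≤ D * (Real.pi / δ) + (D * (Real.pi / δ) + D * (β - α) / δ) := add_le_add n1 n2
    _ = _ := by ring


/-- The polynomial bump on `[1/2, 5/2]`. -/
noncomputable def bumpP (u : ℝ) : ℝ := ((u - 1/2) * (5/2 - u)) ^ 2

/-- The rescaled oscillatory kernel. -/
noncomputable def oscJ (b X T R : ℝ) : ℂ :=
  ∫ u in (1/2 : ℝ)..(5/2), (bumpP u : ℂ) *
    Complex.exp ((Complex.I * T - R) * u + Complex.I * ((X * u ^ b : ℝ) : ℂ))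

lemma rpow_bounds (r : ℝ) : ∃ c C : ℝ, 0 < c ∧ 0 < C ∧
    ∀ u ∈ Set.Icc (1/2 : ℝ) (5/2), c ≤ u ^ r ∧ u ^ r ≤ C := by
  have hc : ContinuousOn (fun u : ℝ => u ^ r) (Set.Icc (1/2) (5/2)) := fun u hu =>
    (Real.continuousAt_rpow_const u r (Or.inl (by have := hu.1; linarith))).continuousWithinAt
  have hne : (Set.Icc (1/2 : ℝ) (5/2)).Nonempty := ⟨1, by norm_num, by norm_num⟩
  obtain ⟨x, hx, hxm⟩ := isCompact_Icc.exists_isMinOn hne hc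
  obtain ⟨y, hy, hym⟩ := isCompact_Icc.exists_isMaxOn hne hc
  exact ⟨x ^ r, y ^ r, Real.rpow_pos_of_pos (by have := hx.1; linarith) _,
    Real.rpow_pos_of_pos (by have := hy.1; linarith) _, fun u hu => ⟨hxm hu, hym hu⟩⟩

lemma bump_abs_le {u : ℝ} (hu : u ∈ Set.Icc (1/2 : ℝ) (5/2)) : |bumpP u| ≤ 1 := by
  obtain ⟨h1, h2⟩ := hu
  unfold bumpP
  rw [abs_of_nonneg (sq_nonneg _)]
  have : 0 ≤ (u - 1/2) * (5/2 - u) := mul_nonneg (by linarith) (by linarith)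
  have : (u - 1/2) * (5/2 - u) ≤ 1 := by nlinarith [sq_nonneg (u - 3/2)]
  apply pow_le_one₀ <;> assumption

/-- first derivative of the bump -/
noncomputable def bumpP1 (u : ℝ) : ℝ := 4 * ((u - 1/2) * (5/2 - u)) * (3/2 - u)

/-- second derivative of the bump -/
noncomputable def bumpP2 (u : ℝ) : ℝ := 8 * (3/2 - u) ^ 2 - 4 * ((u - 1/2) * (5/2 - u))

lemma bump_deriv (u : ℝ) : HasDerivAt bumpP (bumpP1 u) u := by
  have h := ((((hasDerivAt_id u).sub_const (1/2)).mul ((hasDerivAt_id u).const_sub (5/2))).pow 2)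
  refine h.congr_deriv ?_
  simp [bumpP1]; ring

lemma bump_deriv1 (u : ℝ) : HasDerivAt bumpP1 (bumpP2 u) u := by
  have h := ((((hasDerivAt_id u).sub_const (1/2)).mul ((hasDerivAt_id u).const_sub (5/2))).const_mul
    4).mul ((hasDerivAt_id u).const_sub (3/2))
  refine h.congr_deriv ?_
  simp [bumpP2]; ring

lemma bump1_abs_le {u : ℝ} (hu : u ∈ Set.Icc (1/2 : ℝ) (5/2)) : |bumpP1 u| ≤ 4 := by
  obtain ⟨h1, h2⟩ := hu
  unfold bumpP1
  have h3 : 0 ≤ (u - 1/2) * (5/2 - u) := mul_nonneg (by linarith) (by linarith)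
  have h4 : (u - 1/2) * (5/2 - u) ≤ 1 := by nlinarith [sq_nonneg (u - 3/2)]
  rw [abs_mul, abs_mul, abs_of_nonneg h3, abs_of_nonneg (by norm_num : (0:ℝ) ≤ 4)]
  have : |3/2 - u| ≤ 1 := abs_le.2 ⟨by linarith, by linarith⟩
  calc _ ≤ 4 * 1 * (1:ℝ) := by gcongr
    _ = 4 := by norm_num

lemma bump2_abs_le {u : ℝ} (hu : u ∈ Set.Icc (1/2 : ℝ) (5/2)) : |bumpP2 u| ≤ 8 := by
  obtain ⟨h1, h2⟩ := hu
  unfold bumpP2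
  have h3 : 0 ≤ (u - 1/2) * (5/2 - u) := mul_nonneg (by linarith) (by linarith)
  rw [abs_le]; constructor <;> nlinarith [sq_nonneg (u - 3/2)]

lemma cont_bump : Continuous bumpP := by unfold bumpP; fun_prop
lemma cont_bump1 : Continuous bumpP1 := by unfold bumpP1; fun_prop
lemma cont_bump2 : Continuous bumpP2 := by unfold bumpP2; fun_prop

lemma hasDerivAt_rpow_aux {u : ℝ} (hu : u ∈ Set.Icc (1/2 : ℝ) (5/2)) (r : ℝ) :
    HasDerivAt (fun u : ℝ => u ^ r) (r * u ^ (r - 1)) u :=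
  Real.hasDerivAt_rpow_const (Or.inl (by have := hu.1; linarith))

lemma contOn_rpow_aux (r : ℝ) : ContinuousOn (fun u : ℝ => u ^ r) (Set.Icc (1/2 : ℝ) (5/2)) :=
  fun _ hu => (hasDerivAt_rpow_aux hu r).continuousAt.continuousWithinAt

lemma oscJ_vdc (b : ℝ) (hb : 1 < b) : ∃ C : ℝ, 0 < C ∧ ∀ X T R : ℝ, 0 < X → 0 ≤ R →
    ‖oscJ b X T R‖ ≤ C * X ^ (-(1/2) : ℝ) * Real.exp (-(R / 4)) := by
  obtain ⟨c, C, hc, hC, hcC⟩ := rpow_bounds (b - 2)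
  have hk : 0 < b * (b - 1) * c := by have : 0 < b - 1 := by linarith
                                      positivity
  refine ⟨4 * (2 * Real.pi + 2) / √(b * (b - 1) * c), by positivity, fun X T R hX hR => ?_⟩
  have key := vdc_second (α := 1/2) (β := 5/2) (by norm_num)
    (fun u => bumpP u * Real.exp (-(R * u)))
    (fun u => (bumpP1 u - R * bumpP u) * Real.exp (-(R * u)))
    (fun u => T * u + X * u ^ b) (fun u => T + X * (b * u ^ (b - 1)))
    (fun u => X * (b * ((b - 1) * u ^ (b - 2)))) (4 * Real.exp (-(R / 4))) (X * (b * (b - 1) * c))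
    (fun u hu => by
      have h := (bump_deriv u).mul (((hasDerivAt_id u).const_mul R).neg.exp)
      refine h.congr_deriv ?_
      simp; ring)
    (by apply Continuous.continuousOn; have := cont_bump; have := cont_bump1; fun_prop)
    (by simp [bumpP]) (by simp [bumpP])
    (fun u hu => by
      have h := ((hasDerivAt_id u).const_mul T).add ((hasDerivAt_rpow_aux hu b).const_mul X)
      refine h.congr_deriv ?_
      simp)
    (fun u hu => by
      have h := (((hasDerivAt_rpow_aux hu (b - 1)).const_mul b).const_mul X).const_add T
      refine h.congr_deriv ?_
      rw [show b - 1 - 1 = b - 2 by ring])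
    (continuousOn_const.mul (continuousOn_const.mul (continuousOn_const.mul (contOn_rpow_aux _))))
    (by positivity) (by positivity)
    (fun u hu => by
      rw [abs_mul, abs_of_pos (Real.exp_pos _)]
      calc _ ≤ 1 * Real.exp (-(R / 4)) := by
            gcongr
            · exact bump_abs_le hu
            · have := hu.1; nlinarith
        _ ≤ _ := by gcongr; norm_num)
    (fun u hu => by
      rw [abs_mul, abs_of_pos (Real.exp_pos _)]
      have h1 := bump_abs_le hu
      have h2 := bump1_abs_le hu
      have h3 : |bumpP1 u - R * bumpP u| ≤ 4 + R := by
        refine (abs_sub _ _).trans ?_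
        rw [abs_mul, abs_of_nonneg hR]
        nlinarith
      calc _ ≤ (4 * Real.exp (R / 4)) * Real.exp (-(R / 2)) := by
            gcongr
            · have := Real.add_one_le_exp (R / 4); linarith
            · have := hu.1; nlinarith
        _ = _ := by rw [mul_assoc, ← Real.exp_add]; congr 2; ring)
    (fun u hu => by
      have := (hcC u hu).1
      have : 0 ≤ b - 1 := by linarith
      rw [← mul_assoc b]
      gcongr)
  have e : oscJ b X T R = ∫ u in (1/2 : ℝ)..(5/2), ((bumpP u * Real.exp (-(R * u)) : ℝ) : ℂ) *
      Complex.exp (Complex.I * ((T * u + X * u ^ b : ℝ) : ℂ)) := by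
    unfold oscJ
    congr 1; ext u
    push_cast
    rw [mul_assoc, ← Complex.exp_add]
    congr 2; ring
  rw [e]
  refine key.trans (le_of_eq ?_)
  rw [Real.sqrt_mul hX.le, Real.rpow_neg hX.le, ← Real.sqrt_eq_rpow]
  have := Real.sqrt_pos.2 hX
  have := Real.sqrt_pos.2 hk
  field_simp
  ring

lemma oscJ_nonstat (b : ℝ) (hb : 1 < b) : ∃ c C : ℝ, 0 < c ∧ 0 < C ∧ ∀ X T R : ℝ, X ≠ 0 → 0 ≤ R →
    |T| ≤ c * |X| → ‖oscJ b X T R‖ ≤ C / X ^ 2 := by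
  obtain ⟨c1, C1, hc1, hC1, h1⟩ := rpow_bounds (b - 1)
  obtain ⟨c2, C2, hc2, hC2, h2⟩ := rpow_bounds (b - 2)
  obtain ⟨c3, C3, hc3, hC3, h3⟩ := rpow_bounds (b - 3)
  set c := b * c1 / 2 with hc
  have hb0 : 0 < b := by linarith
  have hb1 : 0 < b - 1 := by linarith
  have hcp : 0 < c := by positivity
  set B := b * ((b - 1) * C2) / c + b * ((b - 1) * (|b - 2| * C3)) / c with hB
  have hBp : 0 ≤ B := by positivity
  refine ⟨c, 8 * (1 + 4 * B + 3 * B ^ 2) * 2 / c ^ 2, hcp, by positivity,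
    fun X T R hX hR hT => ?_⟩
  have hX' : 0 < |X| := abs_pos.2 hX
  have lower : ∀ u ∈ Set.Icc (1/2 : ℝ) (5/2), c * |X| ≤
      ‖(Complex.I * T - R) + Complex.I * ((X * (b * u ^ (b - 1)) : ℝ) : ℂ)‖ := by
    intro u hu
    refine le_trans ?_ (Complex.abs_im_le_norm _)
    have : ((Complex.I * T - R) + Complex.I * ((X * (b * u ^ (b - 1)) : ℝ) : ℂ)).im =
      T + X * (b * u ^ (b - 1)) := by simp [-Complex.ofReal_mul]
    rw [this]
    have h4 : |X * (b * u ^ (b - 1))| ≥ 2 * c * |X| := by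
      have := (h1 u hu).1
      rw [abs_mul, abs_of_pos (mul_pos hb0 (hc1.trans_le this))]
      calc 2 * c * |X| = |X| * (b * c1) := by rw [hc]; ring
        _ ≤ _ := by gcongr
    have h5 := abs_sub_abs_le_abs_sub (X * (b * u ^ (b - 1))) (-T)
    rw [abs_neg, sub_neg_eq_add, add_comm _ T] at h5
    linarith
  have key := ibp_twice (α := 1/2) (β := 5/2) (by norm_num)
    (fun u => (bumpP u : ℂ)) (fun u => (bumpP1 u : ℂ)) (fun u => (bumpP2 u : ℂ))
    (fun u => (Complex.I * T - R) * u + Complex.I * ((X * u ^ b : ℝ) : ℂ))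
    (fun u => (Complex.I * T - R) + Complex.I * ((X * (b * u ^ (b - 1)) : ℝ) : ℂ))
    (fun u => Complex.I * ((X * (b * ((b - 1) * u ^ (b - 2))) : ℝ) : ℂ))
    (fun u => Complex.I * ((X * (b * ((b - 1) * ((b - 2) * u ^ (b - 3)))) : ℝ) : ℂ))
    8 B (c * |X|)
    (fun u _ => (bump_deriv u).ofReal_comp) (fun u _ => (bump_deriv1 u).ofReal_comp)
    (Complex.continuous_ofReal.comp cont_bump2).continuousOn
    (by simp [bumpP]) (by simp [bumpP]) (by simp [bumpP1]) (by simp [bumpP1])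
    (fun u hu => by
      have h := ((hasDerivAt_id u).ofReal_comp.const_mul (Complex.I * T - R)).add
        (((hasDerivAt_rpow_aux hu b).const_mul X).ofReal_comp.const_mul Complex.I)
      refine h.congr_deriv ?_
      simp)
    (fun u hu => by
      have h := ((((hasDerivAt_rpow_aux hu (b - 1)).const_mul b).const_mul
        X).ofReal_comp.const_mul Complex.I).const_add (Complex.I * T - R)
      refine h.congr_deriv ?_
      rw [show b - 1 - 1 = b - 2 by ring])
    (fun u hu => by
      have h := (((((hasDerivAt_rpow_aux hu (b - 2)).const_mul (b - 1)).const_mul b).const_mul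
        X).ofReal_comp.const_mul Complex.I)
      refine h.congr_deriv ?_
      rw [show b - 2 - 1 = b - 3 by ring])
    (continuousOn_const.mul (Complex.continuous_ofReal.comp_continuousOn
      (continuousOn_const.mul (continuousOn_const.mul (continuousOn_const.mul
        (continuousOn_const.mul (contOn_rpow_aux _)))))))
    (by positivity) hBp (by norm_num)
    (fun u hu => by
      rw [Complex.norm_real, Real.norm_eq_abs]; exact (bump_abs_le hu).trans (by norm_num))
    (fun u hu => by
      rw [Complex.norm_real, Real.norm_eq_abs]; exact (bump1_abs_le hu).trans (by norm_num))
    (fun u hu => by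
      rw [Complex.norm_real, Real.norm_eq_abs]; exact (bump2_abs_le hu))
    (fun u hu => by
      have := hu.1
      have : (((Complex.I * T - R) * u + Complex.I * ((X * u ^ b : ℝ) : ℂ))).re = - (R * u) := by
        simp [-Complex.ofReal_mul]
      rw [this]; nlinarith)
    lower
    (fun u hu => by
      have h4 := (h2 u hu)
      have h5 : 0 < u ^ (b - 2) := hc2.trans_le h4.1
      rw [norm_mul, Complex.norm_I, one_mul, Complex.norm_real, Real.norm_eq_abs, abs_mul,
        abs_of_pos (mul_pos hb0 (mul_pos hb1 h5))]
      calc |X| * (b * ((b - 1) * u ^ (b - 2))) ≤ |X| * (b * ((b - 1) * C2)) := by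
            gcongr; exact h4.2
        _ = (b * ((b - 1) * C2) / c) * (c * |X|) := by field_simp
        _ ≤ _ := by
            gcongr
            · rw [hB]; apply le_add_of_nonneg_right; positivity
            · exact lower u hu)
    (fun u hu => by
      have h4 := (h3 u hu)
      have h5 : 0 < u ^ (b - 3) := hc3.trans_le h4.1
      rw [norm_mul, Complex.norm_I, one_mul, Complex.norm_real, Real.norm_eq_abs, abs_mul,
        abs_mul, abs_mul, abs_mul, abs_of_pos hb0, abs_of_pos hb1, abs_of_pos h5]
      calc |X| * (b * ((b - 1) * (|b - 2| * u ^ (b - 3)))) ≤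
            |X| * (b * ((b - 1) * (|b - 2| * C3))) := by
            gcongr; exact h4.2
        _ = (b * ((b - 1) * (|b - 2| * C3)) / c) * (c * |X|) := by field_simp
        _ ≤ _ := by
            gcongr
            · rw [hB]; apply le_add_of_nonneg_left; positivity
            · exact lower u hu)
  refine key.trans (le_of_eq ?_)
  rw [mul_pow, sq_abs]
  field_simp
  norm_num

lemma oscJ_conj (b X T R : ℝ) : oscJ b (-X) (-T) R = starRingEnd ℂ (oscJ b X T R) := by
  unfold oscJ
  rw [intervalIntegral.integral_of_le (by norm_num), intervalIntegral.integral_of_le (by norm_num),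
    ← integral_conj]
  congr 1; ext u
  rw [map_mul, ← Complex.exp_conj]
  simp
  
lemma oscJ_triv (b X T R : ℝ) (hR : 0 ≤ R) : ‖oscJ b X T R‖ ≤ 2 := by
  unfold oscJ
  refine (intervalIntegral.norm_integral_le_of_norm_le_const (C := 1) fun u hu => ?_).trans ?_
  · rw [Set.uIoc_of_le (by norm_num)] at hu
    have hu := Set.Ioc_subset_Icc_self hu
    rw [norm_mul, Complex.norm_real, Real.norm_eq_abs, Complex.norm_exp]
    have : (((Complex.I * T - R) * u + Complex.I * ((X * u ^ b : ℝ) : ℂ))).re = - (R * u) := by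
      simp [-Complex.ofReal_mul]
    rw [this]
    have h1 := bump_abs_le hu
    have h2 : Real.exp (-(R * u)) ≤ 1 := Real.exp_le_one_iff.2 (by have := hu.1; nlinarith)
    calc _ ≤ (1:ℝ) * 1 := by gcongr
      _ = 1 := by norm_num
  · norm_num [abs_of_pos]

lemma oscJ_bound (b γ : ℝ) (hb : 1 < b) (hγ : 1 < γ) : ∃ c C : ℝ, 0 < c ∧ 0 < C ∧
    ∀ X T R M : ℝ, 0 < M → |T| ^ γ * M ^ (1 - γ) ≤ R →
    ‖oscJ b X T R‖ ≤ C * ((1 + X ^ 2)⁻¹ +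
      |X| ^ (-(1/2) : ℝ) * Real.exp (-(c * M ^ (1 - γ)) * |X| ^ γ)) := by
  obtain ⟨C0, hC0, h0⟩ := oscJ_vdc b hb
  obtain ⟨c1, C1, hc1, hC1, h1⟩ := oscJ_nonstat b hb
  refine ⟨c1 ^ γ / 4, C0 + 2 * C1 + 4, by positivity, by positivity, fun X T R M hM hR => ?_⟩
  have hR0 : 0 ≤ R := le_trans (by positivity) hR
  set E := |X| ^ (-(1/2) : ℝ) * Real.exp (-(c1 ^ γ / 4 * M ^ (1 - γ)) * |X| ^ γ) with hE
  have hE0 : 0 ≤ E := by positivity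
  have hI0 : 0 ≤ (1 + X ^ 2)⁻¹ := by positivity
  by_cases hX1 : |X| ≤ 1
  · have hh : X ^ 2 ≤ 1 := by rw [← sq_abs]; exact pow_le_one₀ (abs_nonneg _) hX1
    have : 1 / 2 ≤ (1 + X ^ 2)⁻¹ := by
      rw [one_div]; gcongr; linarith
    have := oscJ_triv b X T R hR0
    nlinarith [mul_nonneg hC0.le hI0, mul_nonneg hC1.le hI0, mul_nonneg hC0.le hE0,
      mul_nonneg hC1.le hE0]
  · push Not at hX1
    have hX0 : X ≠ 0 := by rintro rfl; simp at hX1; linarith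
    by_cases hT : |T| ≤ c1 * |X|
    · refine (h1 X T R hX0 hR0 hT).trans ?_
      have hh : 1 ≤ X ^ 2 := by rw [← sq_abs]; exact one_le_pow₀ hX1.le
      have : C1 / X ^ 2 ≤ 2 * C1 * (1 + X ^ 2)⁻¹ := by
        rw [← div_eq_mul_inv, div_le_div_iff₀ (by positivity) (by positivity)]
        nlinarith
      nlinarith [mul_nonneg hC0.le hI0, mul_nonneg hC1.le hI0, mul_nonneg hC0.le hE0,
        mul_nonneg hC1.le hE0]
    · push Not at hT
      have h3 : ‖oscJ b X T R‖ ≤ C0 * |X| ^ (-(1/2) : ℝ) * Real.exp (-(R / 4)) := by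
        rcases lt_or_gt_of_ne hX0 with h | h
        · have := h0 (-X) (-T) R (by linarith) hR0
          rw [oscJ_conj, RCLike.norm_conj] at this
          rwa [abs_of_neg h]
        · rw [abs_of_pos h]; exact h0 X T R h hR0
      have h4 : c1 ^ γ * |X| ^ γ * M ^ (1 - γ) ≤ R := by
        refine le_trans ?_ hR
        rw [← Real.mul_rpow hc1.le (abs_nonneg _)]
        gcongr
      have h5 : C0 * |X| ^ (-(1/2) : ℝ) * Real.exp (-(R / 4)) ≤ C0 * E := by
        rw [hE, ← mul_assoc]
        gcongr
        linarith
      nlinarith [mul_nonneg hC0.le hI0, mul_nonneg hC1.le hI0, mul_nonneg hC0.le hE0,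
        mul_nonneg hC1.le hE0]


lemma ennreal_two_mul_le (a b : ENNReal) : 2 * (a * b) ≤ a ^ 2 + b ^ 2 := by
  rcases eq_or_ne a ⊤ with rfl | ha
  · simp
  rcases eq_or_ne b ⊤ with rfl | hb
  · simp
  lift a to NNReal using ha
  lift b to NNReal using hb
  norm_cast
  have : (2 * ((a:ℝ) * b)) ≤ (a:ℝ) ^ 2 + (b:ℝ) ^ 2 := by nlinarith [sq_nonneg ((a:ℝ) - b)]
  exact_mod_cast this

set_option maxHeartbeats 1600000 in
/-- Schur test for the `TT*` kernel. -/
lemma tt_star {α β : Type*} [MeasurableSpace α] [MeasurableSpace β] (μ : Measure α)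
    [IsFiniteMeasure μ] (ν : Measure β) [IsFiniteMeasure ν] (E : α → β → ℂ)
    (hE : Measurable (Function.uncurry E)) (D : ℝ) (bE : ∀ x ξ, ‖E x ξ‖ ≤ D)
    (k : α → α → ENNReal) (hk : Measurable (Function.uncurry k))
    (hK : ∀ x y, ‖∫ ξ, E x ξ * (starRingEnd ℂ) (E y ξ) ∂ν‖ₑ ≤ k x y) (Λ : ℝ) (hΛ : 0 < Λ)
    (hk1 : ∀ x, ∫⁻ y, k x y ∂μ ≤ ENNReal.ofReal Λ)
    (hk2 : ∀ y, ∫⁻ x, k x y ∂μ ≤ ENNReal.ofReal Λ)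
    (g : β → ℂ) (hgm : Measurable g) (hg : MemLp g 2 ν) :
    ∫⁻ x, ‖∫ ξ, g ξ * E x ξ ∂ν‖ₑ ^ 2 ∂μ ≤ ENNReal.ofReal Λ * ∫⁻ ξ, ‖g ξ‖ₑ ^ 2 ∂ν := by
  by_cases hα : IsEmpty α
  · rw [Measure.eq_zero_of_isEmpty μ]; simp
  rw [not_isEmpty_iff] at hα
  by_cases hβ : IsEmpty β
  · rw [Measure.eq_zero_of_isEmpty ν]; simp
  rw [not_isEmpty_iff] at hβ
  have hD : 0 ≤ D := (norm_nonneg _).trans (bE hα.some hβ.some)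
  have hg1 : Integrable g ν := hg.integrable (by norm_num)
  set u : α → ℂ := fun x => ∫ ξ, g ξ * E x ξ ∂ν with hu
  have mu : Measurable u := by
    have : StronglyMeasurable u := by
      apply StronglyMeasurable.integral_prod_right (f := fun x ξ => g ξ * E x ξ)
      exact ((hgm.comp measurable_snd).mul hE).stronglyMeasurable
    exact this.measurable
  set U : ℝ := D * ∫ ξ, ‖g ξ‖ ∂ν with hU
  have hU0 : 0 ≤ U := mul_nonneg hD (integral_nonneg fun _ => norm_nonneg _)
  have bu : ∀ x, ‖u x‖ ≤ U := fun x => by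
    rw [hU, ← integral_const_mul]
    refine norm_integral_le_of_norm_le (hg1.norm.const_mul D) (Filter.Eventually.of_forall fun ξ => ?_)
    rw [norm_mul, mul_comm]
    gcongr
    exact bE x ξ
  set S : β → ℂ := fun ξ => ∫ x, (starRingEnd ℂ) (u x) * E x ξ ∂μ with hS
  have mS : Measurable S := by
    have : StronglyMeasurable S := by
      apply StronglyMeasurable.integral_prod_right (f := fun ξ x => (starRingEnd ℂ) (u x) * E x ξ)
      have h1 : Measurable (fun p : β × α => E p.2 p.1) := hE.comp measurable_swap
      have h2 : Measurable (fun p : β × α => (starRingEnd ℂ) (u p.2)) :=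
        Complex.continuous_conj.measurable.comp (mu.comp measurable_snd)
      exact (h2.mul h1).stronglyMeasurable
    exact this.measurable
  have buE : ∀ x ξ, ‖(starRingEnd ℂ) (u x) * E x ξ‖ ≤ U * D := fun x ξ => by
    rw [norm_mul, RCLike.norm_conj]
    exact mul_le_mul (bu x) (bE x ξ) (norm_nonneg _) hU0
  have bS : ∀ ξ, ‖S ξ‖ ≤ U * D * μ.real Set.univ := fun ξ =>
    norm_integral_le_of_norm_le_const (Filter.Eventually.of_forall fun x => buE x ξ)
  -- A
  set A : ℝ := ∫ x, ‖u x‖ ^ 2 ∂μ with hA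
  have iu2 : Integrable (fun x => ‖u x‖ ^ 2) μ := by
    refine Integrable.of_bound (mu.norm.pow_const 2).aestronglyMeasurable (U ^ 2)
      (Filter.Eventually.of_forall fun x => ?_)
    rw [Real.norm_eq_abs, abs_of_nonneg (by positivity)]
    gcongr; exact bu x
  have eA : ENNReal.ofReal A = ∫⁻ x, ‖u x‖ₑ ^ 2 ∂μ := by
    rw [hA, ofReal_integral_eq_lintegral_ofReal iu2 (Filter.Eventually.of_forall fun _ => by positivity)]
    congr 1; ext x
    rw [ENNReal.ofReal_pow (norm_nonneg _), ofReal_norm]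
  have h1 : ∫ ξ, g ξ * S ξ ∂ν = (A : ℂ) := by
    calc ∫ ξ, g ξ * S ξ ∂ν = ∫ ξ, ∫ x, g ξ * ((starRingEnd ℂ) (u x) * E x ξ) ∂μ ∂ν := by
          congr 1; ext ξ; rw [hS, integral_const_mul]
      _ = ∫ x, ∫ ξ, g ξ * ((starRingEnd ℂ) (u x) * E x ξ) ∂ν ∂μ := by
          apply integral_integral_swap
          refine Integrable.mono' (g := fun p : β × α => ‖g p.1‖ * (U * D))
            ((hg1.norm.comp_fst μ).mul_const _) ?_ (Filter.Eventually.of_forall fun p => ?_)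
          · have h1 : Measurable (fun p : β × α => E p.2 p.1) := hE.comp measurable_swap
            have h2 : Measurable (fun p : β × α => (starRingEnd ℂ) (u p.2)) :=
              Complex.continuous_conj.measurable.comp (mu.comp measurable_snd)
            exact ((hgm.comp measurable_fst).mul (h2.mul h1)).aestronglyMeasurable
          · simp only [Function.uncurry]
            rw [norm_mul]
            gcongr
            exact buE _ _
      _ = ∫ x, ((‖u x‖ ^ 2 : ℝ) : ℂ) ∂μ := by
          congr 1; ext x
          have : ∀ ξ, g ξ * ((starRingEnd ℂ) (u x) * E x ξ) = (starRingEnd ℂ) (u x) * (g ξ * E x ξ) :=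
            fun ξ => by ring
          simp_rw [this]
          rw [integral_const_mul]
          change (starRingEnd ℂ) (u x) * u x = _
          rw [mul_comm, Complex.mul_conj, Complex.normSq_eq_norm_sq]
      _ = _ := integral_ofReal
  set Q : ℝ := ∫ ξ, ‖S ξ‖ ^ 2 ∂ν with hQ
  have iS2 : Integrable (fun ξ => ‖S ξ‖ ^ 2) ν := by
    refine Integrable.of_bound (mS.norm.pow_const 2).aestronglyMeasurable
      ((U * D * μ.real Set.univ) ^ 2) (Filter.Eventually.of_forall fun x => ?_)
    rw [Real.norm_eq_abs, abs_of_nonneg (by positivity)]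
    gcongr; exact bS x
  have h2 : (Q : ℂ) = ∫ p : α × α, (starRingEnd ℂ) (u p.1) * u p.2 *
      ∫ ξ, E p.1 ξ * (starRingEnd ℂ) (E p.2 ξ) ∂ν ∂(μ.prod μ) := by
    calc (Q : ℂ) = ∫ ξ, ((‖S ξ‖ ^ 2 : ℝ) : ℂ) ∂ν := integral_ofReal.symm
      _ = ∫ ξ, ∫ p : α × α, ((starRingEnd ℂ) (u p.1) * E p.1 ξ) *
            (starRingEnd ℂ) ((starRingEnd ℂ) (u p.2) * E p.2 ξ) ∂(μ.prod μ) ∂ν := by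
          congr 1; ext ξ
          rw [integral_prod_mul (fun x => (starRingEnd ℂ) (u x) * E x ξ)
            (fun y => (starRingEnd ℂ) ((starRingEnd ℂ) (u y) * E y ξ)), integral_conj]
          rw [Complex.mul_conj, Complex.normSq_eq_norm_sq]
      _ = ∫ p : α × α, ∫ ξ, ((starRingEnd ℂ) (u p.1) * E p.1 ξ) *
            (starRingEnd ℂ) ((starRingEnd ℂ) (u p.2) * E p.2 ξ) ∂ν ∂(μ.prod μ) := by
          apply integral_integral_swap
          refine Integrable.of_bound (C := (U * D) * (U * D)) ?_ (Filter.Eventually.of_forall fun p => ?_)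
          · have h0 : Measurable (fun q : α × β => (starRingEnd ℂ) (u q.1) * E q.1 q.2) :=
              (Complex.continuous_conj.measurable.comp (mu.comp measurable_fst)).mul hE
            have h1 : Measurable (fun p : β × α × α => (starRingEnd ℂ) (u p.2.1) * E p.2.1 p.1) :=
              h0.comp (measurable_snd.fst.prodMk measurable_fst)
            have h2 : Measurable (fun p : β × α × α => (starRingEnd ℂ)
                ((starRingEnd ℂ) (u p.2.2) * E p.2.2 p.1)) :=
              Complex.continuous_conj.measurable.comp
                (h0.comp (measurable_snd.snd.prodMk measurable_fst))
            exact (h1.mul h2).aestronglyMeasurable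
          · simp only [Function.uncurry]
            rw [norm_mul, RCLike.norm_conj]
            exact mul_le_mul (buE _ _) (buE _ _) (norm_nonneg _) (by positivity)
      _ = _ := by
          congr 1; ext p
          rw [← integral_const_mul]
          congr 1; ext ξ
          simp only [map_mul, Complex.conj_conj]; ring
  have hQ0 : 0 ≤ Q := integral_nonneg fun _ => by positivity
  have hA0 : 0 ≤ A := integral_nonneg fun _ => by positivity
  have h3 : Q ≤ Λ * A := by
    have e1 : ENNReal.ofReal Q ≤ ∫⁻ p : α × α, ‖u p.1‖ₑ * ‖u p.2‖ₑ * k p.1 p.2 ∂(μ.prod μ) := by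
      have : ENNReal.ofReal Q = ‖(Q : ℂ)‖ₑ := by
        rw [← ofReal_norm, Complex.norm_real, Real.norm_of_nonneg hQ0]
      rw [this, h2]
      refine (enorm_integral_le_lintegral_enorm _).trans (lintegral_mono fun p => ?_)
      simp only [enorm_mul]
      gcongr
      · rw [← ofReal_norm, RCLike.norm_conj, ofReal_norm]
      · exact hK _ _
    have e2 : 2 * ENNReal.ofReal Q ≤ 2 * (ENNReal.ofReal Λ * ENNReal.ofReal A) := by
      have m1 : Measurable (fun p : α × α => ‖u p.1‖ₑ ^ 2 * k p.1 p.2) :=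
        ((mu.comp measurable_fst).enorm.pow_const 2).mul hk
      have m2 : Measurable (fun p : α × α => ‖u p.2‖ₑ ^ 2 * k p.1 p.2) :=
        ((mu.comp measurable_snd).enorm.pow_const 2).mul hk
      calc 2 * ENNReal.ofReal Q
          ≤ 2 * ∫⁻ p : α × α, ‖u p.1‖ₑ * ‖u p.2‖ₑ * k p.1 p.2 ∂(μ.prod μ) := by gcongr
        _ = ∫⁻ p : α × α, 2 * (‖u p.1‖ₑ * ‖u p.2‖ₑ * k p.1 p.2) ∂(μ.prod μ) := by
            rw [lintegral_const_mul' _ _ (by norm_num)]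
        _ ≤ ∫⁻ p : α × α, (‖u p.1‖ₑ ^ 2 * k p.1 p.2 + ‖u p.2‖ₑ ^ 2 * k p.1 p.2) ∂(μ.prod μ) := by
            refine lintegral_mono fun p => ?_
            rw [← mul_assoc, ← add_mul]
            gcongr
            exact ennreal_two_mul_le _ _
        _ = (∫⁻ p : α × α, ‖u p.1‖ₑ ^ 2 * k p.1 p.2 ∂(μ.prod μ)) +
              ∫⁻ p : α × α, ‖u p.2‖ₑ ^ 2 * k p.1 p.2 ∂(μ.prod μ) := by
            exact lintegral_add_left m1 _
        _ ≤ ENNReal.ofReal Λ * ENNReal.ofReal A + ENNReal.ofReal Λ * ENNReal.ofReal A := by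
            gcongr
            · rw [lintegral_prod _ m1.aemeasurable]
              rw [eA, ← lintegral_const_mul _ (mu.enorm.pow_const 2)]
              refine lintegral_mono fun x => ?_
              simp only
              rw [lintegral_const_mul' _ _ (by simp), mul_comm]
              gcongr
              exact hk1 x
            · rw [lintegral_prod_symm _ m2.aemeasurable]
              rw [eA, ← lintegral_const_mul _ (mu.enorm.pow_const 2)]
              refine lintegral_mono fun x => ?_
              simp only
              rw [lintegral_const_mul' _ _ (by simp), mul_comm]
              gcongr
              exact hk2 x
        _ = _ := by rw [two_mul]
    rw [ENNReal.mul_le_mul_iff_right (by norm_num) (by norm_num), ← ENNReal.ofReal_mul hΛ.le] at e2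
    exact (ENNReal.ofReal_le_ofReal_iff (by positivity)).1 e2
  have ig2 : Integrable (fun ξ => ‖g ξ‖ ^ 2) ν := (memLp_two_iff_integrable_sq_norm hgm.aestronglyMeasurable).1 hg
  set G : ℝ := ∫ ξ, ‖g ξ‖ ^ 2 ∂ν with hG
  have eG : ENNReal.ofReal G = ∫⁻ x, ‖g x‖ₑ ^ 2 ∂ν := by
    rw [hG, ofReal_integral_eq_lintegral_ofReal ig2 (Filter.Eventually.of_forall fun _ => by positivity)]
    congr 1; ext x
    rw [ENNReal.ofReal_pow (norm_nonneg _), ofReal_norm]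
  have h4 : 2 * Λ * A ≤ Λ ^ 2 * G + Q := by
    have : A = (∫ ξ, g ξ * S ξ ∂ν).re := by rw [h1, Complex.ofReal_re]
    have igS : Integrable (fun ξ => g ξ * S ξ) ν :=
      hg1.mul_bdd mS.aestronglyMeasurable (Filter.Eventually.of_forall bS)
    have h5 : A ≤ ∫ ξ, ‖g ξ‖ * ‖S ξ‖ ∂ν := by
      calc A ≤ ‖∫ ξ, g ξ * S ξ ∂ν‖ := by rw [this]; exact Complex.re_le_norm _
        _ ≤ _ := by
          refine (norm_integral_le_integral_norm _).trans (le_of_eq ?_)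
          simp_rw [norm_mul]
    have igS' : Integrable (fun ξ => ‖g ξ‖ * ‖S ξ‖) ν := by
      simpa only [norm_mul] using igS.norm
    calc 2 * Λ * A ≤ 2 * Λ * ∫ ξ, ‖g ξ‖ * ‖S ξ‖ ∂ν := by gcongr
      _ = ∫ ξ, 2 * Λ * (‖g ξ‖ * ‖S ξ‖) ∂ν := (integral_const_mul _ _).symm
      _ ≤ ∫ ξ, (Λ ^ 2 * ‖g ξ‖ ^ 2 + ‖S ξ‖ ^ 2) ∂ν := by
          apply integral_mono (igS'.const_mul _) ((ig2.const_mul _).add iS2)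
          intro ξ
          simp only [Pi.add_apply]
          nlinarith [sq_nonneg (Λ * ‖g ξ‖ - ‖S ξ‖)]
      _ = _ := by rw [integral_add (ig2.const_mul _) iS2, integral_const_mul]
  rw [← eA, ← eG, ← ENNReal.ofReal_mul hΛ.le]
  apply ENNReal.ofReal_le_ofReal
  have h6 : Λ * A ≤ Λ * (Λ * G) := by nlinarith
  exact le_of_mul_le_mul_left h6 hΛ


lemma tt_star_R (ν : Measure ℝ) [IsFiniteMeasure ν] (E : ℝ → ℝ → ℂ)
    (hE : Measurable (Function.uncurry E)) (D : ℝ) (bE : ∀ x ξ, ‖E x ξ‖ ≤ D)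
    (k : ℝ → ENNReal) (hk : Measurable k)
    (hK : ∀ x y, ‖∫ ξ, E x ξ * (starRingEnd ℂ) (E y ξ) ∂ν‖ₑ ≤ k (x - y)) (Λ : ℝ) (hΛ : 0 < Λ)
    (hk1 : ∫⁻ z, k z ≤ ENNReal.ofReal Λ)
    (g : ℝ → ℂ) (hgm : Measurable g) (hg : MemLp g 2 ν) :
    ∫⁻ x, ‖∫ ξ, g ξ * E x ξ ∂ν‖ₑ ^ 2 ≤ ENNReal.ofReal Λ * ∫⁻ ξ, ‖g ξ‖ₑ ^ 2 ∂ν := by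
  have key : ∀ n : ℕ, ∫⁻ x in Metric.ball (0:ℝ) n, ‖∫ ξ, g ξ * E x ξ ∂ν‖ₑ ^ 2 ≤
      ENNReal.ofReal Λ * ∫⁻ ξ, ‖g ξ‖ₑ ^ 2 ∂ν := fun n => by
    have : IsFiniteMeasure (volume.restrict (Metric.ball (0:ℝ) n)) :=
      ⟨by rw [Measure.restrict_apply_univ]; exact measure_ball_lt_top⟩
    refine tt_star (volume.restrict (Metric.ball (0:ℝ) n)) ν E hE D bE (fun x y => k (x - y)) ?_ hK
      Λ hΛ ?_ ?_ g hgm hg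
    · exact hk.comp (measurable_fst.sub measurable_snd)
    · intro x
      refine (setLIntegral_le_lintegral _ _).trans ?_
      rw [lintegral_sub_left_eq_self (fun z => k z) x]; exact hk1
    · intro y
      refine (setLIntegral_le_lintegral _ _).trans ?_
      rw [lintegral_sub_right_eq_self (fun z => k z) y]; exact hk1
  rw [← setLIntegral_univ, ← Metric.iUnion_ball_nat (0:ℝ), setLIntegral_iUnion_of_directed]
  · exact iSup_le key
  · refine Monotone.directed_le fun m n hmn => Metric.ball_subset_ball (by exact_mod_cast hmn)

lemma low_kernel (y : ℝ) : ‖∫ u in (-2:ℝ)..2, (((4 - u ^ 2) ^ 2 : ℝ) : ℂ) *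
    Complex.exp (Complex.I * y * u)‖ ≤ 256 / (1 + y ^ 2) := by
  by_cases hy : |y| ≤ 1
  · have hh : y ^ 2 ≤ 1 := by rw [← sq_abs]; exact pow_le_one₀ (abs_nonneg _) hy
    have : ‖∫ u in (-2:ℝ)..2, (((4 - u ^ 2) ^ 2 : ℝ) : ℂ) *
        Complex.exp (Complex.I * y * u)‖ ≤ 16 * |2 - (-2)| := by
      apply intervalIntegral.norm_integral_le_of_norm_le_const
      intro u hu
      rw [Set.uIoc_of_le (by norm_num)] at hu
      rw [norm_mul, Complex.norm_real, Complex.norm_exp]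
      simp only [Complex.mul_re, Complex.I_re, Complex.I_im, Complex.ofReal_re, Complex.ofReal_im,
        Complex.mul_im, zero_mul, mul_zero, sub_zero, one_mul, add_zero, sub_self, Real.exp_zero, mul_one, Real.norm_eq_abs]
      rw [abs_of_nonneg (sq_nonneg _)]
      have : u ^ 2 ≤ 4 := by nlinarith [hu.1, hu.2]
      nlinarith [sq_nonneg u]
    refine this.trans ?_
    rw [le_div_iff₀ (by positivity)]
    norm_num; nlinarith
  · push Not at hy
    have hy2 : 1 ≤ y ^ 2 := by rw [← sq_abs]; nlinarith
    have := ibp_twice (α := -2) (β := 2) (by norm_num) (fun u => (((4 - u ^ 2) ^ 2 : ℝ) : ℂ))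
      (fun u => ((-4 * u * (4 - u ^ 2) : ℝ) : ℂ)) (fun u => ((-16 + 12 * u ^ 2 : ℝ) : ℂ))
      (fun u => Complex.I * y * u) (fun _ => Complex.I * y) (fun _ => 0) (fun _ => 0) 32 0 |y|
      (fun u _ => by
        apply HasDerivAt.ofReal_comp
        have := (((hasDerivAt_id u).pow 2).const_sub 4).pow 2
        refine this.congr_deriv ?_
        simp; ring)
      (fun u _ => by
        apply HasDerivAt.ofReal_comp
        have := (((hasDerivAt_id u).const_mul (-4))).mul (((hasDerivAt_id u).pow 2).const_sub 4)
        refine this.congr_deriv ?_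
        simp; ring)
      (by fun_prop) (by norm_num) (by norm_num) (by norm_num) (by norm_num)
      (fun u _ => by
        have := ((hasDerivAt_id u).ofReal_comp).const_mul (Complex.I * y)
        simpa using this)
      (fun u _ => hasDerivAt_const _ _) (fun u _ => hasDerivAt_const _ _) continuousOn_const
      (by linarith) le_rfl (by norm_num)
      (fun u hu => by
        have : u ^ 2 ≤ 4 := by nlinarith [hu.1, hu.2]
        rw [Complex.norm_real, Real.norm_eq_abs, abs_le]; constructor <;> nlinarith [sq_nonneg u])
      (fun u hu => by
        have : u ^ 2 ≤ 4 := by nlinarith [hu.1, hu.2]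
        have h2 : |u| ≤ 2 := abs_le.2 hu
        rw [Complex.norm_real, Real.norm_eq_abs, abs_mul, abs_mul, abs_of_nonneg (show 0 ≤ 4 - u ^ 2 by linarith)]
        norm_num
        have : |u| * (4 - u ^ 2) ≤ 2 * 4 := by
          apply mul_le_mul h2 _ (by linarith) (by norm_num)
          nlinarith [sq_nonneg u]
        nlinarith)
      (fun u hu => by
        have : u ^ 2 ≤ 4 := by nlinarith [hu.1, hu.2]
        rw [Complex.norm_real, Real.norm_eq_abs, abs_le]; constructor <;> nlinarith [sq_nonneg u])
      (fun u _ => by simp) (fun u _ => by simp) (fun u _ => by simp) (fun u _ => by simp)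
    refine this.trans ?_
    rw [sq_abs, div_le_div_iff₀ (by positivity) (by positivity)]
    nlinarith

/-- A Plancherel-type upper bound for band-limited functions. -/
lemma low_planch (g : ℝ → ℂ) (hgm : Measurable g) (hg : MemLp g 2 volume)
    (hs : ∀ ξ, 1 < |ξ| → g ξ = 0) :
    ∫⁻ x : ℝ, ‖∫ ξ, g ξ * Complex.exp (Complex.I * ((x * ξ : ℝ) : ℂ))‖ₑ ^ 2 ≤
      ENNReal.ofReal (256 * Real.pi) * ∫⁻ ξ, ‖g ξ‖ₑ ^ 2 := by
  set I : Set ℝ := Set.Ioc (-2) 2 with hI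
  set ν : Measure ℝ := volume.restrict I
  have : IsFiniteMeasure ν := ⟨by
    rw [Measure.restrict_apply_univ]; exact measure_Ioc_lt_top⟩
  set E : ℝ → ℝ → ℂ := fun x ξ => I.indicator (fun ξ => ((4 - ξ ^ 2 : ℝ) : ℂ) *
    Complex.exp (Complex.I * ((x * ξ : ℝ) : ℂ))) ξ with hE
  set h : ℝ → ℂ := fun ξ => g ξ / ((4 - ξ ^ 2 : ℝ) : ℂ) with hh
  have bh : ∀ ξ, ‖h ξ‖ ≤ ‖g ξ‖ := fun ξ => by
    by_cases h1 : 1 < |ξ|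
    · simp [hh, hs ξ h1]
    · push Not at h1
      have : ξ ^ 2 ≤ 1 := by rw [← sq_abs]; exact pow_le_one₀ (abs_nonneg _) h1
      simp only [hh]
      rw [norm_div, Complex.norm_real, Real.norm_eq_abs, abs_of_nonneg (by linarith)]
      exact div_le_self (norm_nonneg _) (by linarith)
  have hhm : Measurable h := by
    simp only [hh]; fun_prop
  have nexp : ∀ r : ℝ, ‖Complex.exp (Complex.I * (r : ℂ))‖ = 1 := fun r => by
    rw [mul_comm]; exact Complex.norm_exp_ofReal_mul_I r
  have main := tt_star_R ν E ?_ 4 ?_ (fun z => ENNReal.ofReal (256 * (1 + z ^ 2)⁻¹)) ?_ ?_ (256 * Real.pi)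
    (by positivity) ?_ h hhm ?_
  · calc _ = ∫⁻ x, ‖∫ ξ, h ξ * E x ξ ∂ν‖ₑ ^ 2 := by
          congr 1; ext x; congr 2
          rw [← integral_indicator measurableSet_Ioc]
          congr 1; ext ξ
          by_cases h1 : 1 < |ξ|
          · rw [hs ξ h1]
            by_cases h2 : ξ ∈ I
            · rw [Set.indicator_of_mem h2]; simp [hh, hs ξ h1]
            · rw [Set.indicator_of_notMem h2]; simp
          · push Not at h1
            have h2 : ξ ∈ I := by
              obtain ⟨h3, h4⟩ := abs_le.1 h1
              exact ⟨by linarith, by linarith⟩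
            have h3 : ξ ^ 2 ≤ 1 := by rw [← sq_abs]; exact pow_le_one₀ (abs_nonneg _) h1
            rw [Set.indicator_of_mem h2]
            simp only [hh, hE]
            rw [Set.indicator_of_mem h2]
            have : ((4 - ξ ^ 2 : ℝ) : ℂ) ≠ 0 := by
              rw [Complex.ofReal_ne_zero]; linarith
            field_simp
      _ ≤ _ := main
      _ ≤ _ := by
          refine mul_le_mul' le_rfl ?_
          calc ∫⁻ ξ, ‖h ξ‖ₑ ^ 2 ∂ν ≤ ∫⁻ ξ, ‖h ξ‖ₑ ^ 2 := setLIntegral_le_lintegral _ _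
            _ ≤ _ := by
              refine lintegral_mono fun ξ => ?_
              exact pow_le_pow_left' (enorm_le_iff_norm_le.2 (bh ξ)) 2
  · have : Function.uncurry E = (Set.univ ×ˢ I).indicator (fun p : ℝ × ℝ => ((4 - p.2 ^ 2 : ℝ) : ℂ) *
        Complex.exp (Complex.I * ((p.1 * p.2 : ℝ) : ℂ))) := by
      ext ⟨x, ξ⟩
      by_cases h2 : ξ ∈ I <;> simp [Function.uncurry, hE, h2]
    rw [this]
    exact Measurable.indicator (by fun_prop) (MeasurableSet.univ.prod measurableSet_Ioc)
  · intro x ξ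
    by_cases h2 : ξ ∈ I
    · simp only [hE]
      rw [Set.indicator_of_mem h2, norm_mul, nexp, mul_one, Complex.norm_real, Real.norm_eq_abs]
      have : ξ ^ 2 ≤ 4 := by nlinarith [h2.1, h2.2]
      rw [abs_of_nonneg (by linarith)]; nlinarith [sq_nonneg ξ]
    · simp only [hE]
      rw [Set.indicator_of_notMem h2]; simp
  · fun_prop
  · intro x y
    have e1 : ∫ ξ, E x ξ * (starRingEnd ℂ) (E y ξ) ∂ν = ∫ u in (-2:ℝ)..2, (((4 - u ^ 2) ^ 2 : ℝ) : ℂ) *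
        Complex.exp (Complex.I * (x - y : ℝ) * u) := by
      rw [intervalIntegral.integral_of_le (by norm_num)]
      refine setIntegral_congr_fun measurableSet_Ioc fun ξ hξ => ?_
      simp only [hE]
      rw [Set.indicator_of_mem hξ, Set.indicator_of_mem hξ, map_mul, Complex.conj_ofReal,
        ← Complex.exp_conj, map_mul, Complex.conj_I, Complex.conj_ofReal]
      rw [mul_mul_mul_comm, ← Complex.exp_add]
      push_cast
      congr 1
      · ring
      · congr 1; ring
    rw [e1, ← ofReal_norm]
    apply ENNReal.ofReal_le_ofReal
    rw [← div_eq_mul_inv]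
    exact low_kernel _
  · rw [← ofReal_integral_eq_lintegral_ofReal (integrable_inv_one_add_sq.const_mul _)
      (Filter.Eventually.of_forall fun z => by simp only [Pi.zero_apply]; positivity),
      integral_const_mul, integral_univ_inv_one_add_sq]
  · exact (hg.restrict I).of_le hhm.aestronglyMeasurable (Filter.Eventually.of_forall bh)


lemma kernel_int (c C0 γ : ℝ) (hc : 0 < c) (hC0 : 0 < C0) (hγ : 1 < γ) : ∃ C : ℝ, 0 < C ∧
    ∀ M N : ℝ, 1 ≤ M → 0 < N →
    ∫⁻ z : ℝ, ENNReal.ofReal (C0 * ((1 + (N * z) ^ 2)⁻¹ +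
      |N * z| ^ (-(1/2) : ℝ) * Real.exp (-(c * M ^ (1 - γ)) * |N * z| ^ γ))) ≤
      ENNReal.ofReal (C * M ^ ((1 - 1 / γ) / 2) * N⁻¹) := by
  have hγ0 : 0 < γ := by linarith
  set G : ℝ := 2 * (c ^ (-(-(1/2) + 1) / γ) * (1 / γ) * Real.Gamma ((-(1/2) + 1) / γ)) with hG
  have hG0 : 0 < G := by
    have : 0 < Real.Gamma ((-(1/2) + 1) / γ) := Real.Gamma_pos_of_pos (by norm_num; positivity)
    positivity
  refine ⟨C0 * (Real.pi + G), by positivity, fun M N hM hN => ?_⟩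
  have hM0 : 0 < M := by linarith
  set κ := c * M ^ (1 - γ) with hκ
  have hκ0 : 0 < κ := by positivity
  have e1 : ∫ u : ℝ, |u| ^ (-(1/2) : ℝ) * Real.exp (-κ * |u| ^ γ) = G * M ^ ((1 - 1 / γ) / 2) := by
    rw [integral_comp_abs (f := fun u => u ^ (-(1/2) : ℝ) * Real.exp (-κ * u ^ γ)),
      integral_rpow_mul_exp_neg_mul_rpow hγ0 (by norm_num) hκ0, hκ,
      Real.mul_rpow hc.le (by positivity), ← Real.rpow_mul hM0.le, hG]
    have : (1 - γ) * (-(-(1 / 2) + 1) / γ) = (1 - 1 / γ) / 2 := by field_simp; ring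
    rw [this]; ring
  have i1 : Integrable (fun u : ℝ => |u| ^ (-(1/2) : ℝ) * Real.exp (-κ * |u| ^ γ)) := by
    apply Integrable.of_integral_ne_zero
    rw [e1]; positivity
  set h : ℝ → ℝ := fun u => C0 * ((1 + u ^ 2)⁻¹ + |u| ^ (-(1/2) : ℝ) * Real.exp (-κ * |u| ^ γ))
  have ih : Integrable h := (integrable_inv_one_add_sq.add i1).const_mul C0
  have e2 : ∫ u, h u = C0 * (Real.pi + G * M ^ ((1 - 1 / γ) / 2)) := by
    simp only [h]
    rw [integral_const_mul, integral_add integrable_inv_one_add_sq i1, e1, integral_univ_inv_one_add_sq]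
  have e3 : ∫ z, h (N * z) = N⁻¹ * (C0 * (Real.pi + G * M ^ ((1 - 1 / γ) / 2))) := by
    rw [Measure.integral_comp_mul_left h N, e2, abs_of_pos (by positivity), smul_eq_mul]
  change ∫⁻ z : ℝ, ENNReal.ofReal (h (N * z)) ≤ _
  rw [← ofReal_integral_eq_lintegral_ofReal (ih.comp_mul_left' hN.ne')
    (Filter.Eventually.of_forall fun z => by simp only [Pi.zero_apply, h]; positivity), e3]
  apply ENNReal.ofReal_le_ofReal
  have h1 : 1 ≤ M ^ ((1 - 1 / γ) / 2) := Real.one_le_rpow hM (by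
    have : 1 / γ ≤ 1 := by rw [div_le_one hγ0]; exact hγ.le
    linarith)
  have : Real.pi + G * M ^ ((1 - 1 / γ) / 2) ≤ (Real.pi + G) * M ^ ((1 - 1 / γ) / 2) := by
    nlinarith [Real.pi_pos]
  calc N⁻¹ * (C0 * (Real.pi + G * M ^ ((1 - 1 / γ) / 2)))
      ≤ N⁻¹ * (C0 * ((Real.pi + G) * M ^ ((1 - 1 / γ) / 2))) := by gcongr
    _ = _ := by ring

/-- the phase factor of the evolution -/
noncomputable def phs (a γ t x ξ : ℝ) : ℂ :=
  Complex.exp (Complex.I * ((t * |ξ| ^ a : ℝ) : ℂ) - ((t ^ γ * |ξ| ^ a : ℝ) : ℂ)) *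
    Complex.exp (Complex.I * ((x * ξ : ℝ) : ℂ))

lemma Pop_eq (a γ : ℝ) (f : ℝ → ℂ) (t x : ℝ) : Pop a γ f t x = ∫ ξ, f ξ * phs a γ t x ξ := by
  simp only [Pop, phs, mul_assoc]

lemma phs_norm (a γ t x ξ : ℝ) (ht : 0 ≤ t) : ‖phs a γ t x ξ‖ ≤ 1 := by
  have h : 0 ≤ t ^ γ * |ξ| ^ a := by positivity
  simp only [phs]
  rw [← Complex.exp_add, Complex.norm_exp, Real.exp_le_one_iff]
  have e : (Complex.I * ((t * |ξ| ^ a : ℝ) : ℂ) - ((t ^ γ * |ξ| ^ a : ℝ) : ℂ) +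
      Complex.I * ((x * ξ : ℝ) : ℂ)).re = - (t ^ γ * |ξ| ^ a) := by
    rw [Complex.add_re, Complex.sub_re, Complex.re_mul_ofReal, Complex.re_mul_ofReal,
      Complex.ofReal_re, Complex.I_re]
    ring
  rw [e]; linarith

lemma phs_ne (a γ t x ξ : ℝ) : phs a γ t x ξ ≠ 0 :=
  mul_ne_zero (Complex.exp_ne_zero _) (Complex.exp_ne_zero _)

lemma phs_meas (a γ : ℝ) : Measurable (fun p : ℝ × ℝ × ℝ => phs a γ p.1 p.2.1 p.2.2) := by
  unfold phs; fun_prop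

lemma tau_ineq (γ s t : ℝ) (hγ : 1 < γ) (hs : 0 < s) (ht : 0 < t) : |s - t| ^ γ ≤ s ^ γ + t ^ γ := by
  have h1 : 0 < s ^ γ := by positivity
  have h2 : 0 < t ^ γ := by positivity
  rcases le_total s t with h | h
  · have : |s - t| ^ γ ≤ t ^ γ := Real.rpow_le_rpow (abs_nonneg _) (by rw [abs_sub_comm, abs_of_nonneg (by linarith)]; linarith) (by linarith)
    linarith
  · have : |s - t| ^ γ ≤ s ^ γ := Real.rpow_le_rpow (abs_nonneg _) (by rw [abs_of_nonneg (by linarith)]; linarith) (by linarith)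
    linarith

/-- the weight -/
noncomputable def wgt (a M ξ : ℝ) : ℝ := bumpP (ξ ^ a / M) * (a * ξ ^ (a - 1) / M)

lemma kernel_eq (a γ M : ℝ) (ha : 0 < a) (ha1 : a < 1) (hM : 0 < M) (s t x y : ℝ) :
    ∫ ξ in ((M / 2) ^ (1 / a))..((5 * M / 2) ^ (1 / a)), (wgt a M ξ : ℂ) *
      (phs a γ s x ξ * (starRingEnd ℂ) (phs a γ t y ξ)) =
    oscJ (1 / a) (M ^ (1 / a) * (x - y)) (M * (s - t)) (M * (s ^ γ + t ^ γ)) := by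
  have hA : 0 < (M / 2) ^ (1 / a) := by positivity
  have hAB : (M / 2) ^ (1 / a) ≤ (5 * M / 2) ^ (1 / a) :=
    Real.rpow_le_rpow (by positivity) (by linarith) (by positivity)
  have hu : Set.uIcc ((M / 2) ^ (1 / a)) ((5 * M / 2) ^ (1 / a)) =
    Set.Icc ((M / 2) ^ (1 / a)) ((5 * M / 2) ^ (1 / a)) := Set.uIcc_of_le hAB
  have hpos : ∀ ξ ∈ Set.Icc ((M / 2) ^ (1 / a)) ((5 * M / 2) ^ (1 / a)), 0 < ξ := fun ξ hξ =>
    hA.trans_le hξ.1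
  set G : ℝ → ℂ := fun u => (bumpP u : ℂ) *
    Complex.exp ((Complex.I * ((M * (s - t) : ℝ) : ℂ) - ((M * (s ^ γ + t ^ γ) : ℝ) : ℂ)) * u +
      Complex.I * ((M ^ (1 / a) * (x - y) * u ^ (1 / a) : ℝ) : ℂ)) with hG
  have := intervalIntegral.integral_deriv_smul_comp' (a := (M / 2) ^ (1 / a)) (b := (5 * M / 2) ^ (1 / a))
    (f := fun ξ => ξ ^ a / M) (f' := fun ξ => a * ξ ^ (a - 1) / M) (g := G) ?_ ?_ ?_
  · have e1 : ((M / 2) ^ (1 / a)) ^ a / M = 1 / 2 := by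
      rw [← Real.rpow_mul (by positivity), one_div_mul_cancel ha.ne', Real.rpow_one]; field_simp
    have e2 : ((5 * M / 2) ^ (1 / a)) ^ a / M = 5 / 2 := by
      rw [← Real.rpow_mul (by positivity), one_div_mul_cancel ha.ne', Real.rpow_one]; field_simp
    simp only [e1, e2] at this
    unfold oscJ
    rw [← this]
    refine intervalIntegral.integral_congr fun ξ hξ => ?_
    rw [hu] at hξ
    have h0 := hpos ξ hξ
    have e3 : M ^ (1 / a) * (ξ ^ a / M) ^ (1 / a) = ξ := by
      rw [← Real.mul_rpow hM.le (by positivity), mul_div_cancel₀ _ hM.ne', ← Real.rpow_mul h0.le,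
        mul_one_div_cancel ha.ne', Real.rpow_one]
    simp only [hG, Function.comp, wgt, phs, abs_of_pos h0, Complex.real_smul]
    rw [map_mul, ← Complex.exp_conj, ← Complex.exp_conj, ← Complex.exp_add, ← Complex.exp_add,
      ← Complex.exp_add]
    have e4 : M ^ (1 / a) * (x - y) * (ξ ^ a / M) ^ (1 / a) = (x - y) * ξ := by
      rw [mul_right_comm, e3, mul_comm]
    rw [e4]
    simp only [map_sub, map_mul, Complex.conj_I, Complex.conj_ofReal]
    have hMc : (M : ℂ) ≠ 0 := by exact_mod_cast hM.ne'
    have e5 : Complex.I * ((s * ξ ^ a : ℝ) : ℂ) - ((s ^ γ * ξ ^ a : ℝ) : ℂ) + Complex.I * ((x * ξ : ℝ) : ℂ) +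
        (-Complex.I * ((t * ξ ^ a : ℝ) : ℂ) - ((t ^ γ * ξ ^ a : ℝ) : ℂ) + -Complex.I * ((y * ξ : ℝ) : ℂ)) =
        (Complex.I * ((M * (s - t) : ℝ) : ℂ) - ((M * (s ^ γ + t ^ γ) : ℝ) : ℂ)) * ((ξ ^ a / M : ℝ) : ℂ) +
        Complex.I * (((x - y) * ξ : ℝ) : ℂ) := by
      push_cast
      field_simp
      ring
    rw [e5]
    push_cast
    ring
  · intro ξ hξ
    rw [hu] at hξ
    exact (Real.hasDerivAt_rpow_const (Or.inl (hpos ξ hξ).ne')).div_const M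
  · rw [hu]
    intro ξ hξ
    exact (((Real.continuousAt_rpow_const _ _ (Or.inl (hpos ξ hξ).ne')).const_mul a).div_const M).continuousWithinAt
  · have : Continuous G := by
      simp only [hG]
      have := cont_bump
      have h2 : Continuous (fun u : ℝ => u ^ (1 / a)) := Real.continuous_rpow_const (by positivity)
      fun_prop
    exact this.continuousOn


lemma wgt_lower (a M ξ : ℝ) (ha : 0 < a) (ha1 : a < 1) (hM : 1 ≤ M) (h0 : 0 < ξ) (h1 : M ≤ ξ ^ a)
    (h2 : ξ ^ a ≤ 2 * M) : 1 ≤ 2 ^ (1 / a) / a * M ^ (1 / a) * wgt a M ξ := by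
  have hM0 : 0 < M := by linarith
  have u1 : 1 ≤ ξ ^ a / M := by rwa [le_div_iff₀ hM0, one_mul]
  have u2 : ξ ^ a / M ≤ 2 := by rwa [div_le_iff₀ hM0]
  have b1 : 1 / 2 ≤ bumpP (ξ ^ a / M) := by
    unfold bumpP
    have : 3 / 4 ≤ (ξ ^ a / M - 1/2) * (5/2 - ξ ^ a / M) := by nlinarith
    nlinarith
  have e1 : ξ ≤ (2 * M) ^ (1 / a) := by
    have := Real.rpow_le_rpow (by positivity) h2 (show 0 ≤ 1 / a by positivity)
    rwa [← Real.rpow_mul h0.le, mul_one_div_cancel ha.ne', Real.rpow_one] at this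
  have e2 : (2 * M) ^ (1 - 1 / a) ≤ ξ ^ (a - 1) := by
    have := Real.rpow_le_rpow_of_nonpos h0 e1 (show a - 1 ≤ 0 by linarith)
    rw [← Real.rpow_mul (by positivity)] at this
    convert this using 2
    field_simp
  have e3 : 2 ^ (1 / a) * M ^ (1 / a) * (2 * M) ^ (1 - 1 / a) = 2 * M := by
    rw [← Real.mul_rpow (by norm_num) hM0.le, ← Real.rpow_add (by positivity)]
    simp
  unfold wgt
  calc (1:ℝ) = 1 / (a * M) * (1/2 * a) * (2 * M) := by field_simp
    _ = 1 / (a * M) * (1/2 * a) * (2 ^ (1 / a) * M ^ (1 / a) * (2 * M) ^ (1 - 1 / a)) := by rw [e3]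
    _ ≤ 1 / (a * M) * (bumpP (ξ ^ a / M) * a) * (2 ^ (1 / a) * M ^ (1 / a) * ξ ^ (a - 1)) := by gcongr
    _ = _ := by field_simp

lemma wgt_upper (a M ξ : ℝ) (ha : 0 < a) (ha1 : a < 1) (hM : 1 ≤ M)
    (hξ : ξ ∈ Set.Ioc ((M / 2) ^ (1 / a)) ((5 * M / 2) ^ (1 / a))) :
    0 ≤ wgt a M ξ ∧ wgt a M ξ ≤ a * ((M / 2) ^ (1 / a)) ^ (a - 1) / M := by
  have hM0 : 0 < M := by linarith
  have hA : 0 < (M / 2) ^ (1 / a) := by positivity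
  have h0 : 0 < ξ := hA.trans hξ.1
  have l1 : M / 2 ≤ ξ ^ a := by
    have := Real.rpow_le_rpow hA.le hξ.1.le ha.le
    rwa [← Real.rpow_mul (by positivity), one_div_mul_cancel ha.ne', Real.rpow_one] at this
  have l2 : ξ ^ a ≤ 5 * M / 2 := by
    have := Real.rpow_le_rpow h0.le hξ.2 ha.le
    rwa [← Real.rpow_mul (by positivity), one_div_mul_cancel ha.ne', Real.rpow_one] at this
  have hb : |bumpP (ξ ^ a / M)| ≤ 1 := bump_abs_le ⟨by rw [le_div_iff₀ hM0]; linarith, by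
    rw [div_le_iff₀ hM0]; linarith⟩
  have hb0 : 0 ≤ bumpP (ξ ^ a / M) := sq_nonneg _
  rw [abs_of_nonneg hb0] at hb
  have e2 : ξ ^ (a - 1) ≤ ((M / 2) ^ (1 / a)) ^ (a - 1) :=
    Real.rpow_le_rpow_of_nonpos hA hξ.1.le (by linarith)
  unfold wgt
  refine ⟨by positivity, ?_⟩
  calc _ ≤ 1 * (a * ((M / 2) ^ (1 / a)) ^ (a - 1) / M) := by gcongr
    _ = _ := one_mul _

set_option maxHeartbeats 2000000 in
lemma piece_tau (a γ : ℝ) (ha : 0 < a) (ha1 : a < 1) (hγ : 1 < γ) : ∃ C : ℝ, 0 < C ∧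
    ∀ M : ℝ, 1 ≤ M → ∀ g : ℝ → ℂ, Measurable g → MemLp g 2 volume →
    (∀ ξ, g ξ ≠ 0 → 0 < ξ ∧ M ≤ ξ ^ a ∧ ξ ^ a ≤ 2 * M) →
    ∀ τ : ℝ → ℝ, Measurable τ → (∀ x, 0 < τ x) →
    ∫⁻ x, ‖Pop a γ g (τ x) x‖ₑ ^ 2 ≤ ENNReal.ofReal (C * M ^ ((1 - 1 / γ) / 2)) * ∫⁻ ξ, ‖g ξ‖ₑ ^ 2 := by
  have hb : 1 < 1 / a := by rw [lt_div_iff₀ ha]; linarith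
  obtain ⟨c, C0, hc, hC0, hJ⟩ := oscJ_bound (1 / a) γ hb hγ
  obtain ⟨C2, hC2, hkint⟩ := kernel_int c C0 γ hc hC0 hγ
  set C1 : ℝ := 2 ^ (1 / a) / a with hC1
  have hC1p : 0 < C1 := by positivity
  refine ⟨C2 * C1, by positivity, fun M hM g hgm hg hs τ hτ hτ0 => ?_⟩
  have hM0 : 0 < M := by linarith
  have hA : 0 < (M / 2) ^ (1 / a) := by positivity
  have hAB : (M / 2) ^ (1 / a) ≤ (5 * M / 2) ^ (1 / a) :=
    Real.rpow_le_rpow (by positivity) (by linarith) (by positivity)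
  set I : Set ℝ := Set.Ioc ((M / 2) ^ (1 / a)) ((5 * M / 2) ^ (1 / a)) with hI
  have hgI : ∀ ξ, g ξ ≠ 0 → ξ ∈ I := fun ξ h => by
    obtain ⟨h0, h1, h2⟩ := hs ξ h
    have e : (ξ ^ a) ^ (1 / a) = ξ := by
      rw [← Real.rpow_mul h0.le, mul_one_div_cancel ha.ne', Real.rpow_one]
    constructor
    · rw [← e]; exact Real.rpow_lt_rpow (by positivity) (by linarith) (by positivity)
    · rw [← e]; exact Real.rpow_le_rpow (by positivity) (by linarith) (by positivity)
  set ν : Measure ℝ := volume.restrict I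
  have : IsFiniteMeasure ν := ⟨by
    rw [Measure.restrict_apply_univ]; exact measure_Ioc_lt_top⟩
  set E : ℝ → ℝ → ℂ := fun x ξ => I.indicator (fun ξ => ((√(wgt a M ξ) : ℝ) : ℂ) *
    phs a γ (τ x) x ξ) ξ with hE
  set h : ℝ → ℂ := fun ξ => g ξ / ((√(wgt a M ξ) : ℝ) : ℂ) with hh
  have hwm : Measurable (fun ξ => wgt a M ξ) := by
    unfold wgt
    have := cont_bump.measurable
    fun_prop
  have wpos : ∀ ξ, g ξ ≠ 0 → 0 < wgt a M ξ := fun ξ h => by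
    obtain ⟨h0, h1, h2⟩ := hs ξ h
    have := wgt_lower a M ξ ha ha1 hM h0 h1 h2
    by_contra hcon
    push Not at hcon
    have : 2 ^ (1 / a) / a * M ^ (1 / a) * wgt a M ξ ≤ 0 := mul_nonpos_of_nonneg_of_nonpos (by positivity) hcon
    linarith
  have bh : ∀ ξ, ‖h ξ‖ ^ 2 ≤ C1 * M ^ (1 / a) * ‖g ξ‖ ^ 2 := fun ξ => by
    by_cases h1 : g ξ = 0
    · simp [hh, h1]
    · obtain ⟨h0, h2, h3⟩ := hs ξ h1
      have hl := wgt_lower a M ξ ha ha1 hM h0 h2 h3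
      have hw := wpos ξ h1
      simp only [hh]
      rw [norm_div, Complex.norm_real, Real.norm_eq_abs, div_pow, sq_abs, Real.sq_sqrt hw.le,
        div_le_iff₀ hw]
      nlinarith [sq_nonneg ‖g ξ‖]
  have bh' : ∀ ξ, ‖h ξ‖ ≤ √(C1 * M ^ (1 / a)) * ‖g ξ‖ := fun ξ => by
    apply le_of_sq_le_sq _ (by positivity)
    rw [mul_pow, Real.sq_sqrt (by positivity)]
    exact bh ξ
  have hhm : Measurable h := by
    simp only [hh]; fun_prop
  have phm : Measurable (fun p : ℝ × ℝ => phs a γ (τ p.1) p.1 p.2) :=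
    (phs_meas a γ).comp ((hτ.comp measurable_fst).prodMk (measurable_fst.prodMk measurable_snd))
  have main := tt_star_R ν E ?_ (√(a * ((M / 2) ^ (1 / a)) ^ (a - 1) / M)) ?_ (fun z => ENNReal.ofReal (C0 *
      ((1 + (M ^ (1 / a) * z) ^ 2)⁻¹ + |M ^ (1 / a) * z| ^ (-(1/2) : ℝ) *
      Real.exp (-(c * M ^ (1 - γ)) * |M ^ (1 / a) * z| ^ γ)))) ?_ ?_
      (C2 * M ^ ((1 - 1 / γ) / 2) * (M ^ (1 / a))⁻¹)
    (by positivity) (hkint M _ hM (by positivity)) h hhm ?_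
  · calc _ = ∫⁻ x, ‖∫ ξ, h ξ * E x ξ ∂ν‖ₑ ^ 2 := by
          congr 1; ext x; congr 2
          rw [← integral_indicator measurableSet_Ioc, Pop_eq]
          congr 1; ext ξ
          by_cases h1 : g ξ = 0
          · by_cases h2 : ξ ∈ I
            · rw [Set.indicator_of_mem h2]; simp [hh, h1]
            · rw [Set.indicator_of_notMem h2]; simp [h1]
          · have h2 := hgI ξ h1
            rw [Set.indicator_of_mem h2]
            simp only [hh, hE]
            rw [Set.indicator_of_mem h2]
            have : ((√(wgt a M ξ) : ℝ) : ℂ) ≠ 0 := by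
              rw [Complex.ofReal_ne_zero]; exact (Real.sqrt_pos.2 (wpos ξ h1)).ne'
            field_simp
      _ ≤ _ := main
      _ ≤ ENNReal.ofReal (C2 * M ^ ((1 - 1 / γ) / 2) * (M ^ (1 / a))⁻¹) *
          (ENNReal.ofReal (C1 * M ^ (1 / a)) * ∫⁻ ξ, ‖g ξ‖ₑ ^ 2) := by
          refine mul_le_mul' le_rfl ?_
          rw [← lintegral_const_mul' _ _ (by simp)]
          refine (setLIntegral_le_lintegral _ _).trans (lintegral_mono fun ξ => ?_)
          rw [← ofReal_norm, ← ofReal_norm, ← ENNReal.ofReal_pow (norm_nonneg _),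
            ← ENNReal.ofReal_pow (norm_nonneg _), ← ENNReal.ofReal_mul (by positivity)]
          exact ENNReal.ofReal_le_ofReal (bh ξ)
      _ = _ := by
          rw [← mul_assoc, ← ENNReal.ofReal_mul (by positivity)]
          congr 2
          have : M ^ (1 / a) ≠ 0 := by positivity
          field_simp
  · have : Function.uncurry E = (Set.univ ×ˢ I).indicator (fun p : ℝ × ℝ =>
        ((√(wgt a M p.2) : ℝ) : ℂ) * phs a γ (τ p.1) p.1 p.2) := by
      ext ⟨x, ξ⟩
      by_cases h2 : ξ ∈ I <;> simp [Function.uncurry, hE, h2]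
    rw [this]
    refine Measurable.indicator (Measurable.mul ?_ phm) (MeasurableSet.univ.prod measurableSet_Ioc)
    exact Complex.measurable_ofReal.comp ((hwm.comp measurable_snd).sqrt)
  · intro x ξ
    simp only [hE]
    by_cases h2 : ξ ∈ I
    · rw [Set.indicator_of_mem h2, norm_mul, Complex.norm_real, Real.norm_eq_abs,
        abs_of_nonneg (Real.sqrt_nonneg _)]
      calc _ ≤ √(a * ((M / 2) ^ (1 / a)) ^ (a - 1) / M) * 1 := by
            gcongr
            · exact (wgt_upper a M ξ ha ha1 hM h2).2
            · exact phs_norm _ _ _ _ _ (hτ0 x).le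
        _ = _ := mul_one _
    · rw [Set.indicator_of_notMem h2]; simp
  · fun_prop
  · intro x y
    have e1 : ∫ ξ, E x ξ * (starRingEnd ℂ) (E y ξ) ∂ν = oscJ (1 / a) (M ^ (1 / a) * (x - y))
        (M * (τ x - τ y)) (M * (τ x ^ γ + τ y ^ γ)) := by
      rw [← kernel_eq a γ M ha ha1 hM0, intervalIntegral.integral_of_le hAB]
      refine setIntegral_congr_fun measurableSet_Ioc fun ξ hξ => ?_
      simp only [hE]
      rw [Set.indicator_of_mem hξ, Set.indicator_of_mem hξ, map_mul, Complex.conj_ofReal,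
        mul_mul_mul_comm, ← Complex.ofReal_mul, Real.mul_self_sqrt (wgt_upper a M ξ ha ha1 hM hξ).1]
    rw [e1, ← ofReal_norm]
    apply ENNReal.ofReal_le_ofReal
    apply hJ _ _ _ M hM0
    have := tau_ineq γ _ _ hγ (hτ0 x) (hτ0 y)
    rw [abs_mul, abs_of_pos hM0, Real.mul_rpow hM0.le (abs_nonneg _), mul_right_comm,
      ← Real.rpow_add hM0]
    simp only [add_sub_cancel, Real.rpow_one]
    gcongr
  · refine MemLp.of_le_mul (hg.restrict I) hhm.aestronglyMeasurable (Filter.Eventually.of_forall bh')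


/-- extended-real-valued maximal function -/
noncomputable def Pmax (a γ : ℝ) (f : ℝ → ℂ) (x : ℝ) : ENNReal :=
  ⨆ t : Set.Ioo (0 : ℝ) 1, ‖Pop a γ f t x‖ₑ

lemma Pop_meas (a γ : ℝ) (g : ℝ → ℂ) (hgm : Measurable g) :
    Measurable (fun p : ℝ × ℝ => Pop a γ g p.1 p.2) := by
  have h1 : Measurable (fun q : (ℝ × ℝ) × ℝ => phs a γ q.1.1 q.1.2 q.2) := by
    unfold phs; fun_prop
  have h2 : Measurable (fun q : (ℝ × ℝ) × ℝ => g q.2) := hgm.comp measurable_snd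
  have h3 : StronglyMeasurable (fun q : (ℝ × ℝ) × ℝ => g q.2 * phs a γ q.1.1 q.1.2 q.2) :=
    (h2.mul h1).stronglyMeasurable
  have h4 := (StronglyMeasurable.integral_prod_right' (ν := volume) h3).measurable
  have e : (fun p : ℝ × ℝ => Pop a γ g p.1 p.2) =
      fun p : ℝ × ℝ => ∫ ξ, g ξ * phs a γ p.1 p.2 ξ := funext fun p => Pop_eq a γ g p.1 p.2
  rw [e]
  exact h4

lemma phs_cont_t (a γ x ξ : ℝ) (hγ : 1 < γ) : Continuous (fun t => phs a γ t x ξ) := by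
  have h2 : Continuous (fun u : ℝ => u ^ γ) := Real.continuous_rpow_const (by linarith)
  unfold phs
  fun_prop

lemma phs_meas_xi (a γ t x : ℝ) : Measurable (fun ξ => phs a γ t x ξ) := by
  unfold phs; fun_prop

lemma Pop_cont (a γ : ℝ) (hγ : 1 < γ) (g : ℝ → ℂ) (hg : Integrable g) (x : ℝ) :
    Continuous (fun t : Set.Ioo (0:ℝ) 1 => Pop a γ g t x) := by
  simp only [Pop_eq]
  refine continuous_of_dominated (bound := fun ξ => ‖g ξ‖) ?_ ?_ hg.norm ?_
  · intro t
    exact hg.aestronglyMeasurable.mul (phs_meas_xi _ _ _ _).aestronglyMeasurable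
  · intro t
    refine Filter.Eventually.of_forall fun ξ => ?_
    rw [norm_mul]
    exact mul_le_of_le_one_right (norm_nonneg _) (phs_norm _ _ _ _ _ t.2.1.le)
  · refine Filter.Eventually.of_forall fun ξ => ?_
    exact continuous_const.mul ((phs_cont_t a γ x ξ hγ).comp continuous_subtype_val)

/-- running argmax over a sequence of times -/
noncomputable def tauSeq (a γ : ℝ) (g : ℝ → ℂ) (d : ℕ → Set.Ioo (0:ℝ) 1) : ℕ → ℝ → ℝ
  | 0 => fun _ => (d 0 : ℝ)
  | n + 1 => {x | ‖Pop a γ g (tauSeq a γ g d n x) x‖ₑ ≤ ‖Pop a γ g (d (n+1)) x‖ₑ}.indicator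
      (fun _ => (d (n+1) : ℝ)) +
      {x | ‖Pop a γ g (tauSeq a γ g d n x) x‖ₑ ≤ ‖Pop a γ g (d (n+1)) x‖ₑ}ᶜ.indicator
      (tauSeq a γ g d n)

lemma tauSeq_succ (a γ : ℝ) (g : ℝ → ℂ) (d : ℕ → Set.Ioo (0:ℝ) 1) (n : ℕ) (x : ℝ) :
    (‖Pop a γ g (tauSeq a γ g d n x) x‖ₑ ≤ ‖Pop a γ g (d (n+1)) x‖ₑ ∧
      tauSeq a γ g d (n+1) x = d (n+1)) ∨
    (‖Pop a γ g (d (n+1)) x‖ₑ ≤ ‖Pop a γ g (tauSeq a γ g d n x) x‖ₑ ∧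
      tauSeq a γ g d (n+1) x = tauSeq a γ g d n x) := by
  by_cases h : ‖Pop a γ g (tauSeq a γ g d n x) x‖ₑ ≤ ‖Pop a γ g (d (n+1)) x‖ₑ
  · left; refine ⟨h, ?_⟩; simp [tauSeq, h]
  · right; refine ⟨(not_le.1 h).le, ?_⟩; simp [tauSeq, h]

lemma tauSeq_meas (a γ : ℝ) (g : ℝ → ℂ) (hgm : Measurable g) (d : ℕ → Set.Ioo (0:ℝ) 1) (n : ℕ) :
    Measurable (tauSeq a γ g d n) := by
  induction n with
  | zero => exact measurable_const
  | succ n ih =>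
    have hP := Pop_meas a γ g hgm
    have hS : MeasurableSet {x | ‖Pop a γ g (tauSeq a γ g d n x) x‖ₑ ≤ ‖Pop a γ g (d (n+1)) x‖ₑ} := by
      apply measurableSet_le
      · exact (hP.comp (ih.prodMk measurable_id)).enorm
      · exact (hP.comp (measurable_const.prodMk measurable_id)).enorm
    exact (measurable_const.indicator hS).add (ih.indicator hS.compl)

lemma tauSeq_mem (a γ : ℝ) (g : ℝ → ℂ) (d : ℕ → Set.Ioo (0:ℝ) 1) (n : ℕ) (x : ℝ) :
    tauSeq a γ g d n x ∈ Set.Ioo (0:ℝ) 1 := by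
  induction n with
  | zero => exact (d 0).2
  | succ n ih =>
    rcases tauSeq_succ a γ g d n x with ⟨_, h⟩ | ⟨_, h⟩
    · rw [h]; exact (d (n+1)).2
    · rw [h]; exact ih

lemma Pmax_eq (a γ : ℝ) (hγ : 1 < γ) (g : ℝ → ℂ) (hg : Integrable g) :
    ∃ d : ℕ → Set.Ioo (0:ℝ) 1, ∀ x, Pmax a γ g x = ⨆ n, ‖Pop a γ g (d n) x‖ₑ := by
  have : Nonempty (Set.Ioo (0:ℝ) 1) := ⟨⟨1/2, by norm_num, by norm_num⟩⟩
  refine ⟨TopologicalSpace.denseSeq _, fun x => le_antisymm (iSup_le fun t => ?_)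
    (iSup_le fun n => le_iSup (fun t : Set.Ioo (0:ℝ) 1 => ‖Pop a γ g t x‖ₑ) _)⟩
  refine DenseRange.induction_on (TopologicalSpace.denseRange_denseSeq (Set.Ioo (0:ℝ) 1)) t
    (p := fun t : Set.Ioo (0:ℝ) 1 => ‖Pop a γ g t x‖ₑ ≤ _) ?_ ?_
  · exact isClosed_le (Pop_cont a γ hγ g hg x).enorm continuous_const
  · intro n; exact le_iSup (fun n => ‖Pop a γ g (TopologicalSpace.denseSeq (Set.Ioo (0:ℝ) 1) n) x‖ₑ) n

lemma Pmax_meas (a γ : ℝ) (hγ : 1 < γ) (g : ℝ → ℂ) (hgm : Measurable g) (hg : Integrable g) :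
    Measurable (Pmax a γ g) := by
  obtain ⟨d, hd⟩ := Pmax_eq a γ hγ g hg
  have : Pmax a γ g = fun x => ⨆ n, ‖Pop a γ g (d n) x‖ₑ := funext hd
  rw [this]
  exact Measurable.iSup fun n => ((Pop_meas a γ g hgm).comp (measurable_const.prodMk measurable_id)).enorm

lemma max_of_tau (a γ : ℝ) (hγ : 1 < γ) (g : ℝ → ℂ) (hgm : Measurable g) (hg : Integrable g)
    (K : ENNReal) (h : ∀ τ : ℝ → ℝ, Measurable τ → (∀ x, 0 < τ x) →
      ∫⁻ x, ‖Pop a γ g (τ x) x‖ₑ ^ 2 ≤ K) : ∫⁻ x, Pmax a γ g x ^ 2 ≤ K := by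
  obtain ⟨d, hd⟩ := Pmax_eq a γ hγ g hg
  have hle : ∀ n x, ‖Pop a γ g (d n) x‖ₑ ≤ ‖Pop a γ g (tauSeq a γ g d n x) x‖ₑ := fun n x => by
    cases n with
    | zero => exact le_rfl
    | succ n =>
      rcases tauSeq_succ a γ g d n x with ⟨_, h⟩ | ⟨h1, h⟩
      · rw [h]
      · rw [h]; exact h1
  have hmono : ∀ x, Monotone (fun n => ‖Pop a γ g (tauSeq a γ g d n x) x‖ₑ) := fun x => by
    refine monotone_nat_of_le_succ fun n => ?_
    rcases tauSeq_succ a γ g d n x with ⟨h1, h⟩ | ⟨h1, h⟩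
    · rw [h]; exact h1
    · rw [h]
  calc ∫⁻ x, Pmax a γ g x ^ 2 ≤ ∫⁻ x, ⨆ n, ‖Pop a γ g (tauSeq a γ g d n x) x‖ₑ ^ 2 := by
        refine lintegral_mono fun x => ?_
        rw [← Monotone.map_iSup_of_continuousAt (f := fun y : ENNReal => y ^ 2)
          (ENNReal.continuous_pow 2).continuousAt (fun a b hab => pow_le_pow_left' hab 2) (by simp)]
        refine pow_le_pow_left' ?_ 2
        rw [hd x]
        exact iSup_mono fun n => hle n x
    _ = ⨆ n, ∫⁻ x, ‖Pop a γ g (tauSeq a γ g d n x) x‖ₑ ^ 2 := by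
        apply lintegral_iSup
        · intro n
          exact (((Pop_meas a γ g hgm).comp ((tauSeq_meas a γ g hgm d n).prodMk measurable_id)).enorm).pow_const 2
        · intro m n hmn x
          exact pow_le_pow_left' (hmono x hmn) 2
    _ ≤ K := iSup_le fun n => h _ (tauSeq_meas a γ g hgm d n) fun x => (tauSeq_mem a γ g d n x).1

lemma cs_tsum {ι : Type*} (c B : ι → ENNReal) :
    (∑' k, c k * B k) ^ 2 ≤ (∑' k, c k) * ∑' k, c k * B k ^ 2 := by
  have h2 : 2 * (∑' k, c k * B k) ^ 2 ≤ 2 * ((∑' k, c k) * ∑' k, c k * B k ^ 2) := by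
    calc 2 * (∑' k, c k * B k) ^ 2 = ∑' k, ∑' j, (c k * c j) * (2 * (B k * B j)) := by
          rw [sq, ← ENNReal.tsum_mul_right, ← ENNReal.tsum_mul_left]
          congr 1; ext k
          rw [← ENNReal.tsum_mul_left, ← ENNReal.tsum_mul_left]
          congr 1; ext j; ring
      _ ≤ ∑' k, ∑' j, (c k * c j) * (B k ^ 2 + B j ^ 2) :=
          ENNReal.tsum_le_tsum fun k => ENNReal.tsum_le_tsum fun j =>
            mul_le_mul' le_rfl (ennreal_two_mul_le _ _)
      _ = (∑' k, ∑' j, c k * (c j * B j ^ 2)) + ∑' k, ∑' j, (c k * B k ^ 2) * c j := by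
          rw [← ENNReal.tsum_add]
          congr 1; ext k
          rw [← ENNReal.tsum_add]
          congr 1; ext j; ring
      _ = _ := by
          simp only [ENNReal.tsum_mul_left, ENNReal.tsum_mul_right]; ring
  rwa [ENNReal.mul_le_mul_iff_right (by norm_num) (by norm_num)] at h2

lemma enorm_hasSum_le {ι : Type*} (z : ι → ℂ) (s : ℂ) (h : HasSum z s) : ‖s‖ₑ ≤ ∑' k, ‖z k‖ₑ := by
  refine le_of_tendsto (h.enorm) (Filter.Eventually.of_forall fun F => ?_)
  exact (enorm_sum_le _ _).trans (ENNReal.sum_le_tsum F)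

lemma pop_split {ι : Type*} [Countable ι] (a γ : ℝ) (f : ℝ → ℂ) (S : ι → Set ℝ)
    (hS : ∀ k, MeasurableSet (S k)) (hd : Pairwise (Function.onFun Disjoint S))
    (hc : ∀ ξ, f ξ ≠ 0 → ∃ k, ξ ∈ S k) (t x : ℝ) :
    ‖Pop a γ f t x‖ₑ ≤ ∑' k, ‖Pop a γ ((S k).indicator f) t x‖ₑ := by
  rw [Pop_eq]
  by_cases hi : Integrable (fun ξ => f ξ * phs a γ t x ξ)
  · have h1 := hasSum_integral_iUnion hS hd hi.integrableOn
    have e : ∫ ξ in ⋃ k, S k, f ξ * phs a γ t x ξ = ∫ ξ, f ξ * phs a γ t x ξ := by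
      apply setIntegral_eq_integral_of_forall_compl_eq_zero
      intro ξ hξ
      by_cases h : f ξ = 0
      · rw [h, zero_mul]
      · exact absurd (Set.mem_iUnion.2 (hc ξ h)) hξ
    rw [e] at h1
    refine (enorm_hasSum_le _ _ h1).trans (le_of_eq ?_)
    congr 1; ext k
    rw [Pop_eq, ← integral_indicator (hS k)]
    congr 2; ext ξ
    by_cases h : ξ ∈ S k <;> simp [h]
  · rw [integral_undef hi]; simp

lemma pmax_split {ι : Type*} [Countable ι] (a γ : ℝ) (f : ℝ → ℂ) (S : ι → Set ℝ)
    (hS : ∀ k, MeasurableSet (S k)) (hd : Pairwise (Function.onFun Disjoint S))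
    (hc : ∀ ξ, f ξ ≠ 0 → ∃ k, ξ ∈ S k) (x : ℝ) :
    Pmax a γ f x ≤ ∑' k, Pmax a γ ((S k).indicator f) x :=
  iSup_le fun t => (pop_split a γ f S hS hd hc t x).trans (ENNReal.tsum_le_tsum fun k =>
    le_iSup (fun t : Set.Ioo (0:ℝ) 1 => ‖Pop a γ ((S k).indicator f) t x‖ₑ) t)

lemma integrable_of_supp (g : ℝ → ℂ) (hg : MemLp g 2 volume) (R : ℝ)
    (h : ∀ ξ, g ξ ≠ 0 → ξ ∈ Set.Icc (-R) R) : Integrable g := by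
  have hs : Function.support g ⊆ Set.Icc (-R) R := fun ξ hξ => h ξ hξ
  rw [← integrableOn_iff_integrable_of_support_subset hs]
  have : IsFiniteMeasure (volume.restrict (Set.Icc (-R) R)) := ⟨by
    rw [Measure.restrict_apply_univ]; exact measure_Icc_lt_top⟩
  exact (hg.restrict _).integrable (by norm_num)

lemma memLp_two_of (g : ℝ → ℂ) (hgm : Measurable g) (h : ∫⁻ ξ, ‖g ξ‖ₑ ^ 2 ≠ ⊤) : MemLp g 2 volume := by
  refine ⟨hgm.aestronglyMeasurable, ?_⟩
  rw [eLpNorm_lt_top_iff_lintegral_rpow_enorm_lt_top (by norm_num) (by norm_num)]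
  have : ∫⁻ ξ, ‖g ξ‖ₑ ^ (ENNReal.toReal 2) = ∫⁻ ξ, ‖g ξ‖ₑ ^ 2 := by
    congr 1; ext ξ; simp
  rw [this]
  exact lt_top_iff_ne_top.2 h


lemma high_pos (a γ s : ℝ) (ha : 0 < a) (ha1 : a < 1) (hγ : 1 < γ) (hs : a / 4 * (1 - 1 / γ) < s) :
    ∃ K : ENNReal, K ≠ ⊤ ∧ ∀ f : ℝ → ℂ, Measurable f → (∀ ξ, f ξ ≠ 0 → 1 ≤ ξ) →
    ∫⁻ ξ, ENNReal.ofReal ((1 + ξ ^ 2) ^ s) * ‖f ξ‖ₑ ^ 2 ≠ ⊤ →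
    ∃ Φ : ℝ → ENNReal, Measurable Φ ∧ (∀ x, Pmax a γ f x ≤ Φ x) ∧
    ∫⁻ x, Φ x ^ 2 ≤ K * ∫⁻ ξ, ENNReal.ofReal ((1 + ξ ^ 2) ^ s) * ‖f ξ‖ₑ ^ 2 := by
  obtain ⟨C, hC, hp⟩ := piece_tau a γ ha ha1 hγ
  have hg1 : 0 < 1 - 1 / γ := by
    have : 1 / γ < 1 := by rw [div_lt_one (by linarith)]; exact hγ
    linarith
  have hs0 : 0 < s := lt_trans (by positivity) hs
  set e := (1 - 1 / γ) / 2 with he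
  set ε := 2 * s / a - e with hε
  have hε0 : 0 < ε := by
    rw [hε, sub_pos, lt_div_iff₀ ha, he]; linarith
  set r : ℝ := 2 ^ (-ε) with hr
  have hr0 : 0 < r := by positivity
  have hr1 : r < 1 := Real.rpow_lt_one_of_one_lt_of_neg (by norm_num) (by linarith)
  set c : ℕ → ENNReal := fun k => ENNReal.ofReal (r ^ k) with hc
  have hc0 : ∀ k, c k ≠ 0 := fun k => by
    simp only [hc, ne_eq, ENNReal.ofReal_eq_zero, not_le]; positivity
  have hct : ∀ k, c k ≠ ⊤ := fun k => ENNReal.ofReal_ne_top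
  have hcs : ∑' k, c k ≠ ⊤ := (summable_geometric_of_lt_one hr0.le hr1).tsum_ofReal_ne_top
  refine ⟨(∑' k, c k) * ENNReal.ofReal C, ENNReal.mul_ne_top hcs ENNReal.ofReal_ne_top,
    fun f hfm hf hW => ?_⟩
  set W : ℝ → ENNReal := fun ξ => ENNReal.ofReal ((1 + ξ ^ 2) ^ s) * ‖f ξ‖ₑ ^ 2 with hWdef
  have hW1 : ∀ ξ, ‖f ξ‖ₑ ^ 2 ≤ W ξ := fun ξ => by
    simp only [hWdef]
    refine le_mul_of_one_le_left' ?_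
    rw [ENNReal.one_le_ofReal]
    exact Real.one_le_rpow (by nlinarith [sq_nonneg ξ]) hs0.le
  set S : ℕ → Set ℝ := fun k => {ξ | 1 ≤ ξ ∧ (2:ℝ) ^ k ≤ ξ ^ a ∧ ξ ^ a < 2 ^ (k + 1)} with hS
  have hSm : ∀ k, MeasurableSet (S k) := fun k => by
    have h1 : Measurable (fun ξ : ℝ => ξ ^ a) := by fun_prop
    exact (measurableSet_le measurable_const measurable_id).inter
      ((measurableSet_le measurable_const h1).inter (measurableSet_lt h1 measurable_const))
  have hSd : Pairwise (Function.onFun Disjoint S) := by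
    have aux : ∀ m n : ℕ, m < n → Disjoint (S m) (S n) := fun m n hmn => by
      rw [Set.disjoint_left]
      rintro ξ ⟨_, _, h1⟩ ⟨_, h2, _⟩
      have : (2:ℝ) ^ (m + 1) ≤ 2 ^ n := pow_le_pow_right₀ (by norm_num) hmn
      linarith
    intro m n hmn
    rcases lt_or_gt_of_ne hmn with h | h
    · exact aux m n h
    · exact (aux n m h).symm
  have hSc : ∀ ξ, f ξ ≠ 0 → ∃ k, ξ ∈ S k := fun ξ h => by
    have h1 := hf ξ h
    have h2 : 1 ≤ ξ ^ a := Real.one_le_rpow h1 ha.le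
    obtain ⟨n, hn1, hn2⟩ := exists_nat_pow_near h2 (show (1:ℝ) < 2 by norm_num)
    exact ⟨n, h1, hn1, hn2⟩
  set fk : ℕ → ℝ → ℂ := fun k => (S k).indicator f with hfk
  have fkm : ∀ k, Measurable (fk k) := fun k => hfm.indicator (hSm k)
  have fkn : ∀ k ξ, fk k ξ ≠ 0 → ξ ∈ S k := fun k ξ h => by
    by_contra hcon
    exact h (Set.indicator_of_notMem hcon f)
  have fkl : ∀ k, MemLp (fk k) 2 volume := fun k => by
    refine memLp_two_of _ (fkm k) (ne_top_of_le_ne_top hW (lintegral_mono fun ξ => ?_))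
    refine le_trans ?_ (hW1 ξ)
    by_cases h : ξ ∈ S k <;> simp [hfk, h]
  have fki : ∀ k, Integrable (fk k) := fun k => by
    refine integrable_of_supp _ (fkl k) (((2:ℝ) ^ (k + 1)) ^ (1 / a)) fun ξ h => ?_
    obtain ⟨h1, h2, h3⟩ := fkn k ξ h
    have h4 : ξ ≤ ((2:ℝ) ^ (k + 1)) ^ (1 / a) := by
      have := Real.rpow_le_rpow (by positivity) h3.le (show 0 ≤ 1 / a by positivity)
      rwa [← Real.rpow_mul (by linarith), mul_one_div_cancel ha.ne', Real.rpow_one] at this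
    exact ⟨by linarith, h4⟩
  have fkb : ∀ k, (c k)⁻¹ * ∫⁻ x, Pmax a γ (fk k) x ^ 2 ≤ ENNReal.ofReal C * ∫⁻ ξ in S k, W ξ := fun k => by
    have h1 : ∫⁻ x, Pmax a γ (fk k) x ^ 2 ≤
        ENNReal.ofReal (C * ((2:ℝ) ^ k) ^ e) * ∫⁻ ξ, ‖fk k ξ‖ₑ ^ 2 := by
      refine max_of_tau a γ hγ (fk k) (fkm k) (fki k) _ fun τ hτ hτ0 => ?_
      refine hp _ (one_le_pow₀ (by norm_num)) (fk k) (fkm k) (fkl k) (fun ξ h => ?_) τ hτ hτ0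
      obtain ⟨h1, h2, h3⟩ := fkn k ξ h
      refine ⟨by linarith, h2, ?_⟩
      rw [pow_succ] at h3; linarith
    have h2 : (c k)⁻¹ = ENNReal.ofReal ((r ^ k)⁻¹) := by
      simp only [hc]; rw [ENNReal.ofReal_inv_of_pos (by positivity)]
    have h3 : ∫⁻ ξ, ‖fk k ξ‖ₑ ^ 2 = ∫⁻ ξ in S k, ‖f ξ‖ₑ ^ 2 := by
      rw [← lintegral_indicator (hSm k)]
      congr 1; ext ξ
      by_cases h : ξ ∈ S k <;> simp [hfk, h]
    rw [h3] at h1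
    calc (c k)⁻¹ * ∫⁻ x, Pmax a γ (fk k) x ^ 2 ≤ ENNReal.ofReal ((r ^ k)⁻¹) *
          (ENNReal.ofReal (C * ((2:ℝ) ^ k) ^ e) * ∫⁻ ξ in S k, ‖f ξ‖ₑ ^ 2) := by
            rw [h2]; exact mul_le_mul' le_rfl h1
      _ = ENNReal.ofReal C * (ENNReal.ofReal ((r ^ k)⁻¹ * ((2:ℝ) ^ k) ^ e) * ∫⁻ ξ in S k, ‖f ξ‖ₑ ^ 2) := by
            rw [ENNReal.ofReal_mul hC.le, ENNReal.ofReal_mul (by positivity)]; ring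
      _ ≤ _ := by
            refine mul_le_mul' le_rfl ?_
            rw [← lintegral_const_mul' _ _ ENNReal.ofReal_ne_top]
            refine setLIntegral_mono' (hSm k) fun ξ hξ => ?_
            simp only [hWdef]
            refine mul_le_mul' (ENNReal.ofReal_le_ofReal ?_) le_rfl
            obtain ⟨q1, q2, q3⟩ := hξ
            have q0 : 0 < ξ := by linarith
            have e1 : (r ^ k)⁻¹ * ((2:ℝ) ^ k) ^ e = ((2:ℝ) ^ k) ^ (2 * s / a) := by
              have : (r ^ k)⁻¹ = ((2:ℝ) ^ k) ^ ε := by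
                rw [hr, ← Real.rpow_natCast, ← Real.rpow_natCast, ← Real.rpow_mul (by norm_num),
                  ← Real.rpow_mul (by norm_num), ← Real.rpow_neg (by norm_num)]
                congr 1; ring
              rw [this, ← Real.rpow_add (by positivity)]
              congr 1; rw [hε]; ring
            rw [e1]
            calc ((2:ℝ) ^ k) ^ (2 * s / a) ≤ (ξ ^ a) ^ (2 * s / a) :=
                  Real.rpow_le_rpow (by positivity) q2 (by positivity)
              _ = (ξ ^ 2) ^ s := by
                  rw [← Real.rpow_natCast, ← Real.rpow_mul q0.le, ← Real.rpow_mul q0.le]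
                  congr 1; push_cast; field_simp
              _ ≤ _ := Real.rpow_le_rpow (by positivity) (by linarith) hs0.le
  refine ⟨fun x => ∑' k, Pmax a γ (fk k) x, Measurable.ennreal_tsum fun k =>
    Pmax_meas a γ hγ (fk k) (fkm k) (fki k), pmax_split a γ f S hSm hSd hSc, ?_⟩
  calc ∫⁻ x, (∑' k, Pmax a γ (fk k) x) ^ 2 ≤
        ∫⁻ x, (∑' k, c k) * ∑' k, (c k)⁻¹ * Pmax a γ (fk k) x ^ 2 := by
        refine lintegral_mono fun x => ?_
        calc (∑' k, Pmax a γ (fk k) x) ^ 2 ≤ (∑' k, c k * ((c k)⁻¹ * Pmax a γ (fk k) x)) ^ 2 := by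
              refine pow_le_pow_left' (le_of_eq ?_) 2
              congr 1; ext k
              rw [← mul_assoc, ENNReal.mul_inv_cancel (hc0 k) (hct k), one_mul]
          _ ≤ _ := cs_tsum _ _
          _ = _ := by
              congr 2; ext k
              rw [mul_pow, sq (c k)⁻¹, ← mul_assoc, ← mul_assoc, ENNReal.mul_inv_cancel (hc0 k) (hct k), one_mul]
    _ = (∑' k, c k) * ∑' k, (c k)⁻¹ * ∫⁻ x, Pmax a γ (fk k) x ^ 2 := by
        rw [lintegral_const_mul' _ _ hcs, lintegral_tsum]
        · congr 2; ext k
          rw [lintegral_const_mul' _ _ (ENNReal.inv_ne_top.2 (hc0 k))]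
        · intro k
          exact (((Pmax_meas a γ hγ (fk k) (fkm k) (fki k)).pow_const 2).const_mul _).aemeasurable
    _ ≤ (∑' k, c k) * ∑' k, ENNReal.ofReal C * ∫⁻ ξ in S k, W ξ :=
        mul_le_mul' le_rfl (ENNReal.tsum_le_tsum fkb)
    _ = (∑' k, c k) * (ENNReal.ofReal C * ∫⁻ ξ in ⋃ k, S k, W ξ) := by
        rw [ENNReal.tsum_mul_left, lintegral_iUnion hSm hSd]
    _ ≤ _ := by
        rw [mul_assoc]
        refine mul_le_mul' le_rfl (mul_le_mul' le_rfl (setLIntegral_le_lintegral _ _))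

lemma Pop_neg (a γ : ℝ) (f : ℝ → ℂ) (t x : ℝ) :
    Pop a γ f t x = Pop a γ (fun ξ => f (-ξ)) t (-x) := by
  unfold Pop
  rw [← integral_neg_eq_self]
  congr 1; ext ξ
  simp

lemma high_neg (a γ s : ℝ) (K : ENNReal) (hK : ∀ f : ℝ → ℂ, Measurable f → (∀ ξ, f ξ ≠ 0 → 1 ≤ ξ) →
    ∫⁻ ξ, ENNReal.ofReal ((1 + ξ ^ 2) ^ s) * ‖f ξ‖ₑ ^ 2 ≠ ⊤ →
    ∃ Φ : ℝ → ENNReal, Measurable Φ ∧ (∀ x, Pmax a γ f x ≤ Φ x) ∧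
    ∫⁻ x, Φ x ^ 2 ≤ K * ∫⁻ ξ, ENNReal.ofReal ((1 + ξ ^ 2) ^ s) * ‖f ξ‖ₑ ^ 2)
    (f : ℝ → ℂ) (hfm : Measurable f) (hf : ∀ ξ, f ξ ≠ 0 → ξ ≤ -1)
    (hW : ∫⁻ ξ, ENNReal.ofReal ((1 + ξ ^ 2) ^ s) * ‖f ξ‖ₑ ^ 2 ≠ ⊤) :
    ∃ Φ : ℝ → ENNReal, Measurable Φ ∧ (∀ x, Pmax a γ f x ≤ Φ x) ∧
    ∫⁻ x, Φ x ^ 2 ≤ K * ∫⁻ ξ, ENNReal.ofReal ((1 + ξ ^ 2) ^ s) * ‖f ξ‖ₑ ^ 2 := by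
  have e : ∫⁻ ξ, ENNReal.ofReal ((1 + ξ ^ 2) ^ s) * ‖f (-ξ)‖ₑ ^ 2 =
      ∫⁻ ξ, ENNReal.ofReal ((1 + ξ ^ 2) ^ s) * ‖f ξ‖ₑ ^ 2 := by
    rw [← lintegral_neg_eq_self]
    congr 1; ext ξ; simp
  obtain ⟨Φ, h1, h2, h3⟩ := hK (fun ξ => f (-ξ)) (hfm.comp measurable_neg) (fun ξ h => by
    have := hf _ h; linarith) (by rw [e]; exact hW)
  rw [e] at h3
  refine ⟨fun x => Φ (-x), h1.comp measurable_neg, fun x => ?_, ?_⟩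
  · refine le_trans (le_of_eq ?_) (h2 (-x))
    unfold Pmax
    congr 1; ext t
    rw [Pop_neg]
  · rw [lintegral_neg_eq_self (fun x => Φ x ^ 2)]
    exact h3

lemma low_freq (a γ : ℝ) (ha : 0 < a) (hγ : 1 < γ) : ∃ K : ENNReal, K ≠ ⊤ ∧ ∀ f : ℝ → ℂ, Measurable f →
    (∀ ξ, f ξ ≠ 0 → |ξ| ≤ 1) → MemLp f 2 volume →
    ∫⁻ x, Pmax a γ f x ^ 2 ≤ K * ∫⁻ ξ, ‖f ξ‖ₑ ^ 2 := by
  set c : ℕ → ENNReal := fun n => ENNReal.ofReal (2 ^ n / n.factorial) with hc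
  have hcs : ∑' k, c k ≠ ⊤ := (Real.summable_pow_div_factorial 2).tsum_ofReal_ne_top
  refine ⟨(∑' k, c k) * ((∑' k, c k) * ENNReal.ofReal (256 * Real.pi)),
    ENNReal.mul_ne_top hcs (ENNReal.mul_ne_top hcs ENNReal.ofReal_ne_top), fun f hfm hf hfl => ?_⟩
  have hfi : Integrable f := integrable_of_supp f hfl 1 fun ξ h => abs_le.1 (hf ξ h)
  set G : ℕ → ℝ → ℂ := fun n ξ => f ξ * (((|ξ| ^ a) ^ n : ℝ) : ℂ) with hG
  have Gm : ∀ n, Measurable (G n) := fun n => by simp only [hG]; fun_prop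
  have Gb : ∀ n ξ, ‖G n ξ‖ ≤ ‖f ξ‖ := fun n ξ => by
    by_cases h : f ξ = 0
    · simp [hG, h]
    · simp only [hG]
      rw [norm_mul, Complex.norm_real, Real.norm_eq_abs, abs_of_nonneg (by positivity)]
      exact mul_le_of_le_one_right (norm_nonneg _) (pow_le_one₀ (by positivity)
        (Real.rpow_le_one (abs_nonneg _) (hf ξ h) ha.le))
  set Q : ℕ → ℝ → ENNReal := fun n x => ‖∫ ξ, G n ξ * Complex.exp (Complex.I * ((x * ξ : ℝ) : ℂ))‖ₑ with hQ
  have Qm : ∀ n, Measurable (Q n) := fun n => by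
    have h1 : StronglyMeasurable (fun p : ℝ × ℝ => G n p.2 * Complex.exp (Complex.I * ((p.1 * p.2 : ℝ) : ℂ))) := by
      refine Measurable.stronglyMeasurable (((Gm n).comp measurable_snd).mul ?_)
      fun_prop
    exact (StronglyMeasurable.integral_prod_right' (ν := volume) h1).measurable.enorm
  have Qb : ∀ n, ∫⁻ x, Q n x ^ 2 ≤ ENNReal.ofReal (256 * Real.pi) * ∫⁻ ξ, ‖f ξ‖ₑ ^ 2 := fun n => by
    refine (low_planch (G n) (Gm n) (hfl.of_le (Gm n).aestronglyMeasurable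
      (Filter.Eventually.of_forall (Gb n))) fun ξ hξ => ?_).trans ?_
    · by_contra hcon
      have : f ξ ≠ 0 := fun h => hcon (by simp [hG, h])
      linarith [hf ξ this]
    · refine mul_le_mul' le_rfl (lintegral_mono fun ξ => ?_)
      exact pow_le_pow_left' (enorm_le_iff_norm_le.2 (Gb n ξ)) 2
  have key : ∀ x, Pmax a γ f x ≤ ∑' n, c n * Q n x := fun x => iSup_le fun t => by
    obtain ⟨t, ht0, ht1⟩ := t
    simp only
    set l : ℂ := Complex.I * (t : ℂ) - ((t ^ γ : ℝ) : ℂ) with hl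
    have hlb : ‖l‖ ≤ 2 := by
      refine (norm_sub_le _ _).trans ?_
      rw [norm_mul, Complex.norm_I, one_mul, Complex.norm_real, Complex.norm_real, Real.norm_eq_abs,
        Real.norm_eq_abs, abs_of_pos ht0, abs_of_nonneg (by positivity)]
      have : t ^ γ ≤ 1 := Real.rpow_le_one ht0.le ht1.le (by linarith)
      linarith
    have nexp : ∀ r : ℝ, ‖Complex.exp (Complex.I * (r : ℂ))‖ = 1 := fun r => by
      rw [mul_comm]; exact Complex.norm_exp_ofReal_mul_I r
    set F : ℕ → ℝ → ℂ := fun n ξ => (l ^ n / n.factorial) *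
      (G n ξ * Complex.exp (Complex.I * ((x * ξ : ℝ) : ℂ))) with hF
    have hsum : HasSum (fun n => ∫ ξ, F n ξ) (Pop a γ f t x) := by
      unfold Pop
      refine hasSum_integral_of_dominated_convergence (fun n ξ => 2 ^ n / n.factorial * ‖f ξ‖) ?_ ?_ ?_ ?_ ?_
      · intro n
        refine Measurable.aestronglyMeasurable ?_
        simp only [hF]
        have := Gm n
        fun_prop
      · intro n
        refine Filter.Eventually.of_forall fun ξ => ?_
        simp only [hF]
        rw [norm_mul, norm_mul, nexp, mul_one, norm_div, norm_pow, Complex.norm_natCast]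
        have := Gb n ξ
        gcongr
      · refine Filter.Eventually.of_forall fun ξ => ?_
        exact (Real.summable_pow_div_factorial 2).mul_right _
      · simp only [tsum_mul_right]
        exact hfi.norm.const_mul _
      · refine Filter.Eventually.of_forall fun ξ => ?_
        have h1 := NormedSpace.expSeries_div_hasSum_exp (l * ((|ξ| ^ a : ℝ) : ℂ))
        rw [← Complex.exp_eq_exp_ℂ] at h1
        have h2 := (h1.mul_left (f ξ)).mul_right (Complex.exp (Complex.I * ((x * ξ : ℝ) : ℂ)))
        have ef : (fun n => F n ξ) = fun n => f ξ * ((l * ((|ξ| ^ a : ℝ) : ℂ)) ^ n / (n.factorial : ℂ)) *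
            Complex.exp (Complex.I * ((x * ξ : ℝ) : ℂ)) := by
          ext n
          simp only [hF, hG]
          rw [mul_pow, Complex.ofReal_pow]; ring
        have eg : Complex.I * ((t * |ξ| ^ a : ℝ) : ℂ) - ((t ^ γ * |ξ| ^ a : ℝ) : ℂ) =
            l * ((|ξ| ^ a : ℝ) : ℂ) := by
          rw [hl, Complex.ofReal_mul, Complex.ofReal_mul]; ring
        rw [eg]
        change HasSum (fun n => F n ξ) _
        rw [ef]
        exact h2
    refine (enorm_hasSum_le _ _ hsum).trans (ENNReal.tsum_le_tsum fun n => ?_)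
    simp only [hF]
    rw [integral_const_mul, enorm_mul]
    refine mul_le_mul' ?_ le_rfl
    rw [← ofReal_norm]
    apply ENNReal.ofReal_le_ofReal
    rw [norm_div, norm_pow, Complex.norm_natCast]
    gcongr
  calc ∫⁻ x, Pmax a γ f x ^ 2 ≤ ∫⁻ x, (∑' k, c k) * ∑' k, c k * Q k x ^ 2 :=
        lintegral_mono fun x => (pow_le_pow_left' (key x) 2).trans (cs_tsum _ _)
    _ = (∑' k, c k) * ∑' k, c k * ∫⁻ x, Q k x ^ 2 := by
        rw [lintegral_const_mul' _ _ hcs, lintegral_tsum]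
        · congr 2; ext k
          rw [lintegral_const_mul' _ _ ENNReal.ofReal_ne_top]
        · intro k
          exact (((Qm k).pow_const 2).const_mul _).aemeasurable
    _ ≤ (∑' k, c k) * ∑' k, c k * (ENNReal.ofReal (256 * Real.pi) * ∫⁻ ξ, ‖f ξ‖ₑ ^ 2) :=
        mul_le_mul' le_rfl (ENNReal.tsum_le_tsum fun k => mul_le_mul' le_rfl (Qb k))
    _ = _ := by rw [ENNReal.tsum_mul_right]; ring


lemma all_freq (a γ s : ℝ) (ha : 0 < a) (ha1 : a < 1) (hγ : 1 < γ) (hs : a / 4 * (1 - 1 / γ) < s) :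
    ∃ K : ENNReal, K ≠ ⊤ ∧ ∀ f : ℝ → ℂ, Measurable f →
    ∫⁻ ξ, ENNReal.ofReal ((1 + ξ ^ 2) ^ s) * ‖f ξ‖ₑ ^ 2 ≠ ⊤ →
    ∫⁻ x, Pmax a γ f x ^ 2 ≤ K * ∫⁻ ξ, ENNReal.ofReal ((1 + ξ ^ 2) ^ s) * ‖f ξ‖ₑ ^ 2 := by
  obtain ⟨K1, hK1, H1⟩ := high_pos a γ s ha ha1 hγ hs
  have H2 := high_neg a γ s K1 H1
  obtain ⟨K0, hK0, H0⟩ := low_freq a γ ha hγ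
  have hs0 : 0 < s := by
    have hg1 : 0 < 1 - 1 / γ := by
      have : 1 / γ < 1 := by rw [div_lt_one (by linarith)]; exact hγ
      linarith
    exact lt_trans (by positivity) hs
  refine ⟨3 * (K0 + (K1 + K1)), ENNReal.mul_ne_top (by norm_num)
    (ENNReal.add_ne_top.2 ⟨hK0, ENNReal.add_ne_top.2 ⟨hK1, hK1⟩⟩), fun f hfm hW => ?_⟩
  set S : Fin 3 → Set ℝ := ![{ξ | |ξ| < 1}, {ξ | 1 ≤ ξ}, {ξ | ξ ≤ -1}] with hS
  have hSm : ∀ k, MeasurableSet (S k) := fun k => by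
    fin_cases k
    · exact measurableSet_lt measurable_id.abs measurable_const
    · exact measurableSet_le measurable_const measurable_id
    · exact measurableSet_le measurable_id measurable_const
  have d01 : Disjoint (S 0) (S 1) := by
    rw [Set.disjoint_left]; intro ξ (h1 : |ξ| < 1) (h2 : 1 ≤ ξ)
    have := (abs_lt.1 h1).2; linarith
  have d02 : Disjoint (S 0) (S 2) := by
    rw [Set.disjoint_left]; intro ξ (h1 : |ξ| < 1) (h2 : ξ ≤ -1)
    have := (abs_lt.1 h1).1; linarith
  have d12 : Disjoint (S 1) (S 2) := by
    rw [Set.disjoint_left]; intro ξ (h1 : 1 ≤ ξ) (h2 : ξ ≤ -1)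
    linarith
  have hSd : Pairwise (Function.onFun Disjoint S) := by
    intro i j hij
    fin_cases i <;> fin_cases j <;> first | exact absurd rfl hij | assumption | exact d01.symm | exact d02.symm | exact d12.symm
  have hSc : ∀ ξ, f ξ ≠ 0 → ∃ k, ξ ∈ S k := fun ξ _ => by
    by_cases h1 : 1 ≤ ξ
    · exact ⟨1, h1⟩
    by_cases h2 : ξ ≤ -1
    · exact ⟨2, h2⟩
    exact ⟨0, show |ξ| < 1 from abs_lt.2 ⟨by linarith, by linarith⟩⟩
  set W := ∫⁻ ξ, ENNReal.ofReal ((1 + ξ ^ 2) ^ s) * ‖f ξ‖ₑ ^ 2 with hWd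
  have fm : ∀ k, Measurable ((S k).indicator f) := fun k => hfm.indicator (hSm k)
  have fn : ∀ k ξ, (S k).indicator f ξ ≠ 0 → ξ ∈ S k := fun k ξ h => by
    by_contra hcon
    exact h (Set.indicator_of_notMem hcon f)
  have fW : ∀ k, ∫⁻ ξ, ENNReal.ofReal ((1 + ξ ^ 2) ^ s) * ‖(S k).indicator f ξ‖ₑ ^ 2 ≤ W := fun k =>
    lintegral_mono fun ξ => by
      refine mul_le_mul' le_rfl ?_
      by_cases h : ξ ∈ S k <;> simp [h]
  have f2 : ∀ k, ∫⁻ ξ, ‖(S k).indicator f ξ‖ₑ ^ 2 ≤ W := fun k => by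
    refine le_trans (lintegral_mono fun ξ => ?_) (fW k)
    refine le_mul_of_one_le_left' ?_
    rw [ENNReal.one_le_ofReal]
    exact Real.one_le_rpow (by nlinarith [sq_nonneg ξ]) hs0.le
  have l0 : MemLp ((S 0).indicator f) 2 volume := memLp_two_of _ (fm 0) (ne_top_of_le_ne_top hW (f2 0))
  have s0 : ∀ ξ, (S 0).indicator f ξ ≠ 0 → |ξ| ≤ 1 := fun ξ h => le_of_lt (fn 0 ξ h)
  have i0 : Integrable ((S 0).indicator f) := integrable_of_supp _ l0 1 fun ξ h => abs_le.1 (s0 ξ h)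
  have b0 := (H0 _ (fm 0) s0 l0).trans (mul_le_mul' le_rfl (f2 0))
  have m0 := Pmax_meas a γ hγ _ (fm 0) i0
  obtain ⟨Φ1, m1, le1, b1⟩ := H1 _ (fm 1) (fn 1) (ne_top_of_le_ne_top hW (fW 1))
  obtain ⟨Φ2, m2, le2, b2⟩ := H2 _ (fm 2) (fn 2) (ne_top_of_le_ne_top hW (fW 2))
  replace b1 := b1.trans (mul_le_mul' le_rfl (fW 1))
  replace b2 := b2.trans (mul_le_mul' le_rfl (fW 2))
  set P0 := Pmax a γ ((S 0).indicator f)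
  calc ∫⁻ x, Pmax a γ f x ^ 2 ≤ ∫⁻ x, 3 * (P0 x ^ 2 + (Φ1 x ^ 2 + Φ2 x ^ 2)) := by
        refine lintegral_mono fun x => ?_
        have h1 : Pmax a γ f x ≤ P0 x + (Φ1 x + Φ2 x) := by
          refine (pmax_split a γ f S hSm hSd hSc x).trans ?_
          rw [tsum_fintype, Fin.sum_univ_three, add_assoc]
          exact add_le_add le_rfl (add_le_add (le1 x) (le2 x))
        refine (pow_le_pow_left' h1 2).trans ?_
        have h2 := cs_tsum (fun _ : Fin 3 => 1) ![P0 x, Φ1 x, Φ2 x]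
        simp only [tsum_fintype, Fin.sum_univ_three, one_mul] at h2
        have h3 : (1 + 1 + 1 : ENNReal) = 3 := by norm_num
        rw [h3] at h2
        simpa [add_assoc] using h2
    _ = 3 * ((∫⁻ x, P0 x ^ 2) + ((∫⁻ x, Φ1 x ^ 2) + ∫⁻ x, Φ2 x ^ 2)) := by
        rw [lintegral_const_mul' _ _ (by norm_num), lintegral_add_left (m0.pow_const 2),
          lintegral_add_left (m1.pow_const 2)]
    _ ≤ 3 * (K0 * W + (K1 * W + K1 * W)) :=
        mul_le_mul' le_rfl (add_le_add b0 (add_le_add b1 b2))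
    _ = _ := by ring

lemma Pstar_le (a γ : ℝ) (f : ℝ → ℂ) (x : ℝ) : ‖Pstar a γ f x‖ₑ ≤ Pmax a γ f x := by
  have : Nonempty (Set.Ioo (0:ℝ) 1) := ⟨⟨1/2, by norm_num, by norm_num⟩⟩
  by_cases h : Pmax a γ f x = ⊤
  · rw [h]; exact le_top
  have h0 : 0 ≤ Pstar a γ f x := Real.iSup_nonneg fun t => norm_nonneg _
  rw [Real.enorm_eq_ofReal h0]
  apply ENNReal.ofReal_le_of_le_toReal
  refine ciSup_le fun t => ?_
  rw [← toReal_enorm]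
  exact ENNReal.toReal_mono h (le_iSup (fun t : Set.Ioo (0:ℝ) 1 => ‖Pop a γ f t x‖ₑ) t)

lemma Pstar_zero (a γ : ℝ) (f : ℝ → ℂ) (hf : ¬ AEStronglyMeasurable f volume) (x : ℝ) :
    Pstar a γ f x = 0 := by
  have : ∀ t, Pop a γ f t x = 0 := fun t => by
    rw [Pop_eq]
    apply integral_undef
    intro hi
    apply hf
    have h1 := hi.aestronglyMeasurable.mul (phs_meas_xi a γ t x).inv.aestronglyMeasurable
    refine h1.congr (Filter.Eventually.of_forall fun ξ => ?_)
    simp [phs_ne a γ t x ξ]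
  simp [Pstar, this]

lemma Pstar_congr (a γ : ℝ) (f g : ℝ → ℂ) (h : f =ᵐ[volume] g) (x : ℝ) :
    Pstar a γ f x = Pstar a γ g x := by
  unfold Pstar
  congr 1; ext t
  rw [Pop_eq, Pop_eq]
  congr 1
  refine integral_congr_ae ?_
  filter_upwards [h] with ξ hξ
  rw [hξ]

theorem maximal_global_L2_bound_frac (a γ s : ℝ) (ha : 0 < a) (ha1 : a < 1)
    (hγ : 1 < γ) (hs : a / 4 * (1 - 1 / γ) < s) :
    ∃ C : ℝ, 0 < C ∧ ∀ fhat : ℝ → ℂ,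
      Integrable (fun ξ : ℝ => (1 + ξ ^ 2) ^ s * ‖fhat ξ‖ ^ 2) volume →
      eLpNorm (fun x => Pstar a γ fhat x) 2 volume ≤
        ENNReal.ofReal
          (C * (∫ ξ : ℝ, (1 + ξ ^ 2) ^ s * ‖fhat ξ‖ ^ 2) ^ (1 / 2 : ℝ)) := by
  obtain ⟨K, hK, H⟩ := all_freq a γ s ha ha1 hγ hs
  refine ⟨(K.toReal + 1) ^ (1 / 2 : ℝ), by positivity, fun fhat hi => ?_⟩
  by_cases hf : AEStronglyMeasurable fhat volume
  swap
  · have : (fun x => Pstar a γ fhat x) = 0 := funext fun x => Pstar_zero a γ fhat hf x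
    rw [this, eLpNorm_zero]; exact bot_le
  set g : ℝ → ℂ := hf.mk fhat with hg
  have hgm : Measurable g := hf.stronglyMeasurable_mk.measurable
  have hae : fhat =ᵐ[volume] g := hf.ae_eq_mk
  have e1 : (fun x => Pstar a γ fhat x) = fun x => Pstar a γ g x :=
    funext fun x => Pstar_congr a γ fhat g hae x
  set A := ∫ ξ : ℝ, (1 + ξ ^ 2) ^ s * ‖fhat ξ‖ ^ 2 with hA
  have hA0 : 0 ≤ A := integral_nonneg fun ξ => by positivity
  have e2 : ∫⁻ ξ, ENNReal.ofReal ((1 + ξ ^ 2) ^ s) * ‖g ξ‖ₑ ^ 2 = ENNReal.ofReal A := by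
    rw [hA, ofReal_integral_eq_lintegral_ofReal hi (Filter.Eventually.of_forall fun ξ => by
      simp only [Pi.zero_apply]; positivity)]
    refine lintegral_congr_ae ?_
    filter_upwards [hae] with ξ hξ
    rw [hξ, ENNReal.ofReal_mul (by positivity), ENNReal.ofReal_pow (norm_nonneg _), ofReal_norm]
  have main := H g hgm (by rw [e2]; exact ENNReal.ofReal_ne_top)
  rw [e2] at main
  rw [e1, eLpNorm_eq_lintegral_rpow_enorm_toReal (by norm_num) (by norm_num)]
  have e3 : ∫⁻ x, ‖Pstar a γ g x‖ₑ ^ (ENNReal.toReal 2) ≤ ENNReal.ofReal ((K.toReal + 1) * A) := by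
    calc _ = ∫⁻ x, ‖Pstar a γ g x‖ₑ ^ 2 := by congr 1; ext x; simp
      _ ≤ ∫⁻ x, Pmax a γ g x ^ 2 := lintegral_mono fun x => pow_le_pow_left' (Pstar_le a γ g x) 2
      _ ≤ _ := main
      _ ≤ _ := by
        rw [ENNReal.ofReal_mul (by positivity)]
        refine mul_le_mul' ?_ le_rfl
        rw [← ENNReal.ofReal_toReal hK]
        apply ENNReal.ofReal_le_ofReal
        rw [ENNReal.toReal_ofReal (by positivity)]
        linarith
  calc _ ≤ (ENNReal.ofReal ((K.toReal + 1) * A)) ^ (1 / ENNReal.toReal 2) :=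
        ENNReal.rpow_le_rpow e3 (by positivity)
    _ = _ := by
        rw [ENNReal.ofReal_rpow_of_nonneg (by positivity) (by positivity)]
        congr 1
        rw [← Real.mul_rpow (by positivity) hA0]
        simp
end

section
/- Let a = 1, γ ∈ (1,∞), and s > (1/2)(1 - 1/γ). Then ‖sup_{0<t<1} |P^t_{1,γ} f|‖_{L²(ℝ)} ≲ ‖f‖_{H^s(ℝ)} for all f ∈ H^s(ℝ). -/
open MeasureTheory

open FourierTransform SchwartzMap in
theorem aux_eLpNorm_fourier (h : ℝ → ℂ) (h1 : Integrable h) (h2 : MemLp h 2) :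
    eLpNorm (𝓕 h) 2 volume = eLpNorm h 2 volume := by
  set H : Lp ℂ 2 (volume : Measure ℝ) := h2.toLp h with hH
  obtain ⟨FH, hFH⟩ : ∃ K : Lp ℂ 2 (volume : Measure ℝ), K = 𝓕 H := ⟨_, rfl⟩
  have key : ∀ᵐ x ∂(volume : Measure ℝ), (𝓕 h) x = FH x := by
    apply ae_eq_of_integral_contDiff_smul_eq
    · have : Continuous (𝓕 h) := by
        exact VectorFourier.fourierIntegral_continuous Real.continuous_fourierChar
          (by exact continuous_inner) h1
      exact this.locallyIntegrable
    · exact (Lp.memLp _).locallyIntegrable (by norm_num)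
    · intro g g_smooth g_cpt
      have hg₁ : HasCompactSupport (Complex.ofRealCLM ∘ g) := g_cpt.comp_left rfl
      have hg₂ : ContDiff ℝ (⊤ : ℕ∞) (Complex.ofRealCLM ∘ g) := by fun_prop
      set φ : 𝓢(ℝ, ℂ) := hg₁.toSchwartzMap hg₂ with hφ
      have e1 : ∫ x, g x • FH x = 
          ((FH : Lp ℂ 2 (volume : Measure ℝ)) : 𝓢'(ℝ, ℂ)) φ := by
        rw [Lp.toTemperedDistribution_apply]
        simp [hφ]
      rw [e1, hFH, ← Lp.fourier_toTemperedDistribution_eq, TemperedDistribution.fourier_apply,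
        Lp.toTemperedDistribution_apply]
      have e2 : ∫ x, (𝓕 φ) x • H x = ∫ x, (𝓕 φ) x • h x := by
        apply integral_congr_ae
        filter_upwards [h2.coeFn_toLp] with x hx
        rw [hH, hx]
      rw [e2]
      have e3 := VectorFourier.integral_fourierIntegral_smul_eq_flip (L := innerₗ ℝ)
        (μ := (volume : Measure ℝ)) (ν := (volume : Measure ℝ)) (f := (φ : ℝ → ℂ)) (g := h)
        Real.continuous_fourierChar (by exact continuous_inner) φ.integrable h1
      rw [SchwartzMap.fourier_coe]
      have e4 : ∫ x, g x • (𝓕 h) x = ∫ x, φ x • (𝓕 h) x := by simp [hφ]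
      rw [e4]
      have e5 : (innerₗ ℝ : ℝ →ₗ[ℝ] ℝ →ₗ[ℝ] ℝ).flip = innerₗ ℝ := by
        ext; simp
      rw [e5] at e3
      exact e3.symm
  rw [eLpNorm_congr_ae key]
  have := Lp.norm_fourier_eq H
  rw [← hFH] at this
  rw [Lp.norm_def, Lp.norm_def, ENNReal.toReal_eq_toReal_iff' (Lp.eLpNorm_ne_top _) (Lp.eLpNorm_ne_top _)] at this
  rw [this, hH]
  exact eLpNorm_congr_ae h2.coeFn_toLp

open FourierTransform in
theorem aux_planch (h : ℝ → ℂ) (h1 : Integrable h) (h2 : MemLp h 2) :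
    ∫⁻ x : ℝ, ‖∫ ξ : ℝ, h ξ * Complex.exp (Complex.I * ((x * ξ : ℝ) : ℂ))‖ₑ ^ 2
      = ENNReal.ofReal (2 * Real.pi) * ∫⁻ ξ, ‖h ξ‖ₑ ^ 2 := by
  have e := aux_eLpNorm_fourier h h1 h2
  have sq : ∀ u : ℝ → ℂ, eLpNorm u 2 volume ^ 2 = ∫⁻ x, ‖u x‖ₑ ^ 2 := by
    intro u
    have := eLpNorm_nnreal_pow_eq_lintegral (p := 2) (f := u) (μ := (volume : Measure ℝ)) (by norm_num)
    simpa using this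
  rw [← sq h, ← e, sq]
  have a0 : (-(2 * Real.pi)⁻¹ : ℝ) ≠ 0 := by
    have := Real.pi_pos
    simp [this.ne']
  have e3 : ∀ x : ℝ, ∫ ξ : ℝ, h ξ * Complex.exp (Complex.I * ((x * ξ : ℝ) : ℂ))
      = (𝓕 h) (-(2 * Real.pi)⁻¹ * x) := by
    intro x
    rw [Real.fourier_real_eq_integral_exp_smul]
    congr 1
    ext ξ
    rw [smul_eq_mul, mul_comm]
    congr 2
    have : (Real.pi : ℂ) ≠ 0 := by exact_mod_cast Real.pi_ne_zero
    push_cast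
    field_simp
  simp_rw [e3]
  have hc : Continuous (𝓕 h) := by
        exact VectorFourier.fourierIntegral_continuous Real.continuous_fourierChar
          (by exact continuous_inner) h1
  have e4 := lintegral_map (μ := (volume : Measure ℝ)) (f := fun x => ‖(𝓕 h) x‖ₑ ^ 2)
    (g := fun x => -(2 * Real.pi)⁻¹ * x) (by fun_prop) (by fun_prop)
  rw [← e4, Real.map_volume_mul_left a0, lintegral_smul_measure]
  congr 2
  rw [inv_neg, inv_inv, abs_neg, abs_of_pos (by positivity)]

theorem aux_calc (g g' : ℝ → ℂ) (M lam : ℝ) (hl : 0 < lam) (hg : Measurable g) (hg' : Measurable g')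
    (hd : ∀ t ∈ Set.Ioo (0:ℝ) 1, HasDerivAt g (g' t) t)
    (hb : ∀ t ∈ Set.Ioo (0:ℝ) 1, ‖g t‖ ≤ M) (hb' : ∀ t ∈ Set.Ioo (0:ℝ) 1, ‖g' t‖ ≤ M)
    (t : ℝ) (ht : t ∈ Set.Ioo (0:ℝ) 1) :
    ‖g t‖ₑ ^ 2 ≤ ∫⁻ u in Set.Ioo (0:ℝ) 1, (ENNReal.ofReal (1 + lam) * ‖g u‖ₑ ^ 2
      + ENNReal.ofReal (lam⁻¹) * ‖g' u‖ₑ ^ 2) := by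
  have hM : 0 ≤ M := (norm_nonneg _).trans (hb t ht)
  have hfin : volume (Set.Ioo (0:ℝ) 1) < ⊤ := by simp
  -- real integrands
  have I1 : IntegrableOn (fun u => ‖g u‖ ^ 2) (Set.Ioo (0:ℝ) 1) := by
    refine Measure.integrableOn_of_bounded (M := M ^ 2) hfin.ne (by fun_prop) ?_
    refine (ae_restrict_iff' measurableSet_Ioo).2 (.of_forall fun u hu => ?_)
    rw [Real.norm_of_nonneg (by positivity)]
    have := hb u hu
    gcongr
  have I2 : IntegrableOn (fun u => ‖g' u‖ ^ 2) (Set.Ioo (0:ℝ) 1) := by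
    refine Measure.integrableOn_of_bounded (M := M ^ 2) hfin.ne (by fun_prop) ?_
    refine (ae_restrict_iff' measurableSet_Ioo).2 (.of_forall fun u hu => ?_)
    rw [Real.norm_of_nonneg (by positivity)]
    have := hb' u hu
    gcongr
  set J : ℝ := ∫ u in Set.Ioo (0:ℝ) 1, (lam * ‖g u‖ ^ 2 + lam⁻¹ * ‖g' u‖ ^ 2) with hJ
  have I3 : IntegrableOn (fun u => lam * ‖g u‖ ^ 2 + lam⁻¹ * ‖g' u‖ ^ 2) (Set.Ioo (0:ℝ) 1) :=
    (I1.const_mul lam).add (I2.const_mul lam⁻¹)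
  have main : ∀ u ∈ Set.Ioo (0:ℝ) 1, ‖g t‖ ^ 2 ≤ ‖g u‖ ^ 2 + J := by
    intro u hu
    have hsub : Set.uIcc u t ⊆ Set.Ioo 0 1 := by
      intro y hy
      rw [Set.mem_uIcc] at hy
      rcases hy with hy | hy
      · exact ⟨hu.1.trans_le hy.1, hy.2.trans_lt ht.2⟩
      · exact ⟨ht.1.trans_le hy.1, hy.2.trans_lt hu.2⟩
    have hdd : ∀ y ∈ Set.uIcc u t, HasDerivAt (fun y => ‖g y‖ ^ 2) (2 * inner ℝ (g y) (g' y)) y :=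
      fun y hy => (hd y (hsub hy)).norm_sq
    have hbd : ∀ y ∈ Set.Ioo (0:ℝ) 1, ‖2 * inner ℝ (g y) (g' y)‖ ≤ 
        lam * ‖g y‖ ^ 2 + lam⁻¹ * ‖g' y‖ ^ 2 := by
      intro y hy
      have h1 := abs_real_inner_le_norm (g y) (g' y)
      rw [norm_mul, Real.norm_eq_abs, Real.norm_eq_abs, abs_two]
      have h2 : 0 ≤ lam⁻¹ * (lam * ‖g y‖ - ‖g' y‖) ^ 2 := by positivity
      have h3 : lam⁻¹ * (lam * ‖g y‖ - ‖g' y‖) ^ 2 = lam * ‖g y‖ ^ 2 - 2 * (‖g y‖ * ‖g' y‖) 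
         + lam⁻¹ * ‖g' y‖ ^ 2 := by field_simp; ring
      linarith
    have hmeas : Measurable fun y => 2 * inner ℝ (g y) (g' y) := by fun_prop
    have hint : IntegrableOn (fun y => 2 * inner ℝ (g y) (g' y)) (Set.Ioo (0:ℝ) 1) := by
      refine Integrable.mono' I3 hmeas.aestronglyMeasurable ?_
      exact (ae_restrict_iff' measurableSet_Ioo).2 (.of_forall hbd)
    have hii : IntervalIntegrable (fun y => 2 * inner ℝ (g y) (g' y)) volume u t :=
      (hint.mono_set hsub).intervalIntegrable
    have ftc := intervalIntegral.integral_eq_sub_of_hasDerivAt hdd hii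
    have : ‖∫ y in u..t, 2 * inner ℝ (g y) (g' y)‖ ≤ J := by
      refine (intervalIntegral.norm_integral_le_integral_norm_uIoc).trans ?_
      refine (setIntegral_mono_on (hint.mono_set (Set.uIoc_subset_uIcc.trans hsub)).norm (I3.mono_set (Set.uIoc_subset_uIcc.trans hsub)) measurableSet_uIoc
        (fun y hy => hbd y (hsub (Set.uIoc_subset_uIcc hy)))).trans ?_
      refine setIntegral_mono_set I3 (.of_forall fun y => by dsimp; positivity) ?_
      exact (Set.uIoc_subset_uIcc.trans hsub).eventuallyLE
    rw [ftc] at this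
    have := (le_abs_self _).trans this
    linarith
  have fin : ‖g t‖ ^ 2 ≤ ∫ u in Set.Ioo (0:ℝ) 1, ((1 + lam) * ‖g u‖ ^ 2 + lam⁻¹ * ‖g' u‖ ^ 2) := by
    have c : ∫ u in Set.Ioo (0:ℝ) 1, ‖g t‖ ^ 2 ≤ ∫ u in Set.Ioo (0:ℝ) 1, (‖g u‖ ^ 2 + J) :=
      setIntegral_mono_on (by simp) (I1.add (by simp)) measurableSet_Ioo main
    rw [integral_add I1 (by simp)] at c
    simp only [integral_const, MeasurableSet.univ, measureReal_restrict_apply, Set.univ_inter,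
      Real.volume_real_Ioo, sub_zero, smul_eq_mul] at c
    norm_num at c
    refine c.trans (le_of_eq ?_)
    rw [hJ, ← integral_add I1 I3]
    congr 1; ext u; ring
  have I4 : IntegrableOn (fun u => (1 + lam) * ‖g u‖ ^ 2 + lam⁻¹ * ‖g' u‖ ^ 2) (Set.Ioo (0:ℝ) 1) :=
    (I1.const_mul _).add (I2.const_mul lam⁻¹)
  have := ENNReal.ofReal_le_ofReal fin
  rw [ofReal_integral_eq_lintegral_ofReal I4 (.of_forall fun u => by dsimp; positivity)] at this
  have cv : ∀ z : ℂ, ‖z‖ₑ ^ 2 = ENNReal.ofReal (‖z‖ ^ 2) := by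
    intro z
    rw [ENNReal.ofReal_pow (norm_nonneg _), ofReal_norm]
  rw [cv]
  refine this.trans (le_of_eq ?_)
  congr 1; ext u
  rw [cv, cv, ENNReal.ofReal_add (by positivity) (by positivity), ENNReal.ofReal_mul (by positivity), ENNReal.ofReal_mul (by positivity)]

theorem aux_meas (γ : ℝ) (f : ℝ → ℂ) (hf : Measurable f) :
    Measurable (fun p : ℝ × ℝ => Pop 1 γ f p.1 p.2) := by
  unfold Pop
  have : StronglyMeasurable (Function.uncurry fun (p : ℝ × ℝ) (ξ : ℝ) => f ξ *
    Complex.exp (Complex.I * ((p.1 * |ξ| ^ (1:ℝ) : ℝ) : ℂ) - ((p.1 ^ γ * |ξ| ^ (1:ℝ) : ℝ) : ℂ)) *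
    Complex.exp (Complex.I * ((p.2 * ξ : ℝ) : ℂ))) := by
    apply Measurable.stronglyMeasurable
    unfold Function.uncurry
    simp only [Real.rpow_one]
    fun_prop
  exact this.integral_prod_right.measurable

theorem aux_norm1 (γ t ξ : ℝ) :
    ‖Complex.exp (Complex.I * ((t * |ξ| ^ (1:ℝ) : ℝ) : ℂ) - ((t ^ γ * |ξ| ^ (1:ℝ) : ℝ) : ℂ))‖
      = Real.exp (-(t ^ γ * |ξ|)) := by
  rw [Complex.norm_exp]
  congr 1
  rw [Real.rpow_one, Complex.sub_re, Complex.re_mul_ofReal, Complex.ofReal_re]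
  simp

theorem aux_norm2 (y : ℝ) : ‖Complex.exp (Complex.I * (y : ℂ))‖ = 1 := by
  rw [mul_comm, Complex.norm_exp_ofReal_mul_I]

theorem aux_pop_planch (γ t : ℝ) (ht : 0 ≤ t) (f : ℝ → ℂ) (hf : Integrable f) (hf2 : MemLp f 2) :
    ∫⁻ x : ℝ, ‖Pop 1 γ f t x‖ₑ ^ 2 = ENNReal.ofReal (2 * Real.pi) *
      ∫⁻ ξ, ‖f ξ‖ₑ ^ 2 * ENNReal.ofReal (Real.exp (-(2 * |ξ|) * t ^ γ)) := by
  unfold Pop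
  have hm : Measurable (fun ξ : ℝ => Complex.exp (Complex.I * ((t * |ξ| ^ (1:ℝ) : ℝ) : ℂ) - ((t ^ γ * |ξ| ^ (1:ℝ) : ℝ) : ℂ))) := by
    simp only [Real.rpow_one]
    fun_prop
  have hb : ∀ ξ : ℝ, ‖Complex.exp (Complex.I * ((t * |ξ| ^ (1:ℝ) : ℝ) : ℂ) - ((t ^ γ * |ξ| ^ (1:ℝ) : ℝ) : ℂ))‖ ≤ 1 := by
    intro ξ
    rw [aux_norm1, Real.exp_le_one_iff]
    have := Real.rpow_nonneg ht γ
    have := mul_nonneg this (abs_nonneg ξ)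
    linarith
  have hle : ∀ ξ : ℝ, ‖f ξ * Complex.exp (Complex.I * ((t * |ξ| ^ (1:ℝ) : ℝ) : ℂ) - ((t ^ γ * |ξ| ^ (1:ℝ) : ℝ) : ℂ))‖ ≤ ‖f ξ‖ := by
    intro ξ
    rw [norm_mul]
    exact mul_le_of_le_one_right (norm_nonneg _) (hb ξ)
  rw [aux_planch]
  · congr 1
    congr 1
    ext ξ
    rw [enorm_mul, mul_pow]
    congr 1
    rw [← ofReal_norm, aux_norm1, ← ENNReal.ofReal_pow (Real.exp_pos _).le, ← Real.exp_nat_mul]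
    congr 2
    push_cast
    ring
  · exact hf.mono (hf.1.mul hm.aestronglyMeasurable) (.of_forall hle)
  · exact hf2.mono (hf.1.mul hm.aestronglyMeasurable) (.of_forall hle)

theorem aux_pop_bound (γ t x : ℝ) (ht : 0 ≤ t) (f : ℝ → ℂ) (hf : Integrable f) :
    ‖Pop 1 γ f t x‖ ≤ ∫ ξ, ‖f ξ‖ := by
  unfold Pop
  refine norm_integral_le_of_norm_le hf.norm (.of_forall fun ξ => ?_)
  rw [norm_mul, norm_mul, aux_norm1, aux_norm2, mul_one]
  refine mul_le_of_le_one_right (norm_nonneg _) ?_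
  rw [Real.exp_le_one_iff]
  have := Real.rpow_nonneg ht γ
  have := mul_nonneg this (abs_nonneg ξ)
  linarith

theorem aux_coef (γ t : ℝ) (hγ : 1 < γ) (ht : t ∈ Set.Ioo (0:ℝ) 1) :
    ‖Complex.I - ((γ * t ^ (γ - 1) : ℝ) : ℂ)‖ ≤ 1 + γ := by
  refine (norm_sub_le _ _).trans ?_
  rw [Complex.norm_I, Complex.norm_real, Real.norm_of_nonneg (by have := ht.1; positivity)]
  have : t ^ (γ - 1) ≤ 1 := Real.rpow_le_one ht.1.le ht.2.le (by linarith)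
  nlinarith

theorem aux_deriv (γ x : ℝ) (hγ : 1 < γ) (f : ℝ → ℂ) (hfm : Measurable f) (hf : Integrable f)
    (hf1 : Integrable (fun ξ : ℝ => ((|ξ| : ℝ) : ℂ) * f ξ)) (t : ℝ) (ht : t ∈ Set.Ioo (0:ℝ) 1) :
    HasDerivAt (fun t => Pop 1 γ f t x)
      ((Complex.I - ((γ * t ^ (γ - 1) : ℝ) : ℂ)) * Pop 1 γ (fun ξ : ℝ => ((|ξ| : ℝ) : ℂ) * f ξ) t x) t := by
  unfold Pop
  rw [← integral_const_mul]
  have hmm : ∀ u : ℝ, Measurable (fun ξ : ℝ => f ξ *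
    Complex.exp (Complex.I * ((u * |ξ| ^ (1:ℝ) : ℝ) : ℂ) - ((u ^ γ * |ξ| ^ (1:ℝ) : ℝ) : ℂ)) *
    Complex.exp (Complex.I * ((x * ξ : ℝ) : ℂ))) := by
    intro u
    simp only [Real.rpow_one]
    fun_prop
  have hexp : ∀ u ∈ Set.Ioo (0:ℝ) 1, ∀ ξ : ℝ, Real.exp (-(u ^ γ * |ξ|)) ≤ 1 := by
    intro u hu ξ
    rw [Real.exp_le_one_iff]
    have := Real.rpow_nonneg hu.1.le γ
    have := mul_nonneg this (abs_nonneg ξ)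
    linarith
  refine (hasDerivAt_integral_of_dominated_loc_of_deriv_le (s := Set.Ioo (0:ℝ) 1)
    (bound := fun ξ : ℝ => (1 + γ) * ‖((|ξ| : ℝ) : ℂ) * f ξ‖)
    (F' := fun (t : ℝ) (ξ : ℝ) => (Complex.I - ((γ * t ^ (γ - 1) : ℝ) : ℂ)) * (((|ξ| : ℝ) : ℂ) * f ξ *
    Complex.exp (Complex.I * ((t * |ξ| ^ (1:ℝ) : ℝ) : ℂ) - ((t ^ γ * |ξ| ^ (1:ℝ) : ℝ) : ℂ)) *
    Complex.exp (Complex.I * ((x * ξ : ℝ) : ℂ))))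
    (Ioo_mem_nhds ht.1 ht.2) (.of_forall fun u => (hmm u).aestronglyMeasurable) ?_ ?_ ?_ ?_ ?_).2
  · refine hf.mono (hmm t).aestronglyMeasurable (.of_forall fun ξ => ?_)
    rw [norm_mul, norm_mul, aux_norm1, aux_norm2, mul_one]
    exact mul_le_of_le_one_right (norm_nonneg _) (hexp t ht ξ)
  · apply Measurable.aestronglyMeasurable
    simp only [Real.rpow_one]
    fun_prop
  · refine .of_forall fun ξ u hu => ?_
    rw [norm_mul, norm_mul, norm_mul, aux_norm1, aux_norm2, mul_one]
    have h1 := aux_coef γ u hγ hu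
    have h2 := hexp u hu ξ
    gcongr
    exact mul_le_of_le_one_right (norm_nonneg _) h2
  · exact hf1.norm.const_mul _
  · refine .of_forall fun ξ u hu => ?_
    simp only [Real.rpow_one]
    have h1 : HasDerivAt (fun u : ℝ => ((u ^ γ : ℝ) : ℂ)) ((γ * u ^ (γ - 1) : ℝ) : ℂ) u :=
      (Real.hasDerivAt_rpow_const (Or.inl hu.1.ne')).ofReal_comp
    have h2 : HasDerivAt (fun u : ℝ => (u : ℂ)) 1 u := Complex.ofRealCLM.hasDerivAt
    have h3 : HasDerivAt (fun u : ℝ => Complex.I * ((u * |ξ| : ℝ) : ℂ) - ((u ^ γ * |ξ| : ℝ) : ℂ))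
        (Complex.I * (1 * ((|ξ| : ℝ) : ℂ)) - ((γ * u ^ (γ - 1) : ℝ) : ℂ) * ((|ξ| : ℝ) : ℂ)) u := by
      simp only [Complex.ofReal_mul] at h1 ⊢
      exact ((h2.mul_const _).const_mul _).sub (h1.mul_const _)
    have h4 := ((h3.cexp.const_mul (f ξ)).mul_const (Complex.exp (Complex.I * ((x * ξ : ℝ) : ℂ))))
    exact h4.congr_deriv (by ring)

theorem aux_piece (γ lam : ℝ) (hγ : 1 < γ) (hl : 0 < lam) (f : ℝ → ℂ) (hfm : Measurable f)
    (hf : Integrable f) (hf2 : MemLp f 2)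
    (hf1 : Integrable (fun ξ : ℝ => ((|ξ| : ℝ) : ℂ) * f ξ)) (hf12 : MemLp (fun ξ : ℝ => ((|ξ| : ℝ) : ℂ) * f ξ) 2) :
    ∃ M : ℝ → ENNReal, Measurable M ∧
      (∀ x, ∀ t ∈ Set.Ioo (0:ℝ) 1, ‖Pop 1 γ f t x‖ₑ ^ 2 ≤ M x) ∧
      ∫⁻ x, M x = ENNReal.ofReal (2 * Real.pi) * ∫⁻ ξ, ‖f ξ‖ₑ ^ 2 *
        (ENNReal.ofReal (1 + lam + lam⁻¹ * (1 + γ) ^ 2 * |ξ| ^ 2) *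
          ∫⁻ t in Set.Ioo (0:ℝ) 1, ENNReal.ofReal (Real.exp (-(2 * |ξ|) * t ^ γ))) := by
  set f1 : ℝ → ℂ := fun ξ : ℝ => ((|ξ| : ℝ) : ℂ) * f ξ with hf1d
  have hf1m : Measurable f1 := by rw [hf1d]; fun_prop
  have mG := aux_meas γ f hfm
  have mG1 := aux_meas γ f1 hf1m
  refine ⟨fun x => ∫⁻ u in Set.Ioo (0:ℝ) 1, (ENNReal.ofReal (1 + lam) * ‖Pop 1 γ f u x‖ₑ ^ 2
      + ENNReal.ofReal (lam⁻¹) * (ENNReal.ofReal ((1 + γ) ^ 2) * ‖Pop 1 γ f1 u x‖ₑ ^ 2)), ?_, ?_, ?_⟩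
  · apply Measurable.lintegral_prod_left' (f := fun p : ℝ × ℝ => (ENNReal.ofReal (1 + lam) * ‖Pop 1 γ f p.1 p.2‖ₑ ^ 2
      + ENNReal.ofReal (lam⁻¹) * (ENNReal.ofReal ((1 + γ) ^ 2) * ‖Pop 1 γ f1 p.1 p.2‖ₑ ^ 2)))
    fun_prop
  · intro x t ht
    have n1 : Measurable fun u : ℝ => Pop 1 γ f u x :=
      mG.comp (g := fun p : ℝ × ℝ => Pop 1 γ f p.1 p.2) (f := fun u : ℝ => (u, x)) (by fun_prop)
    have n2 : Measurable fun u : ℝ => Pop 1 γ f1 u x :=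
      mG1.comp (g := fun p : ℝ × ℝ => Pop 1 γ f1 p.1 p.2) (f := fun u : ℝ => (u, x)) (by fun_prop)
    have hcm : Measurable fun u : ℝ => (Complex.I - ((γ * u ^ (γ - 1) : ℝ) : ℂ)) := by fun_prop
    refine (aux_calc (fun t => Pop 1 γ f t x)
      (fun t => (Complex.I - ((γ * t ^ (γ - 1) : ℝ) : ℂ)) * Pop 1 γ f1 t x)
      (max (∫ ξ, ‖f ξ‖) ((1 + γ) * ∫ ξ, ‖f1 ξ‖)) lam hl n1
      (hcm.mul n2)
      (fun t ht => aux_deriv γ x hγ f hfm hf hf1 t ht) ?_ ?_ t ht).trans ?_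
    · intro t ht
      exact (aux_pop_bound γ t x ht.1.le f hf).trans (le_max_left _ _)
    · intro t ht
      refine le_trans ?_ (le_max_right _ _)
      rw [norm_mul]
      have h1 := aux_coef γ t hγ ht
      have h2 := aux_pop_bound γ t x ht.1.le f1 hf1
      gcongr
    · refine setLIntegral_mono' measurableSet_Ioo fun u hu => ?_
      gcongr
      rw [enorm_mul, mul_pow]
      gcongr
      rw [← ofReal_norm, ← ENNReal.ofReal_pow (norm_nonneg _)]
      have h1 := aux_coef γ u hγ hu
      gcongr
  · have w1 : Measurable fun p : ℝ × ℝ => Pop 1 γ f p.2 p.1 :=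
      mG.comp (g := fun p : ℝ × ℝ => Pop 1 γ f p.1 p.2) (f := fun p : ℝ × ℝ => (p.2, p.1))
        (by fun_prop)
    have w2 : Measurable fun p : ℝ × ℝ => Pop 1 γ f1 p.2 p.1 :=
      mG1.comp (g := fun p : ℝ × ℝ => Pop 1 γ f1 p.1 p.2) (f := fun p : ℝ × ℝ => (p.2, p.1))
        (by fun_prop)
    have w3 : Measurable fun p : ℝ × ℝ => (ENNReal.ofReal (1 + lam) * ‖Pop 1 γ f p.2 p.1‖ₑ ^ 2
      + ENNReal.ofReal (lam⁻¹) * (ENNReal.ofReal ((1 + γ) ^ 2) * ‖Pop 1 γ f1 p.2 p.1‖ₑ ^ 2)) := by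
      fun_prop
    rw [lintegral_lintegral_swap w3.aemeasurable]
    have s1 : ∀ u ∈ Set.Ioo (0:ℝ) 1, ∫⁻ x, (ENNReal.ofReal (1 + lam) * ‖Pop 1 γ f u x‖ₑ ^ 2
      + ENNReal.ofReal (lam⁻¹) * (ENNReal.ofReal ((1 + γ) ^ 2) * ‖Pop 1 γ f1 u x‖ₑ ^ 2)) = 
        ENNReal.ofReal (2 * Real.pi) * ∫⁻ ξ, ‖f ξ‖ₑ ^ 2 *
        (ENNReal.ofReal (1 + lam + lam⁻¹ * (1 + γ) ^ 2 * |ξ| ^ 2) *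
           ENNReal.ofReal (Real.exp (-(2 * |ξ|) * u ^ γ))) := by
      intro u hu
      have m1 : Measurable fun x => Pop 1 γ f u x :=
        mG.comp (g := fun p : ℝ × ℝ => Pop 1 γ f p.1 p.2) (f := fun x : ℝ => (u, x)) (by fun_prop)
      have m2 : Measurable fun x => Pop 1 γ f1 u x :=
        mG1.comp (g := fun p : ℝ × ℝ => Pop 1 γ f1 p.1 p.2) (f := fun x : ℝ => (u, x)) (by fun_prop)
      rw [lintegral_add_left (by fun_prop), lintegral_const_mul _ (by fun_prop),
        lintegral_const_mul _ (by fun_prop), lintegral_const_mul _ (by fun_prop),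
        aux_pop_planch γ u hu.1.le f hf hf2, aux_pop_planch γ u hu.1.le f1 hf1 hf12,
        mul_left_comm, mul_left_comm (ENNReal.ofReal ((1 + γ) ^ 2)),
        mul_left_comm (ENNReal.ofReal lam⁻¹), ← mul_add]
      congr 1
      rw [← lintegral_const_mul _ (by fun_prop), ← lintegral_const_mul _ (by fun_prop),
         ← lintegral_const_mul _ (by fun_prop), ← lintegral_add_left (by fun_prop)]
      congr 1
      ext ξ
      have e : ‖f1 ξ‖ₑ ^ 2 = ENNReal.ofReal (|ξ| ^ 2) * ‖f ξ‖ₑ ^ 2 := by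
        rw [hf1d]
        simp only
        rw [enorm_mul, mul_pow, ← ofReal_norm, Complex.norm_real, Real.norm_eq_abs, abs_abs, ENNReal.ofReal_pow (abs_nonneg _)]
      have e2 : ENNReal.ofReal (1 + lam + lam⁻¹ * (1 + γ) ^ 2 * |ξ| ^ 2) = ENNReal.ofReal (1 + lam)
          + ENNReal.ofReal lam⁻¹ * ENNReal.ofReal ((1 + γ) ^ 2) * ENNReal.ofReal (|ξ| ^ 2) := by
        rw [ENNReal.ofReal_add (by positivity) (by positivity), ENNReal.ofReal_mul (by positivity),
          ENNReal.ofReal_mul (by positivity)]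
      rw [e, e2]
      ring
    rw [setLIntegral_congr_fun measurableSet_Ioo s1, lintegral_const_mul _ (by
      apply Measurable.lintegral_prod_right' (f := fun p : ℝ × ℝ => ‖f p.2‖ₑ ^ 2 *
        (ENNReal.ofReal (1 + lam + lam⁻¹ * (1 + γ) ^ 2 * |p.2| ^ 2) *
           ENNReal.ofReal (Real.exp (-(2 * |p.2|) * p.1 ^ γ))))
      fun_prop)]
    congr 1
    rw [lintegral_lintegral_swap (by apply Measurable.aemeasurable; unfold Function.uncurry; fun_prop)]
    congr 1
    ext ξ
    rw [lintegral_const_mul _ (by fun_prop), lintegral_const_mul _ (by fun_prop)]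

theorem aux_time (γ ξ : ℝ) (hγ : 1 < γ) :
    ∫⁻ t in Set.Ioo (0:ℝ) 1, ENNReal.ofReal (Real.exp (-(2 * |ξ|) * t ^ γ)) ≤
      ENNReal.ofReal (Real.exp 2 * Real.Gamma (1 / γ + 1) * (1 + |ξ|) ^ (-1 / γ)) := by
  have hg0 : 0 < γ := by linarith
  have hb : 0 < 2 * (1 + |ξ|) := by positivity
  have hG : 0 < Real.Gamma (1 / γ + 1) := Real.Gamma_pos_of_pos (by positivity)
  have hi := integral_exp_neg_mul_rpow (p := γ) hg0 hb
  have hII : IntegrableOn (fun t : ℝ => Real.exp (-(2 * (1 + |ξ|)) * t ^ γ)) (Set.Ioi 0) := by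
    by_contra h
    rw [integral_undef h] at hi
    have : 0 < (2 * (1 + |ξ|)) ^ (-1 / γ) * Real.Gamma (1 / γ + 1) := by positivity
    linarith
  calc _ ≤ ∫⁻ t in Set.Ioo (0:ℝ) 1, ENNReal.ofReal (Real.exp 2 * Real.exp (-(2 * (1 + |ξ|)) * t ^ γ)) := by
        refine setLIntegral_mono' measurableSet_Ioo fun t ht => ?_
        rw [← Real.exp_add]
        have := Real.rpow_le_one ht.1.le ht.2.le hg0.le
        gcongr
        linarith
    _ ≤ ∫⁻ t in Set.Ioi (0:ℝ), ENNReal.ofReal (Real.exp 2 * Real.exp (-(2 * (1 + |ξ|)) * t ^ γ)) :=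
        lintegral_mono_set Set.Ioo_subset_Ioi_self
    _ = ENNReal.ofReal (Real.exp 2 * ((2 * (1 + |ξ|)) ^ (-1 / γ) * Real.Gamma (1 / γ + 1))) := by
        rw [← ofReal_integral_eq_lintegral_ofReal (hII.const_mul _) (.of_forall fun u => by dsimp; positivity),
          integral_const_mul, hi]
    _ ≤ _ := by
        apply ENNReal.ofReal_le_ofReal
        rw [Real.mul_rpow (by norm_num) (by positivity)]
        have : (2:ℝ) ^ (-1 / γ) ≤ 1 := Real.rpow_le_one_of_one_le_of_nonpos (by norm_num) (div_nonpos_of_nonpos_of_nonneg (by norm_num) hg0.le)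
        have h2 : 0 ≤ Real.exp 2 * Real.Gamma (1 / γ + 1) * (1 + |ξ|) ^ (-1 / γ) := by positivity
        calc _ = (2:ℝ) ^ (-1 / γ) * (Real.exp 2 * Real.Gamma (1 / γ + 1) * (1 + |ξ|) ^ (-1 / γ)) := by ring
          _ ≤ _ := mul_le_of_le_one_left h2 this

theorem aux_cs (b c : ℕ → ENNReal) :
    (∑' k, b k * c k) ^ 2 ≤ (∑' k, b k ^ 2) * ∑' k, c k ^ 2 := by
  have h := ENNReal.lintegral_mul_le_Lp_mul_Lq (Measure.count : Measure ℕ)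
    (Real.HolderConjugate.two_two) (f := b) (g := c)
    (measurable_of_countable _).aemeasurable (measurable_of_countable _).aemeasurable
  simp only [lintegral_count, Pi.mul_apply, ENNReal.rpow_two] at h
  calc _ ≤ ((∑' k, b k ^ 2) ^ (1 / 2 : ℝ) * (∑' k, c k ^ 2) ^ (1 / 2 : ℝ)) ^ 2 := by gcongr
    _ = _ := by
      rw [mul_pow, ← ENNReal.rpow_two, ← ENNReal.rpow_two, ← ENNReal.rpow_mul, ← ENNReal.rpow_mul]
      norm_num

def auxA (k : ℕ) : Set ℝ := {ξ | 2 ^ k ≤ 1 + |ξ| ∧ 1 + |ξ| < 2 ^ (k + 1)}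

theorem auxA_meas (k : ℕ) : MeasurableSet (auxA k) := by
  have h : Measurable fun ξ : ℝ => 1 + |ξ| := by fun_prop
  exact (measurableSet_le measurable_const h).inter (measurableSet_lt h measurable_const)

theorem auxA_disj : Pairwise (Function.onFun Disjoint auxA) := by
  intro i j hij
  rw [Function.onFun, Set.disjoint_left]
  rintro ξ ⟨h1, h2⟩ ⟨h3, h4⟩
  have a1 : i < j + 1 := (pow_lt_pow_iff_right₀ (one_lt_two (α := ℝ))).1 (h1.trans_lt h4)
  have a2 : j < i + 1 := (pow_lt_pow_iff_right₀ (one_lt_two (α := ℝ))).1 (h3.trans_lt h2)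
  omega

theorem auxA_union : (⋃ k, auxA k) = Set.univ := by
  ext ξ
  simp only [Set.mem_iUnion, Set.mem_univ, iff_true]
  exact exists_nat_pow_near (by linarith [abs_nonneg ξ]) one_lt_two

theorem auxA_fin (k : ℕ) : volume (auxA k) < ⊤ := by
  have : auxA k ⊆ Set.Icc (-2 ^ (k + 1)) (2 ^ (k + 1)) := by
    rintro ξ ⟨h1, h2⟩
    have : |ξ| ≤ 2 ^ (k + 1) := by linarith
    exact abs_le.1 this
  exact (measure_mono this).trans_lt (by simp)

theorem aux_decomp (γ t x : ℝ) (f : ℝ → ℂ) :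
    ‖Pop 1 γ f t x‖ₑ ≤ ∑' k, ‖Pop 1 γ ((auxA k).indicator f) t x‖ₑ := by
  by_cases hi : Integrable (fun ξ : ℝ => f ξ *
    Complex.exp (Complex.I * ((t * |ξ| ^ (1:ℝ) : ℝ) : ℂ) - ((t ^ γ * |ξ| ^ (1:ℝ) : ℝ) : ℂ)) *
    Complex.exp (Complex.I * ((x * ξ : ℝ) : ℂ)))
  · have h := hasSum_integral_iUnion (μ := (volume : Measure ℝ)) auxA_meas auxA_disj hi.integrableOn
    rw [auxA_union, setIntegral_univ] at h
    have e : ∀ k, Pop 1 γ ((auxA k).indicator f) t x = ∫ ξ in auxA k, f ξ *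
        Complex.exp (Complex.I * ((t * |ξ| ^ (1:ℝ) : ℝ) : ℂ) - ((t ^ γ * |ξ| ^ (1:ℝ) : ℝ) : ℂ)) *
        Complex.exp (Complex.I * ((x * ξ : ℝ) : ℂ)) := by
      intro k
      rw [← integral_indicator (auxA_meas k)]
      unfold Pop
      congr 1
      ext ξ
      by_cases hk : ξ ∈ auxA k <;> simp [hk]
    simp_rw [e]
    have := h.tsum_eq
    rw [Pop, ← this]
    exact enorm_tsum_le_tsum_enorm
  · rw [Pop, integral_undef hi]
    simp

theorem aux_main (γ s : ℝ) (hγ : 1 < γ) (hs : 1 / 2 * (1 - 1 / γ) < s) :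
    ∃ C : ℝ, 0 < C ∧ ∀ f : ℝ → ℂ, Measurable f →
      Integrable (fun ξ : ℝ => (1 + ξ ^ 2) ^ s * ‖f ξ‖ ^ 2) volume →
      ∃ N : ℝ → ENNReal, (∀ x, ∀ t ∈ Set.Ioo (0:ℝ) 1, ‖Pop 1 γ f t x‖ₑ ^ 2 ≤ N x) ∧
        ∫⁻ x, N x ≤ ENNReal.ofReal C *
          ENNReal.ofReal (∫ ξ : ℝ, (1 + ξ ^ 2) ^ s * ‖f ξ‖ ^ 2) := by
  have hg0 : 0 < γ := by linarith
  have hs0 : 0 < s := by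
    have : 1 / γ < 1 := by rw [div_lt_one hg0]; exact hγ
    nlinarith
  set ε : ℝ := 2 * s - (1 - 1 / γ) with hε
  have hε0 : 0 < ε := by rw [hε]; linarith
  set q : ℝ := 2 ^ (ε / 2) with hq
  have hq1 : 1 < q := Real.one_lt_rpow one_lt_two (by positivity)
  have hq0 : 0 < q := by linarith
  set S : ℝ := ∑' k : ℕ, ((q⁻¹) ^ 2) ^ k with hS
  have hr1 : (q⁻¹) ^ 2 < 1 := pow_lt_one₀ (by positivity) (inv_lt_one_of_one_lt₀ hq1) (by norm_num)
  have hSs : Summable fun k : ℕ => ((q⁻¹) ^ 2) ^ k := summable_geometric_of_lt_one (by positivity) hr1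
  have hS0 : 0 < S := by
    rw [hS, tsum_geometric_of_lt_one (by positivity) hr1, inv_pos]
    linarith
  have hG : 0 < Real.Gamma (1 / γ + 1) := Real.Gamma_pos_of_pos (by positivity)
  set K : ℝ := Real.exp 2 * Real.Gamma (1 / γ + 1) with hK
  have hK0 : 0 < K := by positivity
  set D : ℝ := (2 + 2 * (1 + γ) ^ 2) * K * 2 ^ s with hD
  have hD0 : 0 < D := by positivity
  refine ⟨S * ((2 * Real.pi) * D), by positivity, fun f hfm hfi => ?_⟩
  have hw1 : ∀ ξ : ℝ, 1 ≤ (1 + ξ ^ 2) ^ s := fun ξ =>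
    Real.one_le_rpow (by nlinarith [sq_nonneg ξ]) hs0.le
  have hf2 : MemLp f 2 := by
    rw [memLp_two_iff_integrable_sq_norm hfm.aestronglyMeasurable]
    refine hfi.mono' (by fun_prop) (.of_forall fun ξ => ?_)
    rw [Real.norm_of_nonneg (by positivity)]
    exact le_mul_of_one_le_left (by positivity) (hw1 ξ)
  -- the pieces
  have hkm : ∀ k, Measurable ((auxA k).indicator f) := fun k => hfm.indicator (auxA_meas k)
  have hk2 : ∀ k, MemLp ((auxA k).indicator f) 2 := fun k => hf2.indicator (auxA_meas k)
  have hk1 : ∀ k, Integrable ((auxA k).indicator f) := by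
    intro k
    rw [integrable_indicator_iff (auxA_meas k)]
    have : IsFiniteMeasure (volume.restrict (auxA k)) := ⟨by simpa using auxA_fin k⟩
    exact (hf2.restrict (auxA k)).integrable one_le_two
  have hbd : ∀ k (ξ : ℝ), ‖((|ξ| : ℝ) : ℂ) * (auxA k).indicator f ξ‖ ≤
      2 ^ (k + 1) * ‖(auxA k).indicator f ξ‖ := by
    intro k ξ
    by_cases h : ξ ∈ auxA k
    · rw [norm_mul, Complex.norm_real, Real.norm_eq_abs, abs_abs]
      have : |ξ| ≤ 2 ^ (k + 1) := by have := h.2; linarith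
      gcongr
    · simp [h]
  have hmm : ∀ k, Measurable fun ξ : ℝ => ((|ξ| : ℝ) : ℂ) * (auxA k).indicator f ξ := by
    intro k
    have := hkm k
    fun_prop
  have P : ∀ k : ℕ, _ := fun k => aux_piece γ (2 ^ k) hγ (by positivity) ((auxA k).indicator f)
    (hkm k) (hk1 k) (hk2 k)
    (((hk1 k).norm.const_mul _).mono' (hmm k).aestronglyMeasurable (.of_forall (hbd k)))
    ((hk2 k).of_le_mul (hmm k).aestronglyMeasurable (.of_forall (hbd k)))
  choose M hMm hMb hMi using P
  refine ⟨fun x => ENNReal.ofReal S * ∑' k, ENNReal.ofReal (q ^ k) ^ 2 * M k x, ?_, ?_⟩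
  · intro x t ht
    have e1 : ∀ k, ‖Pop 1 γ ((auxA k).indicator f) t x‖ₑ = ENNReal.ofReal ((q⁻¹) ^ k) *
        (ENNReal.ofReal (q ^ k) * ‖Pop 1 γ ((auxA k).indicator f) t x‖ₑ) := by
      intro k
      rw [← mul_assoc, ← ENNReal.ofReal_mul (by positivity), ← mul_pow, inv_mul_cancel₀ hq0.ne']
      simp
    have e2 : ∑' k, ENNReal.ofReal ((q⁻¹) ^ k) ^ 2 = ENNReal.ofReal S := by
      rw [hS, ENNReal.ofReal_tsum_of_nonneg (fun k => by positivity) hSs]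
      congr 1
      ext k
      rw [← ENNReal.ofReal_pow (by positivity), ← pow_mul, ← pow_mul, mul_comm]
    have h1 := aux_decomp γ t x f
    rw [tsum_congr e1] at h1
    calc _ ≤ _ := pow_le_pow_left' h1 2
      _ ≤ _ := aux_cs _ _
      _ ≤ _ := by
        rw [e2]
        refine mul_le_mul' le_rfl (ENNReal.tsum_le_tsum fun k => ?_)
        rw [mul_pow]
        exact mul_le_mul' le_rfl (hMb k x t ht)
  · rw [lintegral_const_mul _ (Measurable.tsum fun k => (hMm k).const_mul _),
      lintegral_tsum (fun k => ((hMm k).const_mul _).aemeasurable)]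
    rw [ENNReal.ofReal_mul hS0.le, mul_assoc]
    gcongr
    rw [ENNReal.ofReal_mul (by positivity), mul_assoc]
    rw [ofReal_integral_eq_lintegral_ofReal hfi (.of_forall fun u => by dsimp; positivity)]
    rw [← lintegral_const_mul _ (by fun_prop)]
    rw [← setLIntegral_univ, ← auxA_union, lintegral_iUnion auxA_meas auxA_disj, ← ENNReal.tsum_mul_left]
    refine ENNReal.tsum_le_tsum fun k => ?_
    rw [lintegral_const_mul _ (hMm k), hMi k, mul_left_comm]
    gcongr
    rw [← lintegral_indicator (auxA_meas k), ← lintegral_const_mul']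
    swap
    · exact (ENNReal.pow_lt_top ENNReal.ofReal_lt_top).ne
    refine lintegral_mono fun ξ => ?_
    by_cases h : ξ ∈ auxA k
    swap
    · simp [h]
    simp only [h, Set.indicator_of_mem]
    have ht := aux_time γ ξ hγ
    have hX : 0 < 1 + |ξ| := by positivity
    have b1 : (q ^ k) ^ 2 ≤ (1 + |ξ|) ^ ε := by
      calc (q ^ k) ^ 2 = (2 ^ k : ℝ) ^ ε := by
            rw [← pow_mul, hq, ← Real.rpow_natCast, ← Real.rpow_mul (by norm_num),
              ← Real.rpow_natCast 2 k, ← Real.rpow_mul (by norm_num)]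
            congr 1
            push_cast
            ring
        _ ≤ _ := Real.rpow_le_rpow (by positivity) h.1 hε0.le
    have b2 : 1 + 2 ^ k + (2 ^ k)⁻¹ * (1 + γ) ^ 2 * |ξ| ^ 2 ≤ (2 + 2 * (1 + γ) ^ 2) * (1 + |ξ|) := by
      have c1 := h.1
      have c2 : (2 ^ k : ℝ)⁻¹ * |ξ| ^ 2 ≤ 2 * (1 + |ξ|) := by
        rw [inv_mul_le_iff₀ (by positivity)]
        have := h.2
        rw [pow_succ] at this
        nlinarith [abs_nonneg ξ]
      have c3 : (2 ^ k : ℝ)⁻¹ * (1 + γ) ^ 2 * |ξ| ^ 2 ≤ (1 + γ) ^ 2 * (2 * (1 + |ξ|)) := by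
        calc _ = (1 + γ) ^ 2 * ((2 ^ k : ℝ)⁻¹ * |ξ| ^ 2) := by ring
          _ ≤ _ := by gcongr
      have := abs_nonneg ξ
      linarith
    have b3 : (1 + |ξ|) ^ ε * ((1 + |ξ|) * (1 + |ξ|) ^ (-1 / γ)) ≤ 2 ^ s * (1 + ξ ^ 2) ^ s := by
      calc _ = ((1 + |ξ|) ^ 2) ^ s := by
            rw [← Real.rpow_natCast, ← Real.rpow_mul hX.le, ← Real.rpow_one_add' hX.le, ← Real.rpow_add hX]
            · congr 1
              rw [hε]; push_cast; ring
            · have : 1 / γ < 1 := by rw [div_lt_one hg0]; exact hγ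
              rw [neg_div]
              linarith
        _ ≤ (2 * (1 + ξ ^ 2)) ^ s := by
            apply Real.rpow_le_rpow (by positivity) _ hs0.le
            nlinarith [sq_nonneg (1 - |ξ|), sq_abs ξ]
        _ = _ := Real.mul_rpow (by norm_num) (by positivity)
    rw [← ofReal_norm, ← ENNReal.ofReal_pow (norm_nonneg _), ← ENNReal.ofReal_pow (by positivity)]
    calc _ ≤ ENNReal.ofReal ((1 + |ξ|) ^ ε) * (ENNReal.ofReal (‖f ξ‖ ^ 2) *
          (ENNReal.ofReal ((2 + 2 * (1 + γ) ^ 2) * (1 + |ξ|)) *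
            ENNReal.ofReal (K * (1 + |ξ|) ^ (-1 / γ)))) := by gcongr
      _ = ENNReal.ofReal ((2 + 2 * (1 + γ) ^ 2) * K * ‖f ξ‖ ^ 2 * 
            ((1 + |ξ|) ^ ε * ((1 + |ξ|) * (1 + |ξ|) ^ (-1 / γ)))) := by
          rw [← ENNReal.ofReal_mul (by positivity), ← ENNReal.ofReal_mul (by positivity),
            ← ENNReal.ofReal_mul (by positivity)]
          congr 1; ring
      _ ≤ ENNReal.ofReal ((2 + 2 * (1 + γ) ^ 2) * K * ‖f ξ‖ ^ 2 * (2 ^ s * (1 + ξ ^ 2) ^ s)) := by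
          gcongr
      _ = _ := by
          rw [← ENNReal.ofReal_mul (by positivity), hD]
          congr 1; ring

theorem maximal_global_L2_bound_wave (γ s : ℝ)
    (hγ : 1 < γ) (hs : 1 / 2 * (1 - 1 / γ) < s) :
    ∃ C : ℝ, 0 < C ∧ ∀ fhat : ℝ → ℂ,
      Integrable (fun ξ : ℝ => (1 + ξ ^ 2) ^ s * ‖fhat ξ‖ ^ 2) volume →
      eLpNorm (fun x => Pstar 1 γ fhat x) 2 volume ≤
        ENNReal.ofReal
          (C * (∫ ξ : ℝ, (1 + ξ ^ 2) ^ s * ‖fhat ξ‖ ^ 2) ^ (1 / 2 : ℝ)) := by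
  obtain ⟨C, hC, H⟩ := aux_main γ s hγ hs
  refine ⟨Real.sqrt C, Real.sqrt_pos.2 hC, fun fhat hfi => ?_⟩
  by_cases hm : AEStronglyMeasurable fhat volume
  swap
  · -- not measurable: every integral is zero
    have hz : ∀ t x, Pop 1 γ fhat t x = 0 := by
      intro t x
      unfold Pop
      apply integral_non_aestronglyMeasurable
      intro h
      apply hm
      have hk : Measurable fun ξ : ℝ =>
        (Complex.exp (Complex.I * ((t * |ξ| ^ (1:ℝ) : ℝ) : ℂ) - ((t ^ γ * |ξ| ^ (1:ℝ) : ℝ) : ℂ)) *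
        Complex.exp (Complex.I * ((x * ξ : ℝ) : ℂ)))⁻¹ := by
        simp only [Real.rpow_one]
        fun_prop
      refine (h.mul hk.aestronglyMeasurable).congr (.of_forall fun ξ => ?_)
      simp only [Pi.mul_apply]
      rw [mul_assoc (fhat ξ), mul_assoc (fhat ξ), mul_inv_cancel₀, mul_one]
      exact mul_ne_zero (Complex.exp_ne_zero _) (Complex.exp_ne_zero _)
    have : (fun x => Pstar 1 γ fhat x) = fun _ => (0:ℝ) := by
      ext x
      unfold Pstar
      simp [hz]
    rw [this]
    simp
  set f := hm.mk fhat with hf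
  have hae : fhat =ᵐ[volume] f := hm.ae_eq_mk
  have hfm : Measurable f := hm.stronglyMeasurable_mk.measurable
  have hP : ∀ t x, Pop 1 γ fhat t x = Pop 1 γ f t x := by
    intro t x
    unfold Pop
    apply integral_congr_ae
    filter_upwards [hae] with ξ h
    rw [h]
  have hw : (fun ξ : ℝ => (1 + ξ ^ 2) ^ s * ‖fhat ξ‖ ^ 2) =ᵐ[volume]
      fun ξ : ℝ => (1 + ξ ^ 2) ^ s * ‖f ξ‖ ^ 2 := by
    filter_upwards [hae] with ξ h
    rw [h]
  obtain ⟨N, hN, hNi⟩ := H f hfm (hfi.congr hw)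
  rw [← integral_congr_ae hw] at hNi
  set Q : ℝ := ∫ ξ : ℝ, (1 + ξ ^ 2) ^ s * ‖fhat ξ‖ ^ 2 with hQ
  have hQ0 : 0 ≤ Q := integral_nonneg fun ξ => by positivity
  have hb : ∀ x, ‖Pstar 1 γ fhat x‖ₑ ^ 2 ≤ N x := by
    intro x
    by_cases hx : N x = ⊤
    · rw [hx]; exact le_top
    have h0 : 0 ≤ Pstar 1 γ fhat x := Real.iSup_nonneg fun t => norm_nonneg _
    have h1 : Pstar 1 γ fhat x ≤ Real.sqrt (N x).toReal := by
      apply Real.iSup_le _ (Real.sqrt_nonneg _)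
      intro t
      apply Real.le_sqrt_of_sq_le
      rw [hP]
      have := hN x t t.2
      rw [← ofReal_norm, ← ENNReal.ofReal_pow (norm_nonneg _)] at this
      exact (ENNReal.ofReal_le_iff_le_toReal hx).1 this
    rw [← ofReal_norm, ← ENNReal.ofReal_pow (norm_nonneg _), ENNReal.ofReal_le_iff_le_toReal hx,
      Real.norm_of_nonneg h0]
    calc _ ≤ _ := pow_le_pow_left₀ h0 h1 2
      _ = _ := Real.sq_sqrt ENNReal.toReal_nonneg
  have hsq : eLpNorm (fun x => Pstar 1 γ fhat x) 2 volume ^ 2 ≤ ENNReal.ofReal C * ENNReal.ofReal Q := by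
    have := eLpNorm_nnreal_pow_eq_lintegral (p := 2) (f := fun x => Pstar 1 γ fhat x) (μ := (volume : Measure ℝ)) (by norm_num)
    have e : eLpNorm (fun x => Pstar 1 γ fhat x) 2 volume ^ 2 = ∫⁻ x, ‖Pstar 1 γ fhat x‖ₑ ^ 2 := by
      simpa using this
    rw [e]
    exact (lintegral_mono hb).trans hNi
  rw [← Real.sqrt_eq_rpow, ← Real.sqrt_mul hC.le]
  rw [← ENNReal.ofReal_mul hC.le, ← Real.sq_sqrt (mul_nonneg hC.le hQ0),
    ENNReal.ofReal_pow (Real.sqrt_nonneg _)] at hsq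
  exact (ENNReal.pow_le_pow_left_iff two_ne_zero).1 hsq
end
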